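/- arXiv:0811.0192 — 3 statements merged into one kernel-verified Lean document; each statement's English description precedes it below -/
import Mathlib

section
/- Let Γ be a subgroup of Diff^ω₊(S¹) which has no finite orbit and which has a finite image under the rotation number function. Then Γ is discrete with respect to the C¹-topology, i.e. there is no sequence of elements of Γ∖{id} converging to the identity of S¹ in the C¹-topology. -/
open Filter Topology Set MeasureTheory Classical

noncomputable section

/-- The circle `S¹ = ℝ/ℤ`. -/
abbrev S1 := AddCircle (1 : ℝ)

/-- The group of homeomorphisms of the circle (composition as multiplication). -/
instance : Group (S1 ≃ₜ S1) where
  mul f g := g.trans f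
  one := Homeomorph.refl _
  inv := Homeomorph.symm
  mul_assoc f g h := rfl
  one_mul f := Homeomorph.ext fun _ => rfl
  mul_one f := Homeomorph.ext fun _ => rfl
  inv_mul_cancel f := Homeomorph.ext fun x => f.symm_apply_apply x

/-- `F` is a lift of the circle map `f` to the real line. -/
def IsLiftOf (F : CircleDeg1Lift) (f : S1 ≃ₜ S1) : Prop :=
  ∀ x : ℝ, f (x : S1) = ((F x : ℝ) : S1)

/-- `f` is an orientation-preserving homeomorphism of the circle: it admits a lift to
a monotone homeomorphism of `ℝ` commuting with integer translations. -/
def OrientationPreserving (f : S1 ≃ₜ S1) : Prop :=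
  ∃ F : CircleDeg1Liftˣ, IsLiftOf (F : CircleDeg1Lift) f

/-- The rotation number `ρ(f) ∈ ℝ/ℤ` of an orientation-preserving circle homeomorphism:
the translation number of a lift, taken modulo `ℤ` (independent of the lift). -/
def rotationNumber (f : S1 ≃ₜ S1) : AddCircle (1 : ℝ) :=
  if h : ∃ F : CircleDeg1Liftˣ, IsLiftOf (F : CircleDeg1Lift) f then
    (((h.choose : CircleDeg1Lift).translationNumber : ℝ) : AddCircle (1 : ℝ))
  else 0

/-- The orbit of `x` under a subgroup `Γ` of circle homeomorphisms. -/
def circleOrbit (Γ : Subgroup (S1 ≃ₜ S1)) (x : S1) : Set S1 :=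
  {y : S1 | ∃ γ ∈ Γ, γ x = y}

/-- `Γ` has a finite orbit. -/
def HasFiniteOrbit (Γ : Subgroup (S1 ≃ₜ S1)) : Prop :=
  ∃ x : S1, (circleOrbit Γ x).Finite

/-- `f` is an orientation-preserving real analytic diffeomorphism of the circle: it has a
lift which is a real analytic map `ℝ → ℝ` with everywhere positive derivative. -/
def IsAnalyticDiffeo (f : S1 ≃ₜ S1) : Prop :=
  ∃ F : CircleDeg1Liftˣ, IsLiftOf (F : CircleDeg1Lift) f ∧
    AnalyticOnNhd ℝ (⇑(F : CircleDeg1Lift)) Set.univ ∧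
    ∀ x : ℝ, 0 < deriv (⇑(F : CircleDeg1Lift)) x

/-- `Γ` is nondiscrete with respect to the `C¹`-topology: there is a sequence of elements of
`Γ ∖ {id}` converging to the identity in the `C¹`-topology (expressed via lifts). -/
def C1Nondiscrete (Γ : Subgroup (S1 ≃ₜ S1)) : Prop :=
  ∃ (f : ℕ → S1 ≃ₜ S1) (F : ℕ → CircleDeg1Liftˣ),
    (∀ n, f n ∈ Γ ∧ f n ≠ 1 ∧ IsLiftOf (F n : CircleDeg1Lift) (f n)) ∧
    ∀ ε : ℝ, 0 < ε → ∃ N : ℕ, ∀ n ≥ N, ∀ x : ℝ,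
      |(F n : CircleDeg1Lift) x - x| < ε ∧ |deriv (⇑(F n : CircleDeg1Lift)) x - 1| < ε

/-- `Γ` is locally nondiscrete with respect to the `C¹`-topology: some sequence of elements of
`Γ ∖ {id}` converges to the identity in the `C¹`-topology on some open interval of the circle
(an interval is described by a lift chart `]a, b[` with `b ≤ a + 1`). -/
def LocallyC1Nondiscrete (Γ : Subgroup (S1 ≃ₜ S1)) : Prop :=
  ∃ a b : ℝ, a < b ∧ b ≤ a + 1 ∧
    ∃ (f : ℕ → S1 ≃ₜ S1) (F : ℕ → CircleDeg1Liftˣ),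
      (∀ n, f n ∈ Γ ∧ f n ≠ 1 ∧ IsLiftOf (F n : CircleDeg1Lift) (f n)) ∧
      ∀ ε : ℝ, 0 < ε → ∃ N : ℕ, ∀ n ≥ N, ∀ x ∈ Ioo a b,
        |(F n : CircleDeg1Lift) x - x| < ε ∧ |deriv (⇑(F n : CircleDeg1Lift)) x - 1| < ε

/-- `Γ` is locally nondiscrete with respect to the `C⁰`-topology. -/
def LocallyC0Nondiscrete (Γ : Subgroup (S1 ≃ₜ S1)) : Prop :=
  ∃ a b : ℝ, a < b ∧ b ≤ a + 1 ∧
    ∃ (f : ℕ → S1 ≃ₜ S1) (F : ℕ → CircleDeg1Liftˣ),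
      (∀ n, f n ∈ Γ ∧ f n ≠ 1 ∧ IsLiftOf (F n : CircleDeg1Lift) (f n)) ∧
      ∀ ε : ℝ, 0 < ε → ∃ N : ℕ, ∀ n ≥ N, ∀ x ∈ Ioo a b,
        |(F n : CircleDeg1Lift) x - x| < ε

/-- There is a `Γ`-invariant Borel probability measure on the circle. -/
def HasInvariantProbMeasure (Γ : Subgroup (S1 ≃ₜ S1)) : Prop :=
  ∃ μ : Measure S1, IsProbabilityMeasure μ ∧ ∀ γ ∈ Γ, Measure.map (⇑γ) μ = μ

/-- `Γ` is minimal: every orbit is dense in the circle. -/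
def IsMinimalSubgroup (Γ : Subgroup (S1 ≃ₜ S1)) : Prop :=
  ∀ x : S1, Dense (circleOrbit Γ x)

/-- The closed arc `π([a, b])` of the circle. -/
def closedArc (a b : ℝ) : Set S1 :=
  (fun x : ℝ => (x : S1)) '' Icc a b

/-- The closed arc `π([a,b])` is `Γ`-contractible: some sequence `gₙ ∈ Γ` shrinks its
length to zero (lengths are measured via orientation-preserving lifts). -/
def ContractibleArc (Γ : Subgroup (S1 ≃ₜ S1)) (a b : ℝ) : Prop :=
  ∃ (g : ℕ → S1 ≃ₜ S1) (G : ℕ → CircleDeg1Liftˣ),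
    (∀ n, g n ∈ Γ ∧ IsLiftOf (G n : CircleDeg1Lift) (g n)) ∧
    Tendsto (fun n => (G n : CircleDeg1Lift) b - (G n : CircleDeg1Lift) a) atTop (𝓝 0)

/-- `Φ` is a local flow of the vector field `X` on the set `K` for times `0 ≤ t ≤ t₀`,
staying inside the domain `dom` of `X`. -/
def IsLocalFlowOn (X : ℝ → ℝ) (dom : Set ℝ) (Φ : ℝ → ℝ → ℝ) (K : Set ℝ) (t₀ : ℝ) : Prop :=
  (∀ x ∈ K, Φ 0 x = x) ∧
  ∀ x ∈ K, ∀ t ∈ Icc (0 : ℝ) t₀, Φ t x ∈ dom ∧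
    HasDerivWithinAt (fun s => Φ s x) (X (Φ t x)) (Icc (0 : ℝ) t₀) t

/-- The local vector field `X` on the open interval `]a,b[` (in a lift chart of the circle)
is in the `C⁰`-closure of `Γ` relative to this interval: every time-`t₀` map of its local flow
defined on a compact subinterval is a uniform limit of (lifts of) elements of `Γ`. -/
def InC0Closure (Γ : Subgroup (S1 ≃ₜ S1)) (a b : ℝ) (X : ℝ → ℝ) : Prop :=
  ∀ c d : ℝ, a < c → c ≤ d → d < b →
    ∀ t₀ : ℝ, 0 < t₀ → ∀ Φ : ℝ → ℝ → ℝ,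
      IsLocalFlowOn X (Ioo a b) Φ (Icc c d) t₀ →
      ∃ (γ : ℕ → S1 ≃ₜ S1) (G : ℕ → CircleDeg1Liftˣ),
        (∀ n, γ n ∈ Γ ∧ IsLiftOf (G n : CircleDeg1Lift) (γ n)) ∧
        TendstoUniformlyOn (fun n x => (G n : CircleDeg1Lift) x) (fun x => Φ t₀ x)
          atTop (Icc c d)


/-- Hypotheses on a group of lifts (acting on the line). -/
structure CoreHyp (G : Subgroup (ℝ ≃o ℝ)) (N : ℕ) : Prop where
  add_one : ∀ g ∈ G, ∀ x : ℝ, g (x + 1) = g x + 1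
  trans : ∃ t ∈ G, ∀ x : ℝ, t x = x + 1
  analytic : ∀ g ∈ G, AnalyticOnNhd ℝ (⇑g) univ
  deriv_pos : ∀ g ∈ G, ∀ x : ℝ, 0 < deriv (⇑g) x
  rot : ∀ g ∈ G, ∀ x y : ℝ, ∀ M : ℕ, (g ^ (N + 1)) x ≤ x + 1 → y + 1 ≤ (g ^ M) y → False
  small : ∀ ε : ℝ, 0 < ε → ∃ F ∈ G, F ≠ 1 ∧ (∃ x, F x = x) ∧
    ∀ x : ℝ, |F x - x| < ε ∧ |deriv (⇑F) x - 1| < ε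
  orb : ∀ x : ℝ, ({y : ℝ | ∃ g ∈ G, g x = y} ∩ Icc 0 1).Infinite

/-- A minimal nonempty closed invariant set. -/
structure MinSet (G : Subgroup (ℝ ≃o ℝ)) (A : Set ℝ) : Prop where
  closed : IsClosed A
  nonempty : A.Nonempty
  inv : ∀ g ∈ G, ∀ x ∈ A, g x ∈ A
  min : ∀ B : Set ℝ, IsClosed B → B.Nonempty → (∀ g ∈ G, ∀ x ∈ B, g x ∈ B) → B ⊆ A → B = A

lemma oi_mul (g h : ℝ ≃o ℝ) (x : ℝ) : (g * h) x = g (h x) := rfl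

lemma oi_one (x : ℝ) : (1 : ℝ ≃o ℝ) x = x := rfl

lemma oi_inv_apply (g : ℝ ≃o ℝ) (x : ℝ) : g⁻¹ (g x) = x := g.symm_apply_apply x

lemma oi_apply_inv (g : ℝ ≃o ℝ) (x : ℝ) : g (g⁻¹ x) = x := g.apply_symm_apply x

lemma oi_pow_succ (g : ℝ ≃o ℝ) (n : ℕ) (x : ℝ) : (g ^ (n + 1)) x = (g ^ n) (g x) := by
  rw [pow_succ]; rfl

lemma oi_pow_succ' (g : ℝ ≃o ℝ) (n : ℕ) (x : ℝ) : (g ^ (n + 1)) x = g ((g ^ n) x) := by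
  rw [pow_succ']; rfl

lemma CoreHyp.int_mem {G : Subgroup (ℝ ≃o ℝ)} {N : ℕ} (H : CoreHyp G N) (n : ℤ) :
    ∃ t ∈ G, ∀ x : ℝ, t x = x + n := by
  obtain ⟨t, ht, h⟩ := H.trans
  have h1 : ∀ n : ℕ, ∀ x, (t ^ n) x = x + n := by
    intro n
    induction n with
    | zero => intro x; simp
    | succ k ih => intro x; rw [oi_pow_succ', ih, h]; push_cast; ring
  obtain ⟨k, rfl | rfl⟩ := n.eq_nat_or_neg
  · exact ⟨t ^ k, G.pow_mem ht k, fun x => by simpa using h1 k x⟩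
  · refine ⟨(t ^ k)⁻¹, G.inv_mem (G.pow_mem ht k), fun x => ?_⟩
    apply (t ^ k).injective
    rw [oi_apply_inv, h1]; push_cast; ring

lemma CoreHyp.exists_minSet {G : Subgroup (ℝ ≃o ℝ)} {N : ℕ} (H : CoreHyp G N) :
    ∃ A, MinSet G A := by
  let S : Set (Set ℝ) := {B | IsClosed B ∧ B.Nonempty ∧ ∀ g ∈ G, ∀ x ∈ B, g x ∈ B}
  have hmeet : ∀ B ∈ S, (B ∩ Icc 0 1).Nonempty := by
    rintro B ⟨-, ⟨x, hx⟩, hB⟩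
    obtain ⟨t, ht, h⟩ := H.int_mem (-⌊x⌋)
    refine ⟨t x, hB t ht x hx, ?_⟩
    rw [h]; push_cast
    constructor
    · linarith [Int.floor_le x]
    · linarith [Int.lt_floor_add_one x]
  obtain ⟨A, -, hA⟩ := zorn_superset_nonempty S (by
    intro c hc hchain hne
    refine ⟨⋂₀ c, ⟨isClosed_sInter fun B hB => (hc hB).1, ?_, ?_⟩, fun s hs => sInter_subset_of_mem hs⟩
    · have : (⋂ B : c, (B : Set ℝ) ∩ Icc 0 1).Nonempty := by
        haveI : Nonempty c := hne.to_subtype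
        apply IsCompact.nonempty_iInter_of_directed_nonempty_isCompact_isClosed
        · rintro ⟨B, hB⟩ ⟨C, hC⟩
          rcases hchain.total hB hC with h | h
          · exact ⟨⟨B, hB⟩, subset_rfl, inter_subset_inter_left _ h⟩
          · exact ⟨⟨C, hC⟩, inter_subset_inter_left _ h, subset_rfl⟩
        · rintro ⟨B, hB⟩; exact hmeet B (hc hB)
        · rintro ⟨B, hB⟩; exact isCompact_Icc.inter_left (hc hB).1
        · rintro ⟨B, hB⟩; exact (hc hB).1.inter isClosed_Icc
      obtain ⟨x, hx⟩ := this
      refine ⟨x, fun B hB => ?_⟩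
      exact (mem_iInter.1 hx ⟨B, hB⟩).1
    · intro g hg x hx B hB
      exact (hc hB).2.2 g hg x (hx B hB)) univ ⟨isClosed_univ, univ_nonempty, fun _ _ _ _ => trivial⟩
  refine ⟨A, hA.prop.1, hA.prop.2.1, hA.prop.2.2, fun B h1 h2 h3 h4 => ?_⟩
  exact hA.eq_of_subset ⟨h1, h2, h3⟩ h4

lemma MinSet.dense {G : Subgroup (ℝ ≃o ℝ)} {A : Set ℝ} (hA : MinSet G A) {x y : ℝ} (hx : x ∈ A)
    (hy : y ∈ A) {ε : ℝ} (hε : 0 < ε) : ∃ g ∈ G, |g x - y| < ε := by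
  let O : Set ℝ := {y : ℝ | ∃ g ∈ G, g x = y}
  have h : closure O = A := by
    apply hA.min _ isClosed_closure
    · exact ⟨x, subset_closure ⟨1, G.one_mem, rfl⟩⟩
    · intro g hg
      have : MapsTo g O O := by
        rintro _ ⟨k, hk, rfl⟩
        exact ⟨g * k, G.mul_mem hg hk, rfl⟩
      exact this.closure g.continuous
    · apply closure_minimal _ hA.closed
      rintro _ ⟨k, hk, rfl⟩
      exact hA.inv k hk x hx
  rw [← h, Metric.mem_closure_iff] at hy
  obtain ⟨_, ⟨g, hg, rfl⟩, h2⟩ := hy ε hε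
  refine ⟨g, hg, ?_⟩
  rw [dist_comm] at h2
  exact h2

lemma MinSet.acc {G : Subgroup (ℝ ≃o ℝ)} {N : ℕ} (H : CoreHyp G N)
    {A : Set ℝ} (hA : MinSet G A) {x : ℝ} (hx : x ∈ A)
    {ε : ℝ} (hε : 0 < ε) : ∃ y ∈ A, y ≠ x ∧ |y - x| < ε := by
  have h : derivedSet A = A := by
    apply hA.min _ (isClosed_derivedSet A)
    · obtain ⟨z, -, hz⟩ := (H.orb x).exists_accPt_of_subset_isCompact (isCompact_Icc (a := (0:ℝ)) (b := 1))
        inter_subset_right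
      refine ⟨z, hz.mono (principal_mono.2 ?_)⟩
      rintro _ ⟨⟨g, hg, rfl⟩, -⟩
      exact hA.inv g hg x hx
    · intro g hg z hz
      rw [mem_derivedSet, accPt_iff_nhds] at *
      intro U hU
      obtain ⟨y, ⟨hy1, hy2⟩, hy3⟩ := hz (g ⁻¹' U) (g.continuous.continuousAt hU)
      exact ⟨g y, ⟨hy1, hA.inv g hg y hy2⟩, fun e => hy3 (g.injective e)⟩
    · exact (isClosed_iff_derivedSet_subset A).1 hA.closed
  rw [← h, mem_derivedSet, accPt_iff_nhds] at hx
  obtain ⟨y, ⟨hy1, hy2⟩, hy3⟩ := hx _ (Metric.ball_mem_nhds x hε)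
  exact ⟨y, hy2, hy3, hy1⟩

lemma MinSet.ret {G : Subgroup (ℝ ≃o ℝ)} {N : ℕ} (H : CoreHyp G N)
    {A : Set ℝ} (hA : MinSet G A) {x : ℝ} (hx : x ∈ A)
    {ε : ℝ} (hε : 0 < ε) : ∃ g ∈ G, g x ≠ x ∧ |g x - x| < ε := by
  obtain ⟨y, hy, hne, hlt⟩ := hA.acc H hx hε
  have hpos : 0 < |y - x| := abs_pos.2 (sub_ne_zero.2 hne)
  obtain ⟨g, hg, h⟩ := hA.dense hx hy (lt_min hpos (sub_pos.2 hlt))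
  refine ⟨g, hg, fun e => ?_, ?_⟩
  · rw [e, abs_sub_comm] at h
    exact absurd (h.trans_le (min_le_left _ _)) (lt_irrefl _)
  · have := h.trans_le (min_le_right _ _)
    have h3 := abs_sub_le (g x) y x
    linarith

/-- the fixed points of a nontrivial element are isolated -/
lemma CoreHyp.isolated {G : Subgroup (ℝ ≃o ℝ)} {N : ℕ} (H : CoreHyp G N) {k : ℝ ≃o ℝ} (hk : k ∈ G)
    (hk1 : k ≠ 1) (c : ℝ) : ∃ κ > 0, ∀ x, x ≠ c → |x - c| < κ → k x ≠ x := by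
  by_contra hcon
  push Not at hcon
  apply hk1
  have : (⇑k : ℝ → ℝ) = id := by
    apply AnalyticOnNhd.eq_of_frequently_eq (z₀ := c) (H.analytic k hk) (fun x _ => analyticAt_id)
    rw [frequently_nhdsWithin_iff, Metric.nhds_basis_ball.frequently_iff]
    intro ε hε
    obtain ⟨x, h1, h2, h3⟩ := hcon ε hε
    exact ⟨x, h2, h3, h1⟩
  ext x
  exact congrFun this x

lemma CoreHyp.diff {G : Subgroup (ℝ ≃o ℝ)} {N : ℕ} (H : CoreHyp G N) {k : ℝ ≃o ℝ} (hk : k ∈ G) :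
    Differentiable ℝ (⇑k) := fun x => (H.analytic k hk x trivial).differentiableAt

lemma CoreHyp.contDeriv {G : Subgroup (ℝ ≃o ℝ)} {N : ℕ} (H : CoreHyp G N) {k : ℝ ≃o ℝ} (hk : k ∈ G) :
    Continuous (deriv (⇑k)) := by
  have := (H.analytic k hk).deriv
  exact continuous_iff_continuousAt.2 fun x => (this x trivial).continuousAt

lemma CoreHyp.deriv_mul {G : Subgroup (ℝ ≃o ℝ)} {N : ℕ} (H : CoreHyp G N) {k g : ℝ ≃o ℝ} (hk : k ∈ G)
    (hg : g ∈ G) (x : ℝ) : deriv (⇑(k * g)) x = deriv (⇑k) (g x) * deriv (⇑g) x :=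
  deriv_comp x (H.diff hk _) (H.diff hg x)

lemma CoreHyp.mvt {G : Subgroup (ℝ ≃o ℝ)} {N : ℕ} (H : CoreHyp G N) {k : ℝ ≃o ℝ} (hk : k ∈ G)
    {x y : ℝ} (h : x ≤ y) : ∃ ξ ∈ Icc x y, k y - k x = deriv (⇑k) ξ * (y - x) := by
  rcases h.eq_or_lt with rfl | h
  · exact ⟨x, ⟨le_rfl, le_rfl⟩, by simp⟩
  · obtain ⟨c, hc, h1⟩ := exists_deriv_eq_slope (⇑k) h k.continuous.continuousOn
      (H.diff hk).differentiableOn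
    refine ⟨c, ⟨hc.1.le, hc.2.le⟩, ?_⟩
    rw [h1]; field_simp [sub_ne_zero.2 h.ne']

/-- Lipschitz estimate for the logarithm of the derivative on a compact interval -/
lemma CoreHyp.logLip {G : Subgroup (ℝ ≃o ℝ)} {N : ℕ} (H : CoreHyp G N) {k : ℝ ≃o ℝ} (hk : k ∈ G)
    (a b : ℝ) : ∃ L : ℝ, 0 ≤ L ∧ ∀ x ∈ Icc a b, ∀ y ∈ Icc a b,
      Real.log (deriv (⇑k) x) - Real.log (deriv (⇑k) y) ≤ L * |x - y| := by
  have h1 : ∀ x, AnalyticAt ℝ (fun x => Real.log (deriv (⇑k) x)) x := fun x =>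
    ((H.analytic k hk).deriv x trivial).log (H.deriv_pos k hk x)
  have h2 : ContinuousOn (deriv (fun x => Real.log (deriv (⇑k) x))) (Icc a b) :=
    fun x _ => (h1 x).deriv.continuousAt.continuousWithinAt
  obtain ⟨L, hL⟩ := isCompact_Icc.exists_bound_of_continuousOn h2
  refine ⟨max L 0, le_max_right _ _, fun x hx y hy => ?_⟩
  have := (convex_Icc a b).norm_image_sub_le_of_norm_deriv_le
    (fun z _ => (h1 z).differentiableAt) (fun z hz => (hL z hz).trans (le_max_left L 0)) hy hx
  exact (le_abs_self _).trans this


lemma iter_limit (k : ℝ ≃o ℝ) {x a b : ℝ} (hb : ∀ m : ℕ, (k ^ m) x ∈ Icc a b) :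
    ∃ l ∈ Icc a b, k l = l ∧ Tendsto (fun m : ℕ => (k ^ m) x) atTop (𝓝 l) := by
  have key : ∃ l, Tendsto (fun m : ℕ => (k ^ m) x) atTop (𝓝 l) := by
    rcases le_total (k x) x with h | h
    · have : Antitone (fun m : ℕ => (k ^ m) x) := by
        apply antitone_nat_of_succ_le
        intro m
        rw [oi_pow_succ]
        exact (k ^ m).monotone h
      exact ⟨_, tendsto_atTop_ciInf this ⟨a, by rintro _ ⟨m, rfl⟩; exact (hb m).1⟩⟩
    · have : Monotone (fun m : ℕ => (k ^ m) x) := by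
        apply monotone_nat_of_le_succ
        intro m
        rw [oi_pow_succ]
        exact (k ^ m).monotone h
      exact ⟨_, tendsto_atTop_ciSup this ⟨b, by rintro _ ⟨m, rfl⟩; exact (hb m).2⟩⟩
  obtain ⟨l, hl⟩ := key
  refine ⟨l, isClosed_Icc.mem_of_tendsto hl (Eventually.of_forall hb), ?_, hl⟩
  have h1 : Tendsto (fun m : ℕ => (k ^ (m + 1)) x) atTop (𝓝 l) := hl.comp (tendsto_add_atTop_nat 1)
  have h2 : Tendsto (fun m : ℕ => (k ^ (m + 1)) x) atTop (𝓝 (k l)) := by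
    simp only [oi_pow_succ']
    exact (k.continuous.tendsto l).comp hl
  exact tendsto_nhds_unique h2 h1

lemma pow_fix (k : ℝ ≃o ℝ) {c : ℝ} (h : k c = c) (m : ℕ) : (k ^ m) c = c := by
  induction m with
  | zero => rfl
  | succ m ih => rw [oi_pow_succ, h, ih]

lemma inv_fix (k : ℝ ≃o ℝ) {c : ℝ} (h : k c = c) : k⁻¹ c = c := by
  apply k.injective; rw [oi_apply_inv, h]

lemma contr_right {G : Subgroup (ℝ ≃o ℝ)} {k : ℝ ≃o ℝ} (hk : k ∈ G) {c y : ℝ} (hc : k c = c) (hcy : c < y)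
    (hfix : ∀ x, c < x → x ≤ y → k x ≠ x) :
    ∃ k' ∈ G, k' c = c ∧ Tendsto (fun m : ℕ => (k' ^ m) y) atTop (𝓝 c) := by
  have key : ∀ k' ∈ G, k' c = c → (∀ x, c < x → x ≤ y → k' x ≠ x) → k' y ≤ y →
      Tendsto (fun m : ℕ => (k' ^ m) y) atTop (𝓝 c) := by
    intro k' _ hc' hfix' hle
    have hb : ∀ m : ℕ, (k' ^ m) y ∈ Icc c y := by
      intro m
      induction m with
      | zero => exact ⟨hcy.le, le_rfl⟩
      | succ m ih =>
        rw [oi_pow_succ']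
        exact ⟨hc' ▸ k'.monotone ih.1, (k'.monotone ih.2).trans hle⟩
    obtain ⟨l, hl, hkl, ht⟩ := iter_limit k' hb
    rcases hl.1.eq_or_lt with rfl | h
    · exact ht
    · exact absurd hkl (hfix' l h hl.2)
  rcases le_total (k y) y with h | h
  · exact ⟨k, hk, hc, key k hk hc hfix h⟩
  · refine ⟨k⁻¹, G.inv_mem hk, inv_fix k hc, key _ (G.inv_mem hk) (inv_fix k hc) ?_ ?_⟩
    · intro x h1 h2 h3
      apply hfix x h1 h2
      conv_lhs => rw [← h3]
      exact oi_apply_inv k x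
    · rw [← oi_inv_apply k y]
      simpa [oi_inv_apply] using (k⁻¹).monotone h

lemma contr_left {G : Subgroup (ℝ ≃o ℝ)} {k : ℝ ≃o ℝ} (hk : k ∈ G) {c y : ℝ} (hc : k c = c) (hcy : y < c)
    (hfix : ∀ x, y ≤ x → x < c → k x ≠ x) :
    ∃ k' ∈ G, k' c = c ∧ Tendsto (fun m : ℕ => (k' ^ m) y) atTop (𝓝 c) := by
  have key : ∀ k' ∈ G, k' c = c → (∀ x, y ≤ x → x < c → k' x ≠ x) → y ≤ k' y →
      Tendsto (fun m : ℕ => (k' ^ m) y) atTop (𝓝 c) := by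
    intro k' _ hc' hfix' hle
    have hb : ∀ m : ℕ, (k' ^ m) y ∈ Icc y c := by
      intro m
      induction m with
      | zero => exact ⟨le_rfl, hcy.le⟩
      | succ m ih =>
        rw [oi_pow_succ']
        exact ⟨hle.trans (k'.monotone ih.1), (k'.monotone ih.2).trans hc'.le⟩
    obtain ⟨l, hl, hkl, ht⟩ := iter_limit k' hb
    rcases hl.2.eq_or_lt with rfl | h
    · exact ht
    · exact absurd hkl (hfix' l hl.1 h)
  rcases le_total y (k y) with h | h
  · exact ⟨k, hk, hc, key k hk hc hfix h⟩
  · refine ⟨k⁻¹, G.inv_mem hk, inv_fix k hc, key _ (G.inv_mem hk) (inv_fix k hc) ?_ ?_⟩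
    · intro x h1 h2 h3
      apply hfix x h1 h2
      conv_lhs => rw [← h3]
      exact oi_apply_inv k x
    · rw [← oi_inv_apply k y]
      simpa [oi_inv_apply] using (k⁻¹).monotone h

/-- a pair of maps sending an interval to two disjoint subintervals -/
lemma exists_pair {G : Subgroup (ℝ ≃o ℝ)} {N : ℕ} (H : CoreHyp G N)
    {A : Set ℝ} (hA : MinSet G A) : ∃ g₁ ∈ G, ∃ g₂ ∈ G, ∃ a b : ℝ, a < b ∧ a ≤ g₁ a ∧ g₁ b < g₂ a ∧
      g₂ b ≤ b ∧ ∃ c ∈ A, c ∈ Icc a b := by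
  obtain ⟨k, hk, hk1, ⟨y, hy⟩, -⟩ := H.small 1 one_pos
  -- a fixed point in `A`
  obtain ⟨c, hcA, hc⟩ : ∃ c ∈ A, k c = c := by
    obtain ⟨x, hx⟩ := hA.nonempty
    have hper : ∀ n : ℤ, k (y + n) = y + n := by
      have h1 : ∀ n : ℕ, ∀ z, k (z + n) = k z + n := by
        intro n
        induction n with
        | zero => simp
        | succ n ih => intro z; push_cast; rw [← add_assoc, H.add_one k hk, ih]; ring
      intro n
      obtain ⟨m, rfl | rfl⟩ := n.eq_nat_or_neg
      · simpa [hy] using h1 m y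
      · have := h1 m (y + ((-m : ℤ) : ℝ))
        push_cast at *
        rw [neg_add_cancel_right, hy] at this
        linarith
    have hb : ∀ m : ℕ, (k ^ m) x ∈ Icc (y + ⌊x - y⌋) (y + ⌈x - y⌉) := by
      intro m
      have e1 := (k ^ m).monotone (show y + ⌊x - y⌋ ≤ x by linarith [Int.floor_le (x - y)])
      have e2 := (k ^ m).monotone (show x ≤ y + ⌈x - y⌉ by linarith [Int.le_ceil (x - y)])
      rw [pow_fix k (hper _) m] at e1 e2
      exact ⟨e1, e2⟩
    obtain ⟨l, -, h1, h2⟩ := iter_limit k hb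
    exact ⟨l, hA.closed.mem_of_tendsto h2
      (Eventually.of_forall fun m => hA.inv _ (G.pow_mem hk m) x hx), h1⟩
  obtain ⟨κ, hκ, hiso⟩ := H.isolated hk hk1 c
  obtain ⟨g, hg, hne, hlt⟩ := hA.ret H hcA hκ
  rw [abs_lt] at hlt
  rcases lt_or_gt_of_ne hne with h | h
  · -- left
    obtain ⟨y, hy1, hy2⟩ := exists_between (show c - κ < g c by linarith)
    have hyc : y < c := hy2.trans h
    obtain ⟨k', hk', hc', ht⟩ := contr_left hk hc hyc (fun x h1 h2 => hiso x h2.ne (by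
      rw [abs_lt]; constructor <;> linarith))
    have e1 : ∀ᶠ m in atTop, g c < (k' ^ m) y := ht.eventually_const_lt h
    have e2 : ∀ᶠ m in atTop, y < g ((k' ^ m) y) :=
      ((g.continuous.tendsto c).comp ht).eventually_const_lt hy2
    obtain ⟨m, h1, h2⟩ := (e1.and e2).exists
    refine ⟨g * k' ^ m, G.mul_mem hg (G.pow_mem hk' m), k' ^ m, G.pow_mem hk' m, y, c, hyc,
      h2.le, ?_, (pow_fix k' hc' m).le, c, hcA, hyc.le, le_rfl⟩
    rw [oi_mul, pow_fix k' hc' m]; exact h1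
  · obtain ⟨y, hy2, hy1⟩ := exists_between (show g c < c + κ by linarith)
    have hyc : c < y := h.trans hy2
    obtain ⟨k', hk', hc', ht⟩ := contr_right hk hc hyc (fun x h1 h2 => hiso x h1.ne' (by
      rw [abs_lt]; constructor <;> linarith))
    have e1 : ∀ᶠ m in atTop, (k' ^ m) y < g c := ht.eventually_lt_const h
    have e2 : ∀ᶠ m in atTop, g ((k' ^ m) y) < y :=
      ((g.continuous.tendsto c).comp ht).eventually_lt_const hy2
    obtain ⟨m, h1, h2⟩ := (e1.and e2).exists
    refine ⟨k' ^ m, G.pow_mem hk' m, g * k' ^ m, G.mul_mem hg (G.pow_mem hk' m), c, y, hyc,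
      (pow_fix k' hc' m).ge, ?_, h2.le, c, hcA, le_rfl, hyc.le⟩
    rw [oi_mul, pow_fix k' hc' m]; exact h1

/-- average over words of length `k` -/
def wavg : ℕ → (List Bool → ℝ) → ℝ
  | 0, Φ => Φ []
  | k + 1, Φ => wavg k (fun w => (Φ (true :: w) + Φ (false :: w)) / 2)

lemma wavg_add (k : ℕ) : ∀ Φ Ψ, wavg k (fun w => Φ w + Ψ w) = wavg k Φ + wavg k Ψ := by
  induction k with
  | zero => intros; rfl
  | succ k ih =>
    intro Φ Ψ
    simp only [wavg]
    rw [← ih]; congr 1; ext w; ring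

lemma wavg_smul (k : ℕ) (c : ℝ) : ∀ Φ, wavg k (fun w => c * Φ w) = c * wavg k Φ := by
  induction k with
  | zero => intros; rfl
  | succ k ih =>
    intro Φ
    simp only [wavg]
    rw [← ih]; congr 1; ext w; ring

lemma wavg_exists (k : ℕ) : ∀ Φ, ∃ w, Φ w ≤ wavg k Φ := by
  induction k with
  | zero => exact fun Φ => ⟨[], le_rfl⟩
  | succ k ih =>
    intro Φ
    obtain ⟨w, hw⟩ := ih (fun w => (Φ (true :: w) + Φ (false :: w)) / 2)
    simp only [wavg]
    rcases le_total (Φ (true :: w)) (Φ (false :: w)) with h | h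
    · exact ⟨true :: w, by linarith⟩
    · exact ⟨false :: w, by linarith⟩

/-- the element associated to a word -/
def wordEl (g₁ g₂ : ℝ ≃o ℝ) : List Bool → (ℝ ≃o ℝ)
  | [] => 1
  | b :: w => (if b then g₁ else g₂) * wordEl g₁ g₂ w

/-- sum of the lengths of the images of `[a,b]` by the proper suffixes -/
def wordSum (g₁ g₂ : ℝ ≃o ℝ) (a b : ℝ) : List Bool → ℝ
  | [] => 0
  | _ :: w => (wordEl g₁ g₂ w b - wordEl g₁ g₂ w a) + wordSum g₁ g₂ a b w

lemma exists_hyp {G : Subgroup (ℝ ≃o ℝ)} {N : ℕ} (H : CoreHyp G N)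
    {A : Set ℝ} (hA : MinSet G A) : ∃ h ∈ G, ∃ p ∈ A, h p = p ∧ deriv (⇑h) p < 1 := by
  obtain ⟨g₁, hg₁, g₂, hg₂, a, b, hab, h1, h2, h3, c, hcA, hc⟩ := exists_pair H hA
  set W := wordEl g₁ g₂ with hW
  have hWG : ∀ w, W w ∈ G := by
    intro w
    induction w with
    | nil => exact G.one_mem
    | cons b w ih =>
      refine G.mul_mem ?_ ih
      split_ifs <;> assumption
  have hWJ : ∀ w, ∀ x ∈ Icc a b, W w x ∈ Icc a b := by
    intro w x hx
    induction w with
    | nil => exact hx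
    | cons b' w ih =>
      change (if b' then g₁ else g₂) (W w x) ∈ _
      have m1 := g₁.monotone ih.1
      have m2 := g₁.monotone ih.2
      have m3 := g₂.monotone ih.1
      have m4 := g₂.monotone ih.2
      have m5 := g₁.monotone hab.le
      have m6 := g₂.monotone hab.le
      split_ifs
      · exact ⟨by linarith, by linarith⟩
      · exact ⟨by linarith, by linarith⟩
  -- lengths
  have hlen : ∀ k : ℕ, ∀ u : ℝ ≃o ℝ, wavg k (fun w => u (W w b) - u (W w a)) ≤ (1 / 2) ^ k * (u b - u a) := by
    intro k
    induction k with
    | zero => intro u; simp [wavg, hW, wordEl]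
    | succ k ih =>
      intro u
      have e : (fun w => ((u (W (true :: w) b) - u (W (true :: w) a)) +
          (u (W (false :: w) b) - u (W (false :: w) a))) / 2) =
          fun w => (1/2 : ℝ) * (((u * g₁) (W w b) - (u * g₁) (W w a)) + ((u * g₂) (W w b) - (u * g₂) (W w a))) := by
        ext w
        simp only [hW, wordEl, oi_mul]
        simp
        ring
      simp only [wavg]
      rw [e, wavg_smul, wavg_add]
      have i1 := ih (u * g₁)
      have i2 := ih (u * g₂)
      simp only [oi_mul] at i1 i2 ⊢
      have j1 := u.monotone h1
      have j2 := u.monotone h2.le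
      have j3 := u.monotone h3
      have hp : (0:ℝ) < (1/2) ^ k := by positivity
      have : (1/2:ℝ)^k * (u (g₁ b) - u (g₁ a)) + (1/2:ℝ)^k * (u (g₂ b) - u (g₂ a)) ≤ (1/2:ℝ)^k * (u b - u a) := by
        rw [← mul_add]
        apply mul_le_mul_of_nonneg_left _ hp.le
        linarith
      rw [pow_succ]
      linarith
  have hsum : ∀ k : ℕ, wavg k (wordSum g₁ g₂ a b) ≤ (2 - 2 * (1/2) ^ k) * (b - a) := by
    intro k
    induction k with
    | zero => simp [wavg, wordSum]
    | succ k ih =>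
      have e : (fun w => (wordSum g₁ g₂ a b (true :: w) + wordSum g₁ g₂ a b (false :: w)) / 2) =
          fun w => (W w b - W w a) + wordSum g₁ g₂ a b w := by
        ext w
        simp only [wordSum, ← hW]
        ring
      simp only [wavg]
      rw [e, wavg_add]
      have := hlen k 1
      simp only [oi_one] at this
      rw [pow_succ]
      linarith
  obtain ⟨L₁, hL₁, hl₁⟩ := H.logLip hg₁ a b
  obtain ⟨L₂, hL₂, hl₂⟩ := H.logLip hg₂ a b
  set L := max L₁ L₂ with hL
  have hL0 : 0 ≤ L := hL₁.trans (le_max_left _ _)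
  have hdist : ∀ w, ∀ x ∈ Icc a b, ∀ y ∈ Icc a b,
      Real.log (deriv (⇑(W w)) x) - Real.log (deriv (⇑(W w)) y) ≤ L * wordSum g₁ g₂ a b w := by
    intro w
    induction w with
    | nil =>
      intro x _ y _
      have : (⇑(W []) : ℝ → ℝ) = id := rfl
      rw [this]; simp [wordSum]
    | cons b' w ih =>
      intro x hx y hy
      have hb' : (if b' then g₁ else g₂) ∈ G := by split_ifs <;> assumption
      have e : W (b' :: w) = (if b' then g₁ else g₂) * W w := rfl
      rw [e, H.deriv_mul hb' (hWG w), H.deriv_mul hb' (hWG w),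
        Real.log_mul (H.deriv_pos _ hb' _).ne' (H.deriv_pos _ (hWG w) _).ne',
        Real.log_mul (H.deriv_pos _ hb' _).ne' (H.deriv_pos _ (hWG w) _).ne']
      have i1 := ih x hx y hy
      have hq : |W w x - W w y| ≤ W w b - W w a := by
        have n1 := (W w).monotone hx.1
        have n2 := (W w).monotone hx.2
        have n3 := (W w).monotone hy.1
        have n4 := (W w).monotone hy.2
        rw [abs_le]; constructor <;> linarith
      have i2 : Real.log (deriv (⇑(if b' then g₁ else g₂)) (W w x)) -
          Real.log (deriv (⇑(if b' then g₁ else g₂)) (W w y)) ≤ L * |W w x - W w y| := by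
        split_ifs
        · exact (hl₁ _ (hWJ w x hx) _ (hWJ w y hy)).trans
            (mul_le_mul_of_nonneg_right (le_max_left _ _) (abs_nonneg _))
        · exact (hl₂ _ (hWJ w x hx) _ (hWJ w y hy)).trans
            (mul_le_mul_of_nonneg_right (le_max_right _ _) (abs_nonneg _))
      have i3 := mul_le_mul_of_nonneg_left hq hL0
      simp only [wordSum, ← hW]
      rw [mul_add]
      linarith
  have hba : 0 < b - a := sub_pos.2 hab
  obtain ⟨k, hk⟩ : ∃ k : ℕ, Real.exp (L * (3 * (b - a))) * 3 * (1/2:ℝ) ^ k < 1 := by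
    have : Tendsto (fun k : ℕ => Real.exp (L * (3 * (b - a))) * 3 * (1/2:ℝ) ^ k) atTop (𝓝 (Real.exp (L * (3 * (b - a))) * 3 * 0)) :=
      (tendsto_pow_atTop_nhds_zero_of_lt_one (by norm_num) (by norm_num)).const_mul _
    rw [mul_zero] at this
    exact (this.eventually_lt_const one_pos).exists
  obtain ⟨w, hw⟩ := wavg_exists k (fun w => wordSum g₁ g₂ a b w + 2 ^ k * (W w b - W w a))
  rw [wavg_add, wavg_smul] at hw
  have hl := hlen k 1
  simp only [oi_one] at hl
  have hp2 : (0:ℝ) < 2 ^ k := by positivity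
  have hpp : (2:ℝ) ^ k * (1/2) ^ k = 1 := by rw [← mul_pow]; norm_num
  have hl2 : 2 ^ k * wavg k (fun w => W w b - W w a) ≤ b - a := by
    calc _ ≤ (2:ℝ) ^ k * ((1/2) ^ k * (b - a)) := mul_le_mul_of_nonneg_left hl hp2.le
      _ = b - a := by rw [← mul_assoc, hpp, one_mul]
  have hs := hsum k
  have hp3 : (0:ℝ) < (1/2) ^ k := by positivity
  have hS : wordSum g₁ g₂ a b w + 2 ^ k * (W w b - W w a) ≤ 3 * (b - a) := by
    nlinarith
  have hSpos : ∀ w, 0 ≤ wordSum g₁ g₂ a b w := by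
    intro w
    induction w with
    | nil => simp [wordSum]
    | cons b' w ih =>
      simp only [wordSum]
      have := (wordEl g₁ g₂ w).monotone hab.le
      linarith
  have hlenpos : 0 ≤ W w b - W w a := sub_nonneg.2 ((W w).monotone hab.le)
  have hS1 : wordSum g₁ g₂ a b w ≤ 3 * (b - a) := by nlinarith
  have hS2 : W w b - W w a ≤ 3 * (b - a) * (1/2) ^ k := by
    have := hSpos w
    have h5 : 2 ^ k * (W w b - W w a) ≤ 3 * (b - a) := by linarith
    calc W w b - W w a = (2 ^ k * (W w b - W w a)) * (1/2) ^ k := by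
          rw [mul_right_comm, hpp, one_mul]
      _ ≤ _ := mul_le_mul_of_nonneg_right h5 hp3.le
  have hder : ∀ x ∈ Icc a b, deriv (⇑(W w)) x < 1 := by
    intro x hx
    obtain ⟨ξ, hξ, hm⟩ := H.mvt (hWG w) hab.le
    have hd := hdist w x hx ξ hξ
    have hd2 : Real.log (deriv (⇑(W w)) x) ≤ Real.log (deriv (⇑(W w)) ξ) + L * (3 * (b - a)) := by
      have := mul_le_mul_of_nonneg_left hS1 hL0
      linarith
    have p1 := H.deriv_pos _ (hWG w) x
    have p2 := H.deriv_pos _ (hWG w) ξ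
    have hd3 : deriv (⇑(W w)) x ≤ deriv (⇑(W w)) ξ * Real.exp (L * (3 * (b - a))) := by
      rw [← Real.exp_log p1, ← Real.exp_log p2, ← Real.exp_add]
      exact Real.exp_le_exp.2 hd2
    have hd4 : deriv (⇑(W w)) ξ ≤ 3 * (1/2) ^ k := by
      rw [hm] at hS2
      by_contra hcon
      push Not at hcon
      have := mul_lt_mul_of_pos_right hcon hba
      linarith
    calc _ ≤ _ := hd3
      _ ≤ (3 * (1/2) ^ k) * Real.exp (L * (3 * (b - a))) :=
        mul_le_mul_of_nonneg_right hd4 (Real.exp_pos _).le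
      _ < 1 := by linarith
  obtain ⟨l, hl, hfix, ht⟩ := iter_limit (W w) (x := c) (a := a) (b := b) (by
    intro m
    induction m with
    | zero => exact hc
    | succ m ih => rw [oi_pow_succ']; exact hWJ w _ ih)
  exact ⟨W w, hWG w, l, hA.closed.mem_of_tendsto ht
      (Eventually.of_forall fun m => hA.inv _ (G.pow_mem (hWG w) m) c hcA), hfix, hder l hl⟩


lemma CoreHyp.mvt_abs {G : Subgroup (ℝ ≃o ℝ)} {N : ℕ} (H : CoreHyp G N) {k : ℝ ≃o ℝ} (hk : k ∈ G)
    {a b B : ℝ} (hB : ∀ x ∈ Icc a b, deriv (⇑k) x ≤ B) {x y : ℝ} (hx : x ∈ Icc a b) (hy : y ∈ Icc a b) :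
    |k x - k y| ≤ B * |x - y| := by
  have key : ∀ x y : ℝ, x ∈ Icc a b → y ∈ Icc a b → x ≤ y → |k x - k y| ≤ B * |x - y| := by
    intro x y hx hy hxy
    obtain ⟨ξ, hξ, h⟩ := H.mvt hk hxy
    have h1 : k x ≤ k y := k.monotone hxy
    rw [abs_sub_comm, abs_sub_comm x y, abs_of_nonneg (by linarith), abs_of_nonneg (by linarith), h]
    apply mul_le_mul_of_nonneg_right (hB ξ ⟨hx.1.trans hξ.1, hξ.2.trans hy.2⟩); linarith
  rcases le_total x y with h | h
  · exact key x y hx hy h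
  · rw [abs_sub_comm, abs_sub_comm x y]; exact key y x hy hx h

lemma exists_ifs {G : Subgroup (ℝ ≃o ℝ)} {N : ℕ} (H : CoreHyp G N)
    {A : Set ℝ} (hA : MinSet G A) : ∃ p ∈ A, ∃ δ > 0, ∃ g₁ ∈ G, ∃ g₂ ∈ G, g₁ p = p ∧ g₂ p ≠ p ∧
      ∀ x ∈ Icc (p - δ) (p + δ), g₁ x ∈ Icc (p - δ) (p + δ) ∧ g₂ x ∈ Icc (p - δ) (p + δ) ∧
        deriv (⇑g₁) x ≤ 1 / 2 ∧ deriv (⇑g₂) x ≤ 1 / 2 := by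
  obtain ⟨h, hh, p, hp, hfix, hd⟩ := exists_hyp H hA
  obtain ⟨l, hl1, hl2⟩ := exists_between hd
  have hl0 : 0 < l := (H.deriv_pos h hh p).trans hl1
  obtain ⟨δ, hδ, hball⟩ := Metric.isOpen_iff.1 (isOpen_lt (H.contDeriv hh) continuous_const) p hl1
  refine ⟨p, hp, δ / 2, by positivity, ?_⟩
  set r := δ / 2 with hr
  have hr0 : 0 < r := by positivity
  have hD : ∀ x ∈ Icc (p - r) (p + r), deriv (⇑h) x ≤ l := by
    intro x hx
    have : x ∈ Metric.ball p δ := by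
      rw [Metric.mem_ball, Real.dist_eq, abs_lt]; constructor <;> linarith [hx.1, hx.2]
    exact (hball this).le
  have hpJ : p ∈ Icc (p - r) (p + r) := ⟨by linarith, by linarith⟩
  have memJ : ∀ x, x ∈ Icc (p - r) (p + r) ↔ |x - p| ≤ r := by
    intro x; rw [abs_le, mem_Icc]; constructor <;> rintro ⟨h1, h2⟩ <;> constructor <;> linarith
  have hpow : ∀ m : ℕ, ∀ x ∈ Icc (p - r) (p + r), |(h ^ m) x - p| ≤ l ^ m * |x - p| ∧
      deriv (⇑(h ^ m)) x ≤ l ^ m := by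
    intro m
    induction m with
    | zero =>
      intro x hx
      refine ⟨by simp, ?_⟩
      have : (⇑((h:ℝ ≃o ℝ) ^ 0) : ℝ → ℝ) = id := rfl
      rw [this]; simp
    | succ m ih =>
      intro x hx
      obtain ⟨i1, i2⟩ := ih x hx
      have hJ : (h ^ m) x ∈ Icc (p - r) (p + r) := by
        rw [memJ] at hx ⊢
        refine i1.trans (le_trans ?_ hx)
        exact mul_le_of_le_one_left (abs_nonneg _) (pow_le_one₀ hl0.le hl2.le)
      constructor
      · rw [oi_pow_succ']
        have := H.mvt_abs hh hD hJ hpJ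
        rw [hfix] at this
        refine this.trans ?_
        rw [pow_succ', mul_assoc]
        exact mul_le_mul_of_nonneg_left i1 hl0.le
      · rw [pow_succ', H.deriv_mul hh (G.pow_mem hh m), pow_succ']
        exact mul_le_mul (hD _ hJ) i2 (H.deriv_pos _ (G.pow_mem hh m) x).le hl0.le
  obtain ⟨g, hg, hq, hqr⟩ := hA.ret H hp hr0
  obtain ⟨B, hB⟩ := (isCompact_Icc (a := p - r) (b := p + r)).bddAbove_image (H.contDeriv hg).continuousOn
  have hB' : ∀ x ∈ Icc (p - r) (p + r), deriv (⇑g) x ≤ B := fun x hx => hB ⟨x, hx, rfl⟩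
  have hB0 : 0 < B := (H.deriv_pos g hg p).trans_le (hB' p hpJ)
  have ht : Tendsto (fun m : ℕ => l ^ m) atTop (𝓝 0) := tendsto_pow_atTop_nhds_zero_of_lt_one hl0.le hl2
  obtain ⟨m, hm⟩ := ((ht.eventually (gt_mem_nhds (show (0:ℝ) < min (1/2) (min (1/(2*B)) ((r - |g p - p|)/(B*r))) by
    have : 0 < r - |g p - p| := by linarith
    positivity)))).exists
  have hm1 : l ^ m < 1/2 := hm.trans_le (min_le_left _ _)
  have hm2 : B * l ^ m < 1/2 := by
    have := hm.trans_le ((min_le_right _ _).trans (min_le_left _ _))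
    rw [lt_div_iff₀ (by positivity)] at this; linarith
  have hm3 : B * (l ^ m * r) < r - |g p - p| := by
    have := hm.trans_le ((min_le_right _ _).trans (min_le_right _ _))
    rw [lt_div_iff₀ (by positivity)] at this; linarith
  have hmG := G.pow_mem hh m
  have hmap : ∀ x ∈ Icc (p - r) (p + r), |(h ^ m) x - p| ≤ l ^ m * r := by
    intro x hx
    exact (hpow m x hx).1.trans (mul_le_mul_of_nonneg_left ((memJ x).1 hx) (by positivity))
  have hmap' : ∀ x ∈ Icc (p - r) (p + r), (h ^ m) x ∈ Icc (p - r) (p + r) := by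
    intro x hx
    rw [memJ]
    exact (hmap x hx).trans (by nlinarith)
  refine ⟨h ^ m, hmG, g * h ^ m, G.mul_mem hg hmG, pow_fix h hfix m, ?_, ?_⟩
  · rw [oi_mul, pow_fix h hfix]; exact hq
  · intro x hx
    refine ⟨hmap' x hx, ?_, (hpow m x hx).2.trans hm1.le, ?_⟩
    · rw [memJ, oi_mul]
      have := H.mvt_abs hg hB' (hmap' x hx) hpJ
      have h2 : B * |(h ^ m) x - p| ≤ B * (l ^ m * r) := mul_le_mul_of_nonneg_left (hmap x hx) hB0.le
      have h3 := abs_sub_le (g ((h ^ m) x)) (g p) p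
      linarith
    · rw [H.deriv_mul hg hmG]
      have := mul_le_mul (hB' _ (hmap' x hx)) (hpow m x hx).2 (H.deriv_pos _ hmG x).le hB0.le
      linarith


/-- Right-nested compositions of two maps along a sequence. -/
def uSeq (g₁ g₂ : ℝ ≃o ℝ) (w : ℕ → Bool) : ℕ → (ℝ ≃o ℝ)
  | 0 => 1
  | i + 1 => uSeq g₁ g₂ w i * (if w i then g₂ else g₁)

lemma uSeq_spec {G : Subgroup (ℝ ≃o ℝ)} {N : ℕ} (H : CoreHyp G N) {a b L : ℝ} (hL : 0 ≤ L)
    {g₁ g₂ : ℝ ≃o ℝ} (hg₁ : g₁ ∈ G) (hg₂ : g₂ ∈ G)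
    (hJ : ∀ x ∈ Icc a b, g₁ x ∈ Icc a b ∧ g₂ x ∈ Icc a b ∧ deriv (⇑g₁) x ≤ 1 / 2 ∧ deriv (⇑g₂) x ≤ 1 / 2)
    (hL1 : ∀ x ∈ Icc a b, ∀ y ∈ Icc a b,
      Real.log (deriv (⇑g₁) x) - Real.log (deriv (⇑g₁) y) ≤ L * |x - y|)
    (hL2 : ∀ x ∈ Icc a b, ∀ y ∈ Icc a b,
      Real.log (deriv (⇑g₂) x) - Real.log (deriv (⇑g₂) y) ≤ L * |x - y|)
    (w : ℕ → Bool) (i : ℕ) :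
    uSeq g₁ g₂ w i ∈ G ∧ (∀ x ∈ Icc a b, deriv (⇑(uSeq g₁ g₂ w i)) x ≤ (1 / 2) ^ i) ∧
    ∀ x ∈ Icc a b, ∀ y ∈ Icc a b,
      Real.log (deriv (⇑(uSeq g₁ g₂ w i)) x) - Real.log (deriv (⇑(uSeq g₁ g₂ w i)) y) ≤ 2 * L * |x - y| := by
  induction i with
  | zero =>
    have e : (⇑(uSeq g₁ g₂ w 0) : ℝ → ℝ) = id := rfl
    refine ⟨G.one_mem, fun x _ => ?_, fun x _ y _ => ?_⟩
    · rw [e]; simp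
    · rw [e]; simp; positivity
  | succ i ih =>
    obtain ⟨i1, i2, i3⟩ := ih
    have key : ∀ g ∈ G, (∀ x ∈ Icc a b, g x ∈ Icc a b ∧ deriv (⇑g) x ≤ 1 / 2) →
        (∀ x ∈ Icc a b, ∀ y ∈ Icc a b,
      Real.log (deriv (⇑g) x) - Real.log (deriv (⇑g) y) ≤ L * |x - y|) →
      (uSeq g₁ g₂ w i * g ∈ G ∧ (∀ x ∈ Icc a b, deriv (⇑(uSeq g₁ g₂ w i * g)) x ≤ (1 / 2) ^ (i + 1)) ∧
    ∀ x ∈ Icc a b, ∀ y ∈ Icc a b,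
      Real.log (deriv (⇑(uSeq g₁ g₂ w i * g)) x) - Real.log (deriv (⇑(uSeq g₁ g₂ w i * g)) y) ≤ 2 * L * |x - y|) := by
      intro g hg hgJ hgL
      refine ⟨G.mul_mem i1 hg, fun x hx => ?_, fun x hx y hy => ?_⟩
      · rw [H.deriv_mul i1 hg, pow_succ]
        exact mul_le_mul (i2 _ (hgJ x hx).1) (hgJ x hx).2 (H.deriv_pos g hg x).le (by positivity)
      · rw [H.deriv_mul i1 hg, H.deriv_mul i1 hg,
          Real.log_mul (H.deriv_pos _ i1 _).ne' (H.deriv_pos g hg x).ne',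
          Real.log_mul (H.deriv_pos _ i1 _).ne' (H.deriv_pos g hg y).ne']
        have e1 := i3 _ (hgJ x hx).1 _ (hgJ y hy).1
        have e2 := hgL x hx y hy
        have e3 := H.mvt_abs hg (fun x hx => (hgJ x hx).2) hx hy
        have e4 := mul_le_mul_of_nonneg_left e3 (show 0 ≤ 2 * L by positivity)
        linarith
    rw [uSeq]
    by_cases hw : w i = true
    · rw [if_pos hw]
      exact key g₂ hg₂ (fun x hx => ⟨(hJ x hx).2.1, (hJ x hx).2.2.2⟩) hL2
    · rw [if_neg hw]
      exact key g₁ hg₁ (fun x hx => ⟨(hJ x hx).1, (hJ x hx).2.2.1⟩) hL1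

lemma uSeq_point (g₁ g₂ : ℝ ≃o ℝ) {a b p : ℝ} (hp : p ∈ Icc a b) (hfix : g₁ p = p)
    (hJ : ∀ x ∈ Icc a b, g₁ x ∈ Icc a b ∧ g₂ x ∈ Icc a b) (j : ℕ) :
    ∃ w : ℕ → Bool, ∀ i, ∃ y ∈ Icc a b, uSeq g₁ g₂ w i y = (g₁ ^ j) (g₂ p) := by
  refine ⟨fun i => decide (i = j), ?_⟩
  have h1 : ∀ i, i ≤ j → uSeq g₁ g₂ (fun i => decide (i = j)) i = g₁ ^ i := by
    intro i
    induction i with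
    | zero => intro _; rfl
    | succ i ih =>
      intro hi
      rw [uSeq, ih (by omega), if_neg (by simp; omega), pow_succ]
  have h2 : ∀ k, uSeq g₁ g₂ (fun i => decide (i = j)) (j + 1 + k) p = (g₁ ^ j) (g₂ p) := by
    intro k
    induction k with
    | zero => rw [add_zero, uSeq, h1 j le_rfl, if_pos (by simp)]; rfl
    | succ k ih =>
      rw [← add_assoc, uSeq, if_neg (by simp; omega), oi_mul, hfix, ih]
  have h3 : ∀ m, (g₁ ^ m) (g₂ p) ∈ Icc a b := by
    intro m
    induction m with
    | zero => exact (hJ p hp).2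
    | succ m ih => rw [oi_pow_succ']; exact (hJ _ ih).1
  intro i
  rcases le_or_gt i j with h | h
  · refine ⟨(g₁ ^ (j - i)) (g₂ p), h3 _, ?_⟩
    rw [h1 i h, ← oi_mul, ← pow_add]; congr 2; omega
  · obtain ⟨k, rfl⟩ := Nat.exists_eq_add_of_lt h
    refine ⟨p, hp, ?_⟩
    have := h2 k
    rwa [show j + 1 + k = j + k + 1 by omega] at this

lemma CoreHyp.small2 {G : Subgroup (ℝ ≃o ℝ)} {N : ℕ} (H : CoreHyp G N) {ε : ℝ} (hε : 0 < ε) :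
    ∃ F ∈ G, F ≠ 1 ∧ (∀ x : ℝ, |F x - x| < ε ∧ |deriv (⇑F) x - 1| < ε) ∧
      (∀ x : ℝ, |F⁻¹ x - x| < ε ∧ |deriv (⇑F⁻¹) x - 1| < ε) := by
  obtain ⟨F, hF, h1, -, h2⟩ := H.small (min (ε / 2) (1 / 2)) (by positivity)
  have h3 : ∀ x : ℝ, |F x - x| < ε / 2 ∧ |deriv (⇑F) x - 1| < ε / 2 ∧ |deriv (⇑F) x - 1| < 1 / 2 := fun x =>
    ⟨(h2 x).1.trans_le (min_le_left _ _), (h2 x).2.trans_le (min_le_left _ _),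
      (h2 x).2.trans_le (min_le_right _ _)⟩
  refine ⟨F, hF, h1, fun x => ⟨by linarith [(h3 x).1], by linarith [(h3 x).2.1]⟩, fun x => ⟨?_, ?_⟩⟩
  · have := (h3 (F⁻¹ x)).1
    rw [oi_apply_inv, abs_sub_comm] at this; linarith
  · have e := H.deriv_mul hF (G.inv_mem hF) x
    rw [mul_inv_cancel] at e
    have e1 : (⇑(1 : ℝ ≃o ℝ) : ℝ → ℝ) = id := rfl
    rw [e1, deriv_id] at e
    obtain ⟨-, e2, e3⟩ := h3 (F⁻¹ x)
    set A := deriv (⇑F) (F⁻¹ x)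
    set B := deriv (⇑F⁻¹) x
    have hB : 0 < B := H.deriv_pos _ (G.inv_mem hF) x
    rw [abs_lt] at e2 e3
    have hB2 : B < 2 := by nlinarith
    rw [abs_lt]; constructor <;> nlinarith


lemma flow_step {G : Subgroup (ℝ ≃o ℝ)} {N : ℕ} (H : CoreHyp G N) {u F : ℝ ≃o ℝ} (hu : u ∈ G) (hF : F ∈ G)
    {p δ L E a s Λ ε y₀ : ℝ} (hδ : 0 < δ) (hL : 0 ≤ L) (hE : 1 ≤ E) (ha : 0 < a) (hs : 0 < s) (hΛ : 0 < Λ)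
    (hua : ∀ x ∈ Icc (p - δ) (p + δ), a / E ≤ deriv (⇑u) x ∧ deriv (⇑u) x ≤ E * a)
    (huL : ∀ x ∈ Icc (p - δ) (p + δ), ∀ y ∈ Icc (p - δ) (p + δ),
      Real.log (deriv (⇑u) x) - Real.log (deriv (⇑u) y) ≤ L * |x - y|)
    (hy₀ : y₀ ∈ Icc (p - δ) (p + δ)) (hd1 : s * a ≤ F (u y₀) - u y₀) (hd2 : F (u y₀) - u y₀ ≤ Λ * s * a)
    (hε : ∀ x, |deriv (⇑F) x - 1| < ε) (hεs : ε ≤ s) (hεδ : ε * (2 * δ * E) ≤ s / 2)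
    (hsδ : s * (Λ + 1) * E < δ / 2) :
    ∀ x ∈ Icc (p - δ / 2) (p + δ / 2), x + s / (2 * E) ≤ (u⁻¹ * F * u) x ∧
      (u⁻¹ * F * u) x ≤ x + (Λ + 1) * E * s ∧
      deriv (⇑(u⁻¹ * F * u)) x ≤ Real.exp ((1 + L * ((Λ + 1) * E)) * s) := by
  have hE0 : 0 < E := by linarith
  have hε0 : 0 < ε := (abs_nonneg _).trans_lt (hε 0)
  -- displacement comparison
  have disp : ∀ x ∈ Icc (p - δ) (p + δ), s * a / 2 ≤ F (u x) - u x ∧ F (u x) - u x ≤ (Λ + 1) * s * a := by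
    intro x hx
    have h1 : |u x - u y₀| ≤ E * a * |x - y₀| := H.mvt_abs hu (fun x hx => (hua x hx).2) hx hy₀
    have h2 : |x - y₀| ≤ 2 * δ := by
      rw [abs_le]; constructor <;> linarith [hx.1, hx.2, hy₀.1, hy₀.2]
    have key : ∀ b c : ℝ, b ≤ c → |(F c - c) - (F b - b)| ≤ ε * |c - b| := by
      intro b c hbc
      obtain ⟨ξ, -, h⟩ := H.mvt hF hbc
      have : (F c - c) - (F b - b) = (deriv (⇑F) ξ - 1) * (c - b) := by linarith
      rw [this, abs_mul]
      exact mul_le_mul_of_nonneg_right (hε ξ).le (abs_nonneg _)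
    have h3 : |(F (u x) - u x) - (F (u y₀) - u y₀)| ≤ ε * |u x - u y₀| := by
      rcases le_total (u y₀) (u x) with h | h
      · exact key _ _ h
      · rw [abs_sub_comm, abs_sub_comm (u x)]; exact key _ _ h
    have h4 : ε * |u x - u y₀| ≤ s / 2 * a := by
      calc ε * |u x - u y₀| ≤ ε * (E * a * (2 * δ)) := by
            apply mul_le_mul_of_nonneg_left _ hε0.le
            exact h1.trans (mul_le_mul_of_nonneg_left h2 (by positivity))
        _ = ε * (2 * δ * E) * a := by ring
        _ ≤ _ := mul_le_mul_of_nonneg_right hεδ ha.le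
    have h5 := abs_le.1 (h3.trans h4)
    have : 0 < s * a := by positivity
    constructor <;> linarith [h5.1, h5.2]
  intro x hx
  set γ := u⁻¹ * F * u with hγ
  have hγG : γ ∈ G := G.mul_mem (G.mul_mem (G.inv_mem hu) hF) hu
  have hconj : ∀ x, u (γ x) = F (u x) := fun x => by
    rw [hγ, oi_mul, oi_mul, oi_apply_inv]
  have hxJ : x ∈ Icc (p - δ) (p + δ) := ⟨by linarith [hx.1], by linarith [hx.2]⟩
  obtain ⟨d1, d2⟩ := disp x hxJ
  have hsa : 0 < s * a := by positivity
  have hlt : x < γ x := by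
    rw [← u.lt_iff_lt, hconj]; linarith
  have hγJ : γ x ≤ p + δ := by
    by_contra! hcon
    rw [← u.lt_iff_lt, hconj] at hcon
    obtain ⟨ξ, hξ, h⟩ := H.mvt hu hxJ.2
    have h1 := (hua ξ ⟨hxJ.1.trans hξ.1, hξ.2⟩).1
    have h2 : a / E * (δ / 2) ≤ deriv (⇑u) ξ * (p + δ - x) := by
      apply mul_le_mul h1 (by linarith [hx.2]) (by linarith) (H.deriv_pos u hu ξ).le
    have h3 : (Λ + 1) * s * a < a / E * (δ / 2) := by
      rw [div_mul_eq_mul_div, lt_div_iff₀ hE0]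
      nlinarith
    linarith
  have hγJ' : γ x ∈ Icc (p - δ) (p + δ) := ⟨hxJ.1.trans hlt.le, hγJ⟩
  have hup : γ x ≤ x + (Λ + 1) * E * s ∧ x + s / (2 * E) ≤ γ x := by
    obtain ⟨ξ, hξ, h⟩ := H.mvt hu hlt.le
    rw [hconj] at h
    obtain ⟨h1, h2⟩ := hua ξ ⟨hxJ.1.trans hξ.1, hξ.2.trans hγJ⟩
    have hpos : 0 < γ x - x := by linarith
    constructor
    · have h3 : a / E * (γ x - x) ≤ (Λ + 1) * s * a := by
        have := mul_le_mul_of_nonneg_right h1 hpos.le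
        linarith
      rw [div_mul_eq_mul_div, div_le_iff₀ hE0] at h3
      have h4 : a * (γ x - x) ≤ a * ((Λ + 1) * E * s) := by linarith
      linarith [le_of_mul_le_mul_left h4 ha]
    · have h3 : s * a / 2 ≤ E * a * (γ x - x) := by
        have := mul_le_mul_of_nonneg_right h2 hpos.le
        linarith
      have h4 : a * s ≤ a * ((γ x - x) * (2 * E)) := by linarith
      have h5 := le_of_mul_le_mul_left h4 ha
      rw [← div_le_iff₀ (by positivity)] at h5
      linarith
  refine ⟨hup.2, hup.1, ?_⟩
  have e1 : u * γ = F * u := by rw [hγ]; group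
  have e2 := H.deriv_mul hu hγG x
  rw [e1, H.deriv_mul hF hu] at e2
  have e3 := huL x hxJ (γ x) hγJ'
  have e4 : L * |x - γ x| ≤ L * ((Λ + 1) * E) * s := by
    rw [abs_sub_comm, abs_of_pos (by linarith), mul_assoc]
    apply mul_le_mul_of_nonneg_left _ hL; linarith [hup.1]
  have p1 := H.deriv_pos u hu x
  have p2 := H.deriv_pos u hu (γ x)
  have p3 := H.deriv_pos γ hγG x
  have e5 : deriv (⇑u) x ≤ deriv (⇑u) (γ x) * Real.exp (L * ((Λ + 1) * E) * s) := by
    rw [← Real.exp_log p1, ← Real.exp_log p2, ← Real.exp_add]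
    apply Real.exp_le_exp.2; linarith
  have e6 : deriv (⇑F) (u x) ≤ Real.exp s := by
    have := (abs_lt.1 (hε (u x))).2
    linarith [Real.add_one_le_exp s]
  have e7 : deriv (⇑u) (γ x) * deriv (⇑γ) x ≤
      deriv (⇑u) (γ x) * Real.exp ((1 + L * ((Λ + 1) * E)) * s) := by
    rw [← e2, add_mul, one_mul, Real.exp_add]
    calc _ ≤ Real.exp s * (deriv (⇑u) (γ x) * Real.exp (L * ((Λ + 1) * E) * s)) :=
          mul_le_mul e6 e5 p1.le (Real.exp_pos _).le
      _ = _ := by ring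
  exact le_of_mul_le_mul_left e7 p2

/-- Output of the renormalization procedure. -/
structure FlowData (G : Subgroup (ℝ ≃o ℝ)) (A : Set ℝ) (p α β C K s₀ : ℝ) : Prop where
  pA : p ∈ A
  hα : α < p
  hβ : p < β
  hC : 0 < C
  hK : 0 < K
  hs₀ : 0 < s₀
  flow : ∀ s, 0 < s → s < s₀ → ∃ γ ∈ G, (∀ x ∈ Icc α β, x + s ≤ γ x ∧ γ x ≤ x + C * s) ∧
    ∀ x ∈ Icc α β, ∀ y ∈ Icc α β, x ≤ y → γ y - γ x ≤ Real.exp (K * s) * (y - x)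
  contr : ∀ ε : ℝ, 0 < ε → ∃ k ∈ G, ∀ x ∈ Icc α β, |k x - p| < ε

lemma exists_flow {G : Subgroup (ℝ ≃o ℝ)} {N : ℕ} (H : CoreHyp G N)
    {A : Set ℝ} (hA : MinSet G A) : ∃ p α β C K s₀ : ℝ, FlowData G A p α β C K s₀ := by
  obtain ⟨p, hp, δ, hδ, g₁, hg₁, g₂, hg₂, hfix, hne, hJ⟩ := exists_ifs H hA
  have hpJ : p ∈ Icc (p - δ) (p + δ) := ⟨by linarith, by linarith⟩
  obtain ⟨L1, hL10, hL1⟩ := H.logLip hg₁ (p - δ) (p + δ)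
  obtain ⟨L2, hL20, hL2⟩ := H.logLip hg₂ (p - δ) (p + δ)
  set L := max L1 L2 with hLdef
  have hL0 : 0 ≤ L := hL10.trans (le_max_left _ _)
  have hu := uSeq_spec H hL0 hg₁ hg₂ hJ
    (fun x hx y hy => (hL1 x hx y hy).trans (mul_le_mul_of_nonneg_right (le_max_left _ _) (abs_nonneg _)))
    (fun x hx y hy => (hL2 x hx y hy).trans (mul_le_mul_of_nonneg_right (le_max_right _ _) (abs_nonneg _)))
  set E := Real.exp (2 * L * (2 * δ)) with hEdef
  have hE : 1 ≤ E := Real.one_le_exp (by positivity)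
  have hE0 : 0 < E := by linarith
  set σ := min (deriv (⇑g₁) p) (deriv (⇑g₂) p) with hσdef
  have hσ : 0 < σ := lt_min (H.deriv_pos _ hg₁ _) (H.deriv_pos _ hg₂ _)
  -- bounded distortion
  have hcomp : ∀ w i, ∀ x ∈ Icc (p - δ) (p + δ), ∀ y ∈ Icc (p - δ) (p + δ),
      deriv (⇑(uSeq g₁ g₂ w i)) x ≤ E * deriv (⇑(uSeq g₁ g₂ w i)) y := by
    intro w i x hx y hy
    have h1 := (hu w i).2.2 x hx y hy
    have p1 := H.deriv_pos _ (hu w i).1 x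
    have p2 := H.deriv_pos _ (hu w i).1 y
    have h2 : |x - y| ≤ 2 * δ := by
      rw [abs_le]; constructor <;> linarith [hx.1, hx.2, hy.1, hy.2]
    have h3 := mul_le_mul_of_nonneg_left h2 (show 0 ≤ 2 * L by positivity)
    rw [← Real.exp_log p1, ← Real.exp_log p2, hEdef, ← Real.exp_add]
    apply Real.exp_le_exp.2; linarith
  set Λ := E / σ with hΛdef
  have hΛ : 0 < Λ := by positivity
  have hstep : ∀ w i, deriv (⇑(uSeq g₁ g₂ w i)) p ≤ Λ * deriv (⇑(uSeq g₁ g₂ w (i + 1))) p := by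
    intro w i
    have key : ∀ g ∈ G, g p ∈ Icc (p - δ) (p + δ) → σ ≤ deriv (⇑g) p →
        deriv (⇑(uSeq g₁ g₂ w i)) p ≤ Λ * deriv (⇑(uSeq g₁ g₂ w i * g)) p := by
      intro g hg hgp hgσ
      rw [H.deriv_mul (hu w i).1 hg, hΛdef, div_mul_eq_mul_div, le_div_iff₀ hσ, ← mul_assoc]
      exact mul_le_mul (hcomp w i p hpJ _ hgp) hgσ hσ.le
        (mul_pos hE0 (H.deriv_pos _ (hu w i).1 _)).le
    rw [uSeq]
    by_cases hw : w i = true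
    · rw [if_pos hw]; exact key g₂ hg₂ (hJ p hpJ).2.1 (min_le_right _ _)
    · rw [if_neg hw]; exact key g₁ hg₁ (hJ p hpJ).1 (min_le_left _ _)
  -- contraction towards p
  have hpow : ∀ m : ℕ, ∀ x ∈ Icc (p - δ) (p + δ), (g₁ ^ m) x ∈ Icc (p - δ) (p + δ) ∧
      |(g₁ ^ m) x - p| ≤ (1 / 2) ^ m * |x - p| := by
    intro m x hx
    induction m with
    | zero => exact ⟨hx, by simp⟩
    | succ m ih =>
      rw [oi_pow_succ']
      refine ⟨(hJ _ ih.1).1, ?_⟩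
      have := H.mvt_abs hg₁ (fun x hx => (hJ x hx).2.2.1) ih.1 hpJ
      rw [hfix] at this
      rw [pow_succ']; linarith [ih.2]
  have hhalf : Tendsto (fun m : ℕ => (1 / 2 : ℝ) ^ m) atTop (𝓝 0) :=
    tendsto_pow_atTop_nhds_zero_of_lt_one (by norm_num) (by norm_num)
  have habs : ∀ x ∈ Icc (p - δ) (p + δ), |x - p| ≤ δ := by
    intro x hx; rw [abs_le]; constructor <;> linarith [hx.1, hx.2]
  have hcontr : ∀ ε : ℝ, 0 < ε → ∃ m : ℕ, ∀ x ∈ Icc (p - δ) (p + δ), |(g₁ ^ m) x - p| < ε := by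
    intro ε hε
    obtain ⟨m, hm⟩ := (hhalf.eventually (gt_mem_nhds (show 0 < ε / δ by positivity))).exists
    refine ⟨m, fun x hx => (hpow m x hx).2.trans_lt ?_⟩
    rw [lt_div_iff₀ hδ] at hm
    refine lt_of_le_of_lt ?_ hm
    exact mul_le_mul_of_nonneg_left (habs x hx) (by positivity)
  set C₁ := (Λ + 1) * E with hC₁
  have hC₁0 : 0 < C₁ := by positivity
  refine ⟨p, p - δ / 2, p + δ / 2, C₁ * (2 * E), (1 + 2 * L * C₁) * (2 * E), δ / (8 * E * C₁),
    hp, by linarith, by linarith, by positivity, by positivity, by positivity, ?_, ?_⟩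
  · intro s' hs' hs'₀
    rw [lt_div_iff₀ (by positivity)] at hs'₀
    set s := 2 * E * s' with hs
    have hs0 : 0 < s := by positivity
    have hs1 : s * (Λ + 1) * E < δ / 2 := by
      have : s * (Λ + 1) * E = 2 * (E * C₁ * s') := by rw [hs, hC₁]; ring
      rw [this]; nlinarith
    set ε := min s (s / (4 * δ * E)) with hεdef
    have hε0 : 0 < ε := by positivity
    have hεs : ε ≤ s := min_le_left _ _
    have hεδ : ε * (2 * δ * E) ≤ s / 2 := by
      have : ε ≤ s / (4 * δ * E) := min_le_right _ _
      rw [le_div_iff₀ (by positivity)] at this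
      linarith
    obtain ⟨F₀, hF₀, hF₀1, hsm, hsm'⟩ := H.small2 hε0
    -- choose a point
    obtain ⟨j, hj⟩ : ∃ j : ℕ, F₀ ((g₁ ^ j) (g₂ p)) ≠ (g₁ ^ j) (g₂ p) := by
      obtain ⟨κ, hκ, hiso⟩ := H.isolated hF₀ hF₀1 p
      obtain ⟨m, hm⟩ := hcontr κ hκ
      refine ⟨m, hiso _ ?_ (hm _ (hJ p hpJ).2.1)⟩
      intro h
      apply hne
      have : (g₁ ^ m) (g₂ p) = (g₁ ^ m) p := by rw [h, pow_fix g₁ hfix]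
      exact (g₁ ^ m).injective this
    obtain ⟨w, hw⟩ := uSeq_point g₁ g₂ hpJ hfix (fun x hx => ⟨(hJ x hx).1, (hJ x hx).2.1⟩) j
    set z := (g₁ ^ j) (g₂ p) with hz
    obtain ⟨F, hF, hFz, hFs⟩ : ∃ F ∈ G, z < F z ∧ ∀ x : ℝ, |F x - x| < ε ∧ |deriv (⇑F) x - 1| < ε := by
      rcases lt_or_gt_of_ne hj with h | h
      · refine ⟨F₀⁻¹, G.inv_mem hF₀, ?_, hsm'⟩
        rw [← F₀.lt_iff_lt, oi_apply_inv]; exact h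
      · exact ⟨F₀, hF₀, h, hsm⟩
    have hd : F z - z < s := ((le_abs_self _).trans_lt (hFs z).1).trans_le hεs
    have hd0 : 0 < F z - z := by linarith
    have hex : ∃ i, s * deriv (⇑(uSeq g₁ g₂ w i)) p ≤ F z - z := by
      obtain ⟨m, hm⟩ := (hhalf.eventually (gt_mem_nhds (show 0 < (F z - z) / s by positivity))).exists
      refine ⟨m, ?_⟩
      have := (hu w m).2.1 p hpJ
      rw [lt_div_iff₀ hs0] at hm
      nlinarith
    set i := Nat.find hex with hi
    have hi1 := Nat.find_spec hex
    have hi0 : i ≠ 0 := by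
      intro h0
      rw [← hi, h0] at hi1
      have e : (⇑(uSeq g₁ g₂ w 0) : ℝ → ℝ) = id := rfl
      rw [e, deriv_id] at hi1
      linarith
    obtain ⟨i', hi'⟩ := Nat.exists_eq_succ_of_ne_zero hi0
    have hi2 := Nat.find_min hex (show i' < Nat.find hex by omega)
    rw [← hi, hi'] at hi1
    push Not at hi2
    have hst := hstep w i'
    obtain ⟨y₀, hy₀, hy₀z⟩ := hw (i' + 1)
    obtain ⟨u1, u2, u3⟩ := hu w (i' + 1)
    have hc := hcomp w (i' + 1)
    have hapos := H.deriv_pos _ u1 p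
    set a := deriv (⇑(uSeq g₁ g₂ w (i' + 1))) p with ha
    have hfl := flow_step H u1 hF (p := p) (δ := δ) (L := 2 * L) (E := E) (a := a) (s := s) (Λ := Λ)
      (ε := ε) (y₀ := y₀) hδ (by positivity) hE hapos hs0 hΛ
      (fun x hx => ⟨by rw [div_le_iff₀ hE0, mul_comm]; exact hc p hpJ x hx, hc x hx p hpJ⟩)
      u3 hy₀ (by rw [hy₀z]; exact hi1) (by
        rw [hy₀z]
        have := mul_le_mul_of_nonneg_left hst hs0.le
        linarith) (fun x => (hFs x).2) hεs hεδ hs1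
    have hγG : (uSeq g₁ g₂ w (i' + 1))⁻¹ * F * uSeq g₁ g₂ w (i' + 1) ∈ G :=
      G.mul_mem (G.mul_mem (G.inv_mem u1) hF) u1
    refine ⟨_, hγG, fun x hx => ⟨?_, ?_⟩, fun x hx y hy hxy => ?_⟩
    · have := (hfl x hx).1
      have e : s / (2 * E) = s' := by rw [hs]; field_simp
      rwa [e] at this
    · have := (hfl x hx).2.1
      have e : (Λ + 1) * E * s = C₁ * (2 * E) * s' := by rw [hs, hC₁]; ring
      rwa [e] at this
    · obtain ⟨ξ, hξ, h⟩ := H.mvt hγG hxy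
      rw [h]
      apply mul_le_mul_of_nonneg_right _ (by linarith)
      have := (hfl ξ ⟨hx.1.trans hξ.1, hξ.2.trans hy.2⟩).2.2
      have e : (1 + 2 * L * ((Λ + 1) * E)) * s = (1 + 2 * L * C₁) * (2 * E) * s' := by rw [hs, hC₁]; ring
      rwa [e] at this
  · intro ε hε
    obtain ⟨m, hm⟩ := hcontr ε hε
    exact ⟨g₁ ^ m, G.pow_mem hg₁ m, fun x hx => hm x ⟨by linarith [hx.1], by linarith [hx.2]⟩⟩


lemma oi_inv_lt (g : ℝ ≃o ℝ) {x y : ℝ} : g⁻¹ x < y ↔ x < g y := by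
  rw [← g.lt_iff_lt, oi_apply_inv]

lemma oi_lt_inv (g : ℝ ≃o ℝ) {x y : ℝ} : y < g⁻¹ x ↔ g y < x := by
  rw [← g.lt_iff_lt, oi_apply_inv]

lemma minSet_univ {G : Subgroup (ℝ ≃o ℝ)} {A : Set ℝ} (hA : MinSet G A) {p α β C K s₀ : ℝ}
    (D : FlowData G A p α β C K s₀) : A = univ := by
  have hCp := D.hC
  have hs₀ := D.hs₀
  have small : ∀ e : ℝ, 0 < e → ∃ s, 0 < s ∧ s < s₀ ∧ C * s < e := by
    intro e he
    refine ⟨min (s₀ / 2) (e / (2 * C)), by positivity, (min_le_left _ _).trans_lt (by linarith), ?_⟩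
    have : min (s₀ / 2) (e / (2 * C)) ≤ e / (2 * C) := min_le_right _ _
    rw [le_div_iff₀ (by positivity)] at this
    linarith
  have hsub : Ioo α β ⊆ A := by
    intro x hx
    by_contra hxA
    rcases le_total p x with hpx | hpx
    · have hc : IsCompact (A ∩ Icc p x) := isCompact_Icc.inter_left hA.closed
      have hne : (A ∩ Icc p x).Nonempty := ⟨p, D.pA, le_rfl, hpx⟩
      have hm := hc.sSup_mem hne
      set u := sSup (A ∩ Icc p x) with hu
      have hux : u < x := lt_of_le_of_ne hm.2.2 (fun h => hxA (h ▸ hm.1))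
      obtain ⟨s, hs, hs1, hs2⟩ := small (x - u) (by linarith)
      obtain ⟨γ, hγ, hf, -⟩ := D.flow s hs hs1
      obtain ⟨f1, f2⟩ := hf u ⟨by linarith [D.hα, hm.2.1], by linarith [hx.2]⟩
      have : γ u ≤ u := le_csSup hc.bddAbove ⟨hA.inv γ hγ u hm.1, by linarith [hm.2.1], by linarith⟩
      linarith
    · have hc : IsCompact (A ∩ Icc x p) := isCompact_Icc.inter_left hA.closed
      have hne : (A ∩ Icc x p).Nonempty := ⟨p, D.pA, hpx, le_rfl⟩
      have hm := hc.sInf_mem hne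
      set u := sInf (A ∩ Icc x p) with hu
      have hux : x < u := lt_of_le_of_ne hm.2.1 (fun h => hxA (h ▸ hm.1))
      obtain ⟨s, hs, hs1, hs2⟩ := small (u - x) (by linarith)
      obtain ⟨γ, hγ, hf, -⟩ := D.flow s hs hs1
      obtain ⟨f1, f2⟩ := hf x ⟨hx.1.le, hx.2.le⟩
      obtain ⟨f3, -⟩ := hf u ⟨by linarith [hx.1], by linarith [D.hβ, hm.2.2]⟩
      have h1 : x < γ⁻¹ u := (oi_lt_inv γ).2 (by linarith)
      have h2 : γ⁻¹ u < u := (oi_inv_lt γ).2 (by linarith)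
      have : u ≤ γ⁻¹ u := csInf_le hc.bddBelow ⟨hA.inv _ (G.inv_mem hγ) u hm.1, h1.le, by linarith [hm.2.2]⟩
      linarith
  have hop : IsOpen A := by
    rw [isOpen_iff_mem_nhds]
    intro y hy
    have h1 := D.hα
    have h2 := D.hβ
    obtain ⟨g, hg, hgy⟩ := hA.dense hy D.pA (show 0 < min (p - α) (β - p) from lt_min (by linarith) (by linarith))
    have h3 := abs_lt.1 (hgy.trans_le (min_le_left _ _))
    have h4 := abs_lt.1 (hgy.trans_le (min_le_right _ _))
    have : (⇑g) ⁻¹' (Ioo α β) ∈ 𝓝 y :=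
      (isOpen_Ioo.preimage g.continuous).mem_nhds ⟨by linarith [h3.1], by linarith [h4.2]⟩
    refine mem_of_superset this ?_
    intro z hz
    have := hA.inv _ (G.inv_mem hg) _ (hsub hz)
    rwa [oi_inv_apply] at this
  exact IsClopen.eq_univ ⟨hA.closed, hop⟩ hA.nonempty

/-- The interval from `x` to `y` can be sent into arbitrarily small intervals. -/
def Contr (G : Subgroup (ℝ ≃o ℝ)) (x y : ℝ) : Prop :=
  ∀ a b : ℝ, a < b → ∃ g ∈ G, a < g x ∧ g y < b

lemma Contr.mono {G : Subgroup (ℝ ≃o ℝ)} {x y x' y' : ℝ} (h : Contr G x y) (hx : x ≤ x') (hy : y' ≤ y) :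
    Contr G x' y' := by
  intro a b hab
  obtain ⟨g, hg, h1, h2⟩ := h a b hab
  exact ⟨g, hg, h1.trans_le (g.monotone hx), (g.monotone hy).trans_lt h2⟩

lemma Contr.map {G : Subgroup (ℝ ≃o ℝ)} {x y : ℝ} (h : Contr G x y) {k : ℝ ≃o ℝ} (hk : k ∈ G) :
    Contr G (k x) (k y) := by
  intro a b hab
  obtain ⟨g, hg, h1, h2⟩ := h a b hab
  refine ⟨g * k⁻¹, G.mul_mem hg (G.inv_mem hk), ?_, ?_⟩
  · rwa [oi_mul, oi_inv_apply]
  · rwa [oi_mul, oi_inv_apply]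

lemma Contr.lt_add_one {G : Subgroup (ℝ ≃o ℝ)} {N : ℕ} (H : CoreHyp G N) {x y : ℝ} (h : Contr G x y) :
    y < x + 1 := by
  obtain ⟨g, hg, h1, h2⟩ := h 0 1 one_pos
  rw [← g.lt_iff_lt, H.add_one g hg]; linarith

lemma contr_local {G : Subgroup (ℝ ≃o ℝ)} {p α β C K s₀ : ℝ} (hA : MinSet G univ)
    (D : FlowData G univ p α β C K s₀) (z : ℝ) : ∃ κ > 0, Contr G (z - κ) (z + κ) := by
  have h1 := D.hα
  have h2 := D.hβ
  obtain ⟨k, hk, hkz⟩ := hA.dense (mem_univ z) D.pA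
    (show 0 < min (p - α) (β - p) from lt_min (by linarith) (by linarith))
  have h3 := abs_lt.1 (hkz.trans_le (min_le_left _ _))
  have h4 := abs_lt.1 (hkz.trans_le (min_le_right _ _))
  obtain ⟨κ, hκ, hb⟩ := Metric.isOpen_iff.1 ((isOpen_Ioo (a := α) (b := β)).preimage k.continuous) z
    ⟨by linarith [h3.1], by linarith [h4.2]⟩
  refine ⟨κ / 2, by positivity, ?_⟩
  intro a b hab
  obtain ⟨k2, hk2, hd⟩ := hA.dense (mem_univ p) (mem_univ ((a + b) / 2)) (show 0 < (b - a) / 2 by linarith)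
  have h5 := abs_lt.1 hd
  obtain ⟨ε, hε, he⟩ := Metric.isOpen_iff.1 ((isOpen_Ioo (a := a) (b := b)).preimage k2.continuous) p
    ⟨by linarith [h5.1], by linarith [h5.2]⟩
  obtain ⟨k3, hk3, hc⟩ := D.contr ε hε
  have key : ∀ x, |x - z| < κ → k2 (k3 (k x)) ∈ Ioo a b := by
    intro x hx
    have := hb (show x ∈ Metric.ball z κ by rwa [Metric.mem_ball, Real.dist_eq])
    have := hc (k x) ⟨this.1.le, this.2.le⟩
    exact he (show k3 (k x) ∈ Metric.ball p ε by rwa [Metric.mem_ball, Real.dist_eq])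
  refine ⟨k2 * k3 * k, G.mul_mem (G.mul_mem hk2 hk3) hk, ?_, ?_⟩
  · exact (key _ (by rw [abs_lt]; constructor <;> linarith)).1
  · exact (key _ (by rw [abs_lt]; constructor <;> linarith)).2

/-- The supremum of the right endpoints of contractible intervals. -/
def thetaMap (G : Subgroup (ℝ ≃o ℝ)) (x : ℝ) : ℝ := sSup {y | Contr G x y}

/-- Properties of `thetaMap`. -/
structure ThetaSpec (G : Subgroup (ℝ ≃o ℝ)) (θ : ℝ → ℝ) : Prop where
  contr : ∀ x y, y < θ x → Contr G x y
  le : ∀ x y, Contr G x y → y ≤ θ x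
  lt : ∀ x, x < θ x
  mono : Monotone θ
  comm : ∀ k ∈ G, ∀ x, θ (k x) = k (θ x)
  unb : ∀ r b, ∃ m : ℕ, b < θ^[m] r

lemma theta_spec {G : Subgroup (ℝ ≃o ℝ)} {N : ℕ} (H : CoreHyp G N) {p α β C K s₀ : ℝ} (hA : MinSet G univ)
    (D : FlowData G univ p α β C K s₀) : ThetaSpec G (thetaMap G) := by
  have hbdd : ∀ x, BddAbove {y | Contr G x y} := fun x => ⟨x + 1, fun y hy => (Contr.lt_add_one H hy).le⟩
  have hle : ∀ x y, Contr G x y → y ≤ thetaMap G x := fun x y h => le_csSup (hbdd x) h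
  have hloc := contr_local hA D
  have hlt : ∀ x, x < thetaMap G x := by
    intro x
    obtain ⟨κ, hκ, h⟩ := hloc x
    have := hle x (x + κ) (h.mono (by linarith) le_rfl)
    linarith
  have hne : ∀ x, {y | Contr G x y}.Nonempty := by
    intro x
    obtain ⟨κ, hκ, h⟩ := hloc x
    exact ⟨x + κ, h.mono (by linarith) le_rfl⟩
  have hcon : ∀ x y, y < thetaMap G x → Contr G x y := by
    intro x y hy
    obtain ⟨y', h1, h2⟩ := exists_lt_of_lt_csSup (hne x) hy
    exact Contr.mono h1 le_rfl h2.le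
  have hmono : Monotone (thetaMap G) := by
    intro x x' hx
    exact csSup_le (hne x) fun y hy => hle x' y (Contr.mono hy hx le_rfl)
  have hcomm1 : ∀ k ∈ G, ∀ x, k (thetaMap G x) ≤ thetaMap G (k x) := by
    intro k hk x
    by_contra! h
    rw [← oi_inv_lt] at h
    obtain ⟨y, h1, h2⟩ := exists_between h
    have := hle _ _ ((hcon x y h2).map hk)
    rw [oi_inv_lt] at h1
    linarith
  refine ⟨hcon, hle, hlt, hmono, ?_, ?_⟩
  · intro k hk x
    apply le_antisymm _ (hcomm1 k hk x)
    have := hcomm1 _ (G.inv_mem hk) (k x)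
    rw [oi_inv_apply] at this
    have := k.monotone this
    rwa [oi_apply_inv] at this
  · intro r b
    by_contra! h
    have hb : BddAbove (range fun m : ℕ => (thetaMap G)^[m] r) := ⟨b, by rintro _ ⟨m, rfl⟩; exact h m⟩
    set z := sSup (range fun m : ℕ => (thetaMap G)^[m] r) with hz
    obtain ⟨κ, hκ, hc⟩ := hloc z
    obtain ⟨_, ⟨m, rfl⟩, hm⟩ := exists_lt_of_lt_csSup (range_nonempty fun m : ℕ => (thetaMap G)^[m] r)
      (show z - κ < z by linarith)
    have h1 := hle _ _ (hc.mono hm.le le_rfl)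
    have h2 : (thetaMap G)^[m + 1] r ≤ z := le_csSup hb ⟨m + 1, rfl⟩
    rw [Function.iterate_succ_apply'] at h2
    linarith


lemma flow_lower (γ : ℝ ≃o ℝ) {a b s : ℝ} (hs : 0 < s) (hf : ∀ x ∈ Icc a b, x + s ≤ γ x) (hab : a ≤ b)
    {y : ℝ} (hy : a ≤ y) (j : ℕ) : min (y + j * s) b ≤ (γ ^ j) y := by
  induction j with
  | zero => simp [oi_one]
  | succ j ih =>
    rw [oi_pow_succ']
    rcases le_total b ((γ ^ j) y) with h | h
    · have h1 := γ.monotone h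
      have h2 := hf b ⟨hab, le_rfl⟩
      exact (min_le_right _ _).trans (by linarith)
    · have h0 : a ≤ min (y + j * s) b := le_min (by nlinarith [show (0:ℝ) ≤ j from Nat.cast_nonneg j]) hab
      have h1 := hf _ ⟨h0.trans ih, h⟩
      rcases min_le_iff.1 ih with h2 | h2
      · apply (min_le_left _ _).trans; push_cast; linarith
      · exact (min_le_right _ _).trans (by linarith)

lemma flow_lip (γ : ℝ ≃o ℝ) {a c η s K : ℝ} (hs : 0 < s) (hK : 0 < K) (hη : 0 < η) (hac : a ≤ c)
    (hf : ∀ x ∈ Icc a (c + η), x + s ≤ γ x)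
    (hl : ∀ x ∈ Icc a (c + η), ∀ y ∈ Icc a (c + η), x ≤ y → γ y - γ x ≤ Real.exp (K * s) * (y - x))
    {z e : ℝ} (hz : a ≤ z) (he : 0 ≤ e) (i : ℕ) (hi : (γ ^ i) z ≤ c) (hie : Real.exp (K * (i * s)) * e ≤ η) :
    (γ ^ i) (z + e) ≤ (γ ^ i) z + Real.exp (K * (i * s)) * e := by
  induction i with
  | zero => simp [oi_one]
  | succ i ih =>
    rw [oi_pow_succ'] at hi ⊢
    rw [oi_pow_succ']
    have hlow : a ≤ (γ ^ i) z := by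
      have := flow_lower γ hs hf (by linarith) hz i
      refine le_trans (le_min ?_ (by linarith)) this
      nlinarith [show (0:ℝ) ≤ i from Nat.cast_nonneg i]
    have hi' : (γ ^ i) z ≤ c := by
      by_contra! h
      have h1 := γ.monotone h.le
      have h2 := hf c ⟨hac, by linarith⟩
      linarith
    have hexp : Real.exp (K * (((i + 1 : ℕ) : ℝ) * s)) = Real.exp (K * s) * Real.exp (K * (i * s)) := by
      rw [← Real.exp_add]; congr 1; push_cast; ring
    rw [hexp] at hie ⊢
    have h1 : 1 ≤ Real.exp (K * s) := Real.one_le_exp (by positivity)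
    set X := Real.exp (K * (i * s)) * e with hX
    have hX0 : 0 ≤ X := by positivity
    have hie' : Real.exp (K * s) * X ≤ η := by rw [hX, ← mul_assoc]; exact hie
    have hXη : X ≤ η := by nlinarith
    have h2 := ih hi' hXη
    have h3 := γ.monotone h2
    have h4 := hl ((γ ^ i) z) ⟨hlow, by linarith⟩ ((γ ^ i) z + X) ⟨by linarith, by linarith⟩ (by linarith)
    have h5 : Real.exp (K * s) * ((γ ^ i) z + X - (γ ^ i) z) = Real.exp (K * s) * X := by ring
    rw [h5] at h4
    rw [mul_assoc, ← hX]
    linarith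

theorem core_false {G : Subgroup (ℝ ≃o ℝ)} {N : ℕ} (H : CoreHyp G N) : False := by
  obtain ⟨A, hA⟩ := H.exists_minSet
  obtain ⟨p, α, β, C, K, s₀, D⟩ := exists_flow H hA
  obtain rfl := minSet_univ hA D
  have T := theta_spec H hA D
  set θ := thetaMap G with hθ
  have hCp := D.hC
  have hKp := D.hK
  have hs₀ := D.hs₀
  -- choice of r
  obtain ⟨r, hrα, hrβ⟩ : ∃ r, α < θ r ∧ θ r < β := by
    have h1 := D.hα
    have h2 := D.hβ
    obtain ⟨k, hk, hkz⟩ := hA.dense (mem_univ (θ 0)) D.pA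
      (show 0 < min (p - α) (β - p) from lt_min (by linarith) (by linarith))
    have h3 := abs_lt.1 (hkz.trans_le (min_le_left _ _))
    have h4 := abs_lt.1 (hkz.trans_le (min_le_right _ _))
    refine ⟨k 0, ?_, ?_⟩ <;> rw [T.comm k hk] <;> linarith [h3.1, h4.2]
  obtain ⟨κ, hκ, hloc⟩ := contr_local hA D (θ r)
  have hrr := T.lt r
  have hθr : θ r = θ r := rfl
  set r' := θ r with hr'
  obtain ⟨η, hη, h1, h2, h3, h4⟩ : ∃ η > 0, 2 * η < κ ∧ α < r' - 2 * η ∧ r' + 2 * η < β ∧ 2 * η < r' - r := by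
    have hm : 0 < min (min κ (r' - α)) (min (β - r') (r' - r)) :=
      lt_min (lt_min hκ (by linarith)) (lt_min (by linarith) (by linarith))
    refine ⟨min (min κ (r' - α)) (min (β - r') (r' - r)) / 4, by positivity, ?_, ?_, ?_, ?_⟩
    · have : min (min κ (r' - α)) (min (β - r') (r' - r)) ≤ κ := (min_le_left _ _).trans (min_le_left _ _)
      linarith
    · have : min (min κ (r' - α)) (min (β - r') (r' - r)) ≤ r' - α := (min_le_left _ _).trans (min_le_right _ _)
      linarith
    · have : min (min κ (r' - α)) (min (β - r') (r' - r)) ≤ β - r' := (min_le_right _ _).trans (min_le_left _ _)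
      linarith
    · have : min (min κ (r' - α)) (min (β - r') (r' - r)) ≤ r' - r := (min_le_right _ _).trans (min_le_right _ _)
      linarith
  obtain ⟨g, hg, hg1, hg2⟩ := T.contr r (r' - η) (by linarith) (r' - 2 * η) (r' - η) (by linarith)
  obtain ⟨B₀, hB₀⟩ := (isCompact_Icc (a := r) (b := r' + 1)).bddAbove_image (H.contDeriv hg).continuousOn
  set Kg := max B₀ 1 with hKg
  have hKg1 : 1 ≤ Kg := le_max_right _ _
  have hgL : ∀ x ∈ Icc r (r' + 1), deriv (⇑g) x ≤ Kg := fun x hx =>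
    (hB₀ ⟨x, hx, rfl⟩).trans (le_max_left _ _)
  set E := Real.exp (K * (4 * η)) with hE
  have hE1 : 1 ≤ E := Real.one_le_exp (by positivity)
  set M := E * Kg with hM
  have hM1 : 1 ≤ M := by nlinarith
  set a : ℕ → ℝ := fun i => C * (1 + M) ^ i with ha
  have ha0 : ∀ i, 0 < a i := fun i => by rw [ha]; positivity
  have hamono : ∀ i, i ≤ N + 1 → a i ≤ a (N + 1) := by
    intro i hi
    rw [ha]
    exact mul_le_mul_of_nonneg_left (pow_le_pow_right₀ (by linarith) hi) hCp.le
  have hastep : ∀ i, C + M * a i ≤ a (i + 1) := by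
    intro i
    have h5 : 1 ≤ (1 + M) ^ i := one_le_pow₀ (by linarith)
    have : a (i + 1) = C * (1 + M) ^ i + M * a i := by simp only [ha, pow_succ]; ring
    rw [this]; nlinarith
  set B := a (N + 1) with hB
  have hB0 : 0 < B := ha0 _
  obtain ⟨s, hs, hss₀, hsη, hs1⟩ : ∃ s, 0 < s ∧ s < s₀ ∧ M * B * s ≤ η ∧ B * s ≤ 1 := by
    refine ⟨min (s₀ / 2) (min (η / (M * B)) (1 / B)), by positivity,
      (min_le_left _ _).trans_lt (by linarith), ?_, ?_⟩
    · have : min (s₀ / 2) (min (η / (M * B)) (1 / B)) ≤ η / (M * B) :=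
        (min_le_right _ _).trans (min_le_left _ _)
      rw [le_div_iff₀ (by positivity)] at this
      linarith
    · have : min (s₀ / 2) (min (η / (M * B)) (1 / B)) ≤ 1 / B :=
        (min_le_right _ _).trans (min_le_right _ _)
      rw [le_div_iff₀ (by positivity)] at this
      linarith
  obtain ⟨γ, hγ, hfl, hlip⟩ := D.flow s hs hss₀
  have hlow : ∀ y, r' - 2 * η ≤ y → ∀ j : ℕ, min (y + j * s) (r' + 2 * η) ≤ (γ ^ j) y := fun y hy j =>
    flow_lower γ hs (fun x hx => (hfl x ⟨by linarith [hx.1], by linarith [hx.2]⟩).1) (by linarith) hy j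
  have hgr : ∀ y, r ≤ y → r' - 2 * η < g y := fun y hy => hg1.trans_le (g.monotone hy)
  have hex : ∃ j : ℕ, ∀ y ∈ Icc r r', y < (γ ^ j) (g y) := by
    refine ⟨⌈4 * η / s⌉₊, fun y hy => ?_⟩
    have h5 := Nat.le_ceil (4 * η / s)
    rw [div_le_iff₀ hs] at h5
    have h6 := hlow (g y) (hgr y hy.1).le ⌈4 * η / s⌉₊
    rw [min_eq_right (by linarith [hgr y hy.1])] at h6
    linarith [hy.2]
  obtain ⟨j, hj⟩ : ∃ j : ℕ, Nat.find hex = j + 1 := by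
    apply Nat.exists_eq_succ_of_ne_zero
    intro h0
    have := Nat.find_spec hex
    rw [h0] at this
    have := this (r' - η) ⟨by linarith, by linarith⟩
    rw [pow_zero, oi_one] at this
    linarith
  have hspec := Nat.find_spec hex
  rw [hj] at hspec
  have hmin := Nat.find_min hex (show j < Nat.find hex by omega)
  push Not at hmin
  obtain ⟨x, hx, hxle⟩ := hmin
  have hjs : j * s ≤ 4 * η := by
    have h5 : Nat.find hex ≤ ⌈4 * η / s⌉₊ := by
      apply Nat.find_min' hex
      intro y hy
      have h5 := Nat.le_ceil (4 * η / s)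
      rw [div_le_iff₀ hs] at h5
      have h6 := hlow (g y) (hgr y hy.1).le ⌈4 * η / s⌉₊
      rw [min_eq_right (by linarith [hgr y hy.1])] at h6
      linarith [hy.2]
    have h6 : j < ⌈4 * η / s⌉₊ := by omega
    rw [Nat.lt_ceil, lt_div_iff₀ hs] at h6
    exact h6.le
  have hxlow : r' - 2 * η ≤ (γ ^ j) (g x) := by
    refine le_trans (le_min ?_ (by linarith)) (hlow (g x) (hgr x hx.1).le j)
    have : 0 ≤ j * s := by positivity
    linarith [hgr x hx.1]
  set F := γ ^ (j + 1) * g with hF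
  have hFG : F ∈ G := G.mul_mem (G.pow_mem hγ _) hg
  have hFa : ∀ y, F y = γ ((γ ^ j) (g y)) := fun y => by rw [hF, oi_mul, oi_pow_succ']
  -- upper bound for iterates
  have hup : ∀ i, i ≤ N + 1 → (F ^ i) x ≤ x + a i * s := by
    intro i
    induction i with
    | zero =>
      intro _
      rw [pow_zero, oi_one]
      have := ha0 0
      have : 0 < a 0 * s := by positivity
      linarith
    | succ i ih =>
      intro hi
      have hai := ha0 i
      have haiB := hamono i (by omega)
      have hais : a i * s ≤ B * s := mul_le_mul_of_nonneg_right haiB hs.le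
      have hais0 : 0 < a i * s := by positivity
      have i1 := F.monotone (ih (by omega))
      rw [oi_pow_succ']
      refine i1.trans ?_
      rw [hFa]
      set e := Kg * (a i * s) with he
      have he0 : 0 ≤ e := by positivity
      have hEe : E * e ≤ η := by
        have : E * e ≤ M * B * s := by
          rw [he, hM]
          have := mul_le_mul_of_nonneg_left hais (show 0 ≤ E * Kg by positivity)
          linarith
        linarith
      have g1 : g (x + a i * s) ≤ g x + e := by
        have := H.mvt_abs hg hgL (x := x + a i * s) (y := x) ⟨by linarith [hx.1], by linarith [hx.2]⟩
          ⟨hx.1, by linarith [hx.2]⟩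
        rw [show x + a i * s - x = a i * s by ring, abs_of_pos hais0] at this
        linarith [le_abs_self (g (x + a i * s) - g x)]
      have hexp : Real.exp (K * (j * s)) ≤ E := by
        rw [hE]; apply Real.exp_le_exp.2; exact mul_le_mul_of_nonneg_left hjs hKp.le
      have hexp2 := mul_le_mul_of_nonneg_right hexp he0
      have g2 := flow_lip γ (a := r' - 2 * η) (c := r') (η := η) hs hKp hη (by linarith)
        (fun x hx => (hfl x ⟨by linarith [hx.1], by linarith [hx.2]⟩).1)
        (fun x hx y hy => hlip x ⟨by linarith [hx.1], by linarith [hx.2]⟩ y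
          ⟨by linarith [hy.1], by linarith [hy.2]⟩)
        (z := g x) (e := e) (hgr x hx.1).le he0 j (hxle.trans hx.2) (hexp2.trans hEe)
      have g3 : (γ ^ j) (g (x + a i * s)) ≤ x + E * e := by
        have := (γ ^ j).monotone g1
        linarith
      have hEe0 : 0 ≤ E * e := by positivity
      have g4 := γ.monotone g3
      have g5 := (hfl (x + E * e) ⟨by linarith, by linarith [hx.2]⟩).2
      have g6 : E * e + C * s ≤ a (i + 1) * s := by
        have : E * e + C * s = (C + M * a i) * s := by rw [he, hM]; ring
        rw [this]
        exact mul_le_mul_of_nonneg_right (hastep i) hs.le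
      linarith
  have hrot1 : (F ^ (N + 1)) x ≤ x + 1 := (hup (N + 1) le_rfl).trans (by linarith)
  -- lower bound for iterates
  have hFlt : ∀ y ∈ Icc r r', y < F y := fun y hy => hspec y hy
  obtain ⟨Q, hQ⟩ : ∃ Q : ℕ, r' ≤ (F ^ Q) r := by
    by_contra! hcon
    have hmem : ∀ m : ℕ, (F ^ m) r ∈ Icc r r' := by
      intro m
      refine ⟨?_, (hcon m).le⟩
      induction m with
      | zero => exact le_rfl
      | succ m ih =>
        rw [oi_pow_succ']
        exact ih.trans (hFlt _ ⟨ih, (hcon m).le⟩).le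
    obtain ⟨l, hl, hfix, -⟩ := iter_limit F hmem
    have := hFlt l hl
    linarith
  have hFQ := G.pow_mem hFG Q
  have hit : ∀ m : ℕ, θ^[m] r ≤ ((F ^ Q) ^ m) r := by
    intro m
    induction m with
    | zero => exact le_rfl
    | succ m ih =>
      rw [oi_pow_succ, Function.iterate_succ_apply']
      calc θ (θ^[m] r) ≤ θ (((F ^ Q) ^ m) r) := T.mono ih
        _ = ((F ^ Q) ^ m) (θ r) := T.comm _ (G.pow_mem hFQ m) r
        _ ≤ _ := ((F ^ Q) ^ m).monotone hQ
  obtain ⟨m, hm⟩ := T.unb r (r + 1)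
  refine H.rot F hFG x r (Q * m) hrot1 ?_
  rw [pow_mul]
  exact hm.le.trans (hit m)


lemma circ_int_zero (n : ℤ) : (((n : ℤ) : ℝ) : S1) = 0 := by
  rw [AddCircle.coe_eq_zero_iff]
  exact ⟨n, by simp⟩

lemma isLift_mul {F₁ F₂ : CircleDeg1Liftˣ} {f₁ f₂ : S1 ≃ₜ S1} (h₁ : IsLiftOf (F₁ : CircleDeg1Lift) f₁)
    (h₂ : IsLiftOf (F₂ : CircleDeg1Lift) f₂) :
    IsLiftOf ((F₁ * F₂ : CircleDeg1Liftˣ) : CircleDeg1Lift) (f₁ * f₂) := by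
  intro x
  change f₁ (f₂ x) = _
  rw [h₂ x, h₁]; rfl

lemma isLift_one : IsLiftOf ((1 : CircleDeg1Liftˣ) : CircleDeg1Lift) 1 := fun _ => rfl

lemma isLift_inv {F : CircleDeg1Liftˣ} {f : S1 ≃ₜ S1} (h : IsLiftOf (F : CircleDeg1Lift) f) :
    IsLiftOf ((F⁻¹ : CircleDeg1Liftˣ) : CircleDeg1Lift) f⁻¹ := by
  intro x
  apply f.injective
  rw [h, CircleDeg1Lift.units_apply_inv_apply]
  exact f.apply_symm_apply _

lemma isLift_pow {F : CircleDeg1Liftˣ} {f : S1 ≃ₜ S1} (h : IsLiftOf (F : CircleDeg1Lift) f) (n : ℕ) :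
    IsLiftOf ((F ^ n : CircleDeg1Liftˣ) : CircleDeg1Lift) (f ^ n) := by
  induction n with
  | zero => exact isLift_one
  | succ n ih => rw [pow_succ, pow_succ]; exact isLift_mul ih h

lemma isLift_translate (n : ℤ) :
    IsLiftOf ((CircleDeg1Lift.translate (Multiplicative.ofAdd (n : ℝ)) : CircleDeg1Liftˣ) : CircleDeg1Lift) 1 := by
  intro x
  rw [CircleDeg1Lift.translate_apply, AddCircle.coe_add, circ_int_zero, zero_add]
  rfl

lemma lift_continuous (F : CircleDeg1Liftˣ) : Continuous (⇑(F : CircleDeg1Lift)) :=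
  (CircleDeg1Lift.toOrderIso F).continuous

lemma lift_unique {F₁ F₂ : CircleDeg1Liftˣ} {f : S1 ≃ₜ S1} (h₁ : IsLiftOf (F₁ : CircleDeg1Lift) f)
    (h₂ : IsLiftOf (F₂ : CircleDeg1Lift) f) :
    ∃ n : ℤ, ∀ x, (F₂ : CircleDeg1Lift) x = (F₁ : CircleDeg1Lift) x + n := by
  have h : ∀ x, ∃ n : ℤ, (n : ℝ) = (F₂ : CircleDeg1Lift) x - (F₁ : CircleDeg1Lift) x := by
    intro x
    have e : (((F₂ : CircleDeg1Lift) x - (F₁ : CircleDeg1Lift) x : ℝ) : S1) = 0 := by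
      rw [AddCircle.coe_sub, ← h₁ x, ← h₂ x, sub_self]
    rw [AddCircle.coe_eq_zero_iff] at e
    obtain ⟨n, hn⟩ := e
    exact ⟨n, by simpa using hn⟩
  choose n hn using h
  have hc : Continuous n := by
    rw [Int.isClosedEmbedding_coe_real.isInducing.continuous_iff]
    have : ((fun m : ℤ => (m : ℝ)) ∘ n) = fun x => (F₂ : CircleDeg1Lift) x - (F₁ : CircleDeg1Lift) x :=
      funext hn
    rw [this]
    exact (lift_continuous F₂).sub (lift_continuous F₁)
  refine ⟨n 0, fun x => ?_⟩
  rw [PreconnectedSpace.constant inferInstance hc (x := 0) (y := x), hn x]; ring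

lemma rotationNumber_eq {F : CircleDeg1Liftˣ} {f : S1 ≃ₜ S1} (h : IsLiftOf (F : CircleDeg1Lift) f) :
    rotationNumber f = (((F : CircleDeg1Lift).translationNumber : ℝ) : AddCircle (1 : ℝ)) := by
  have hex : ∃ F : CircleDeg1Liftˣ, IsLiftOf (F : CircleDeg1Lift) f := ⟨F, h⟩
  rw [rotationNumber, dif_pos hex]
  obtain ⟨n, hn⟩ := lift_unique h hex.choose_spec
  set F' := hex.choose
  have e : (F' : CircleDeg1Lift) =
      ((CircleDeg1Lift.translate (Multiplicative.ofAdd (n : ℝ)) : CircleDeg1Liftˣ) : CircleDeg1Lift) * F := by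
    ext x
    rw [hn, CircleDeg1Lift.mul_apply, CircleDeg1Lift.translate_apply, add_comm]
  rw [e, CircleDeg1Lift.translationNumber_mul_of_commute, CircleDeg1Lift.translationNumber_translate,
    AddCircle.coe_add]
  · rw [circ_int_zero, zero_add]
  · rw [CircleDeg1Lift.commute_iff_commute]
    intro x
    rw [CircleDeg1Lift.translate_apply, CircleDeg1Lift.translate_apply, CircleDeg1Lift.map_int_add]

/-- The group of all lifts of elements of `Γ`. -/
def liftGroup (Γ : Subgroup (S1 ≃ₜ S1)) : Subgroup CircleDeg1Liftˣ where
  carrier := {F | ∃ f ∈ Γ, IsLiftOf (F : CircleDeg1Lift) f}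
  mul_mem' := by
    rintro a b ⟨f, hf, h⟩ ⟨g, hg, h'⟩
    exact ⟨f * g, Γ.mul_mem hf hg, isLift_mul h h'⟩
  one_mem' := ⟨1, Γ.one_mem, isLift_one⟩
  inv_mem' := by
    rintro a ⟨f, hf, h⟩
    exact ⟨f⁻¹, Γ.inv_mem hf, isLift_inv h⟩

lemma exists_order (Γ : Subgroup (S1 ≃ₜ S1)) (hfin : (rotationNumber '' (Γ : Set (S1 ≃ₜ S1))).Finite) :
    ∃ N : ℕ, 0 < N ∧ ∀ F ∈ liftGroup Γ, ∃ m : ℤ, (m : ℝ) = N * (F : CircleDeg1Lift).translationNumber := by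
  have key : ∀ F ∈ liftGroup Γ, ((F : CircleDeg1Lift).translationNumber : AddCircle (1:ℝ)) ∈
      rotationNumber '' (Γ : Set (S1 ≃ₜ S1)) := by
    rintro F ⟨f, hf, h⟩
    exact ⟨f, hf, rotationNumber_eq h⟩
  have hord : ∀ r ∈ hfin.toFinset, IsOfFinAddOrder r := by
    intro r hr
    rw [Finite.mem_toFinset] at hr
    obtain ⟨f, hf, rfl⟩ := hr
    by_cases hex : ∃ F : CircleDeg1Liftˣ, IsLiftOf (F : CircleDeg1Lift) f
    · obtain ⟨F, hF⟩ := hex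
      rw [← finite_multiples]
      refine hfin.subset ?_
      rintro _ ⟨n, rfl⟩
      refine ⟨f ^ n, Γ.pow_mem hf n, ?_⟩
      rw [rotationNumber_eq hF, rotationNumber_eq (isLift_pow hF n), Units.val_pow_eq_pow_val,
        CircleDeg1Lift.translationNumber_pow]
      simp
    · rw [rotationNumber, dif_neg hex]; exact IsOfFinAddOrder.zero
  refine ⟨∏ r ∈ hfin.toFinset, addOrderOf r, Finset.prod_pos fun r hr => (hord r hr).addOrderOf_pos, ?_⟩
  intro F hF
  have h1 := key F hF
  have h2 : addOrderOf ((F : CircleDeg1Lift).translationNumber : AddCircle (1:ℝ)) ∣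
      ∏ r ∈ hfin.toFinset, addOrderOf r := Finset.dvd_prod_of_mem _ (hfin.mem_toFinset.2 h1)
  rw [addOrderOf_dvd_iff_nsmul_eq_zero, ← AddCircle.coe_nsmul, AddCircle.coe_eq_zero_iff] at h2
  obtain ⟨m, hm⟩ := h2
  exact ⟨m, by simpa using hm⟩

lemma coreHyp_of (Γ : Subgroup (S1 ≃ₜ S1)) (hΓ : ∀ f ∈ Γ, IsAnalyticDiffeo f)
    (horb : ¬ HasFiniteOrbit Γ)
    (hfin : (rotationNumber '' (Γ : Set (S1 ≃ₜ S1))).Finite) (hC : C1Nondiscrete Γ) :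
    ∃ N, CoreHyp ((liftGroup Γ).map CircleDeg1Lift.toOrderIso) N := by
  obtain ⟨N, hN, hNτ⟩ := exists_order Γ hfin
  have hNR : (0:ℝ) < N := by exact_mod_cast hN
  have han : ∀ F ∈ liftGroup Γ, AnalyticOnNhd ℝ (⇑(F : CircleDeg1Lift)) univ ∧
      ∀ x, 0 < deriv (⇑(F : CircleDeg1Lift)) x := by
    rintro F ⟨f, hf, h⟩
    obtain ⟨F₀, h0, h1, h2⟩ := hΓ f hf
    obtain ⟨n, hn⟩ := lift_unique h0 h
    have e : (⇑(F : CircleDeg1Lift) : ℝ → ℝ) = fun x => (F₀ : CircleDeg1Lift) x + n := funext hn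
    rw [e]
    refine ⟨h1.add analyticOnNhd_const, fun x => ?_⟩
    rw [deriv_add_const]; exact h2 x
  have htr : ∀ n : ℤ, CircleDeg1Lift.translate (Multiplicative.ofAdd (n : ℝ)) ∈ liftGroup Γ := fun n =>
    ⟨1, Γ.one_mem, isLift_translate n⟩
  refine ⟨N, ?_, ?_, ?_, ?_, ?_, ?_, ?_⟩
  · rintro _ ⟨F, -, rfl⟩ x
    exact (F : CircleDeg1Lift).map_add_one x
  · refine ⟨_, ⟨_, htr 1, rfl⟩, fun x => ?_⟩
    rw [CircleDeg1Lift.coe_toOrderIso, CircleDeg1Lift.translate_apply]; push_cast; ring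
  · rintro _ ⟨F, hF, rfl⟩
    exact (han F hF).1
  · rintro _ ⟨F, hF, rfl⟩
    exact (han F hF).2
  · rintro _ ⟨F, hF, rfl⟩ x y M h1 h2
    rw [← map_pow, CircleDeg1Lift.coe_toOrderIso, Units.val_pow_eq_pow_val] at h1 h2
    have t1 := CircleDeg1Lift.translationNumber_le_of_le_add_nat (m := 1) _ (by simpa using h1)
    have t2 := CircleDeg1Lift.le_translationNumber_of_add_nat_le (m := 1) _ (by simpa using h2)
    rw [CircleDeg1Lift.translationNumber_pow] at t1 t2
    push_cast at t1 t2
    obtain ⟨m, hm⟩ := hNτ F hF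
    set τ := (F : CircleDeg1Lift).translationNumber
    have hτ : 0 < τ := by
      by_contra! hcon
      have : (M : ℝ) * τ ≤ 0 := mul_nonpos_of_nonneg_of_nonpos (Nat.cast_nonneg M) hcon
      linarith
    have hm0 : (0 : ℝ) < m := by rw [hm]; positivity
    have hm1 : (1 : ℝ) ≤ m := by exact_mod_cast (show 0 < m by exact_mod_cast hm0)
    linarith
  · intro ε hε
    obtain ⟨f, F, h1, h2⟩ := hC
    obtain ⟨n, hn⟩ := h2 (min ε (1 / (2 * N))) (by positivity)
    have hn := hn n le_rfl
    obtain ⟨e1, e2, e3⟩ := h1 n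
    have hmem : F n ∈ liftGroup Γ := ⟨f n, e1, e3⟩
    refine ⟨_, ⟨F n, hmem, rfl⟩, ?_, ?_, fun x => ⟨(hn x).1.trans_le (min_le_left _ _),
      (hn x).2.trans_le (min_le_left _ _)⟩⟩
    · intro h
      apply e2
      apply Homeomorph.ext
      intro z
      induction z using QuotientAddGroup.induction_on with
      | H x =>
        have : (F n : CircleDeg1Lift) x = x := by
          rw [← CircleDeg1Lift.coe_toOrderIso, h]; rfl
        have h3 := e3 x
        rw [this] at h3
        exact h3
    · obtain ⟨m, hm⟩ := hNτ (F n) hmem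
      have hd : ∀ x, |(F n : CircleDeg1Lift) x - x| < 1 / (2 * N) := fun x =>
        (hn x).1.trans_le (min_le_right _ _)
      have t1 : (F n : CircleDeg1Lift).translationNumber ≤ 1 / (2 * N) :=
        CircleDeg1Lift.translationNumber_le_of_le_add _ fun x => by linarith [(abs_lt.1 (hd x)).2]
      have t2 : -(1 / (2 * N)) ≤ (F n : CircleDeg1Lift).translationNumber :=
        CircleDeg1Lift.le_translationNumber_of_add_le _ fun x => by linarith [(abs_lt.1 (hd x)).1]
      set τ := (F n : CircleDeg1Lift).translationNumber
      have hN2 : (N : ℝ) * (1 / (2 * N)) = 1 / 2 := by field_simp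
      have u1 : (m : ℝ) ≤ 1 / 2 := by
        rw [hm, ← hN2]; exact mul_le_mul_of_nonneg_left t1 hNR.le
      have u2 : -(1 / 2) ≤ (m : ℝ) := by
        rw [hm, ← hN2, ← mul_neg]; exact mul_le_mul_of_nonneg_left t2 hNR.le
      have u3 : m < 1 := by exact_mod_cast (show (m : ℝ) < 1 by linarith)
      have u4 : -1 < m := by exact_mod_cast (show (-1 : ℝ) < m by linarith)
      have hm0 : m = 0 := by omega
      have hτ : τ = 0 := by
        rw [hm0] at hm
        have : (N : ℝ) * τ = 0 := by rw [← hm]; simp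
        exact (mul_eq_zero.1 this).resolve_left hNR.ne'
      obtain ⟨x, hx⟩ := (F n : CircleDeg1Lift).exists_eq_add_translationNumber (lift_continuous (F n))
      refine ⟨x, ?_⟩
      rw [CircleDeg1Lift.coe_toOrderIso, hx]
      change x + τ = x
      rw [hτ, add_zero]
  · intro x hS
    apply horb
    refine ⟨(x : S1), (hS.image (fun y : ℝ => (y : S1))).subset ?_⟩
    rintro _ ⟨γ, hγ, rfl⟩
    obtain ⟨F, hF, -⟩ := hΓ γ hγ
    have hFm : F ∈ liftGroup Γ := ⟨γ, hγ, hF⟩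
    have e : (CircleDeg1Lift.toOrderIso (CircleDeg1Lift.translate
        (Multiplicative.ofAdd ((-⌊(F : CircleDeg1Lift) x⌋ : ℤ) : ℝ)) * F)) x = Int.fract ((F : CircleDeg1Lift) x) := by
      rw [CircleDeg1Lift.coe_toOrderIso, Units.val_mul, CircleDeg1Lift.mul_apply,
        CircleDeg1Lift.translate_apply, ← Int.self_sub_floor]
      push_cast; ring
    refine ⟨Int.fract ((F : CircleDeg1Lift) x), ⟨⟨_, ⟨_, (liftGroup Γ).mul_mem (htr _) hFm, rfl⟩, e⟩,
      Int.fract_nonneg _, (Int.fract_lt_one _).le⟩, ?_⟩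
    change ((Int.fract ((F : CircleDeg1Lift) x) : ℝ) : S1) = _
    rw [hF x, ← Int.self_sub_floor, AddCircle.coe_sub, circ_int_zero, sub_zero]


/-- A subgroup of `Diff^ω₊(S¹)` with no finite orbit and a finite image under
the rotation number function is discrete with respect to the `C¹`-topology. -/
theorem discrete_of_no_finite_orbit
    (Γ : Subgroup (S1 ≃ₜ S1)) (hΓ : ∀ f ∈ Γ, IsAnalyticDiffeo f)
    (horb : ¬ HasFiniteOrbit Γ)
    (hfin : (rotationNumber '' (Γ : Set (S1 ≃ₜ S1))).Finite) :
    ¬ C1Nondiscrete Γ := by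
  intro hC
  obtain ⟨N, H⟩ := coreHyp_of Γ hΓ horb hfin hC
  exact core_false H

end
end

section
/- Let Γ be a minimal subgroup of Homeo₊(S¹) and assume that there exists no Γ-invariant Borel probability measure on the circle. Then there exists θ ∈ Homeo₊(S¹) such that: (1) θ is periodic (θ^κ = id for some integer κ ≥ 1) and θ commutes with every element of Γ; (2) for every point x of the circle, every closed interval contained in [x, θ(x)[ is Γ-contractible, where [x, θ(x)[ stands for the whole circle if θ is the identity. -/
open Filter Topology Set MeasureTheory Classical

noncomputable section

namespace PCH

open CircleDeg1Lift Function


/-- Orbits of `G` are dense in the line. -/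
def Mn (G : Subgroup CircleDeg1Liftˣ) : Prop :=
  ∀ x a b : ℝ, a < b → ∃ g ∈ G, a < (g : CircleDeg1Lift) x ∧ (g : CircleDeg1Lift) x < b

/-- The interval `[a,b]` is contracted by `G`. -/
def Con (G : Subgroup CircleDeg1Liftˣ) (a b : ℝ) : Prop :=
  ∀ ε : ℝ, 0 < ε → ∃ g ∈ G, (g : CircleDeg1Lift) b - (g : CircleDeg1Lift) a < ε

theorem unit_cont (g : CircleDeg1Liftˣ) : Continuous (g : CircleDeg1Lift) :=
  (toOrderIso g).continuous

theorem unit_strictMono (g : CircleDeg1Liftˣ) : StrictMono (g : CircleDeg1Lift) :=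
  (toOrderIso g).strictMono

theorem inj_of (G : Subgroup CircleDeg1Liftˣ) (hG : Mn G) (h : CircleDeg1Lift)
    (hc : ∀ g ∈ G, ∀ x y : ℝ, h x = h y → h ((g : CircleDeg1Lift) x) = h ((g : CircleDeg1Lift) y)) :
    Injective h := by
  by_contra hinj
  rw [← strictMono_iff_injective] at hinj
  obtain ⟨a, b, hab, hE⟩ : ∃ a b : ℝ, a < b ∧ h a = h b := by
    by_contra! H
    exact hinj fun a b hab => lt_of_le_of_ne (h.monotone hab.le) (H a b hab)
  have hloc : IsLocallyConstant h := by
    rw [IsLocallyConstant.iff_eventually_eq]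
    intro x
    obtain ⟨g, hg, h1, h2⟩ := hG x a b hab
    have hcont := unit_cont g
    have hev : ∀ᶠ y in 𝓝 x, (g : CircleDeg1Lift) y ∈ Ioo a b :=
      hcont.continuousAt.eventually (Ioo_mem_nhds h1 h2)
    have key : ∀ z ∈ Ioo a b, h z = h a := fun z hz =>
      le_antisymm ((h.monotone hz.2.le).trans hE.ge) (h.monotone hz.1.le)
    filter_upwards [hev] with y hy
    have := hc g⁻¹ (G.inv_mem hg) ((g : CircleDeg1Lift) y) ((g : CircleDeg1Lift) x)
      ((key _ hy).trans (key _ ⟨h1, h2⟩).symm)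
    simpa using this
  have := hloc.apply_eq_of_isPreconnected isPreconnected_univ (mem_univ (0:ℝ)) (mem_univ (0 + 1 : ℝ))
  rw [h.map_add_one] at this
  linarith

theorem bij_of (h : CircleDeg1Lift) (hi : Injective h) (hd : DenseRange h) : Bijective h :=
  ⟨hi, (continuous_iff_surjective h).1 (h.monotone.continuous_of_denseRange hd)⟩

/-- Circle map induced by a lift. -/
def toMap (F : CircleDeg1Lift) : S1 → S1 :=
  Function.Periodic.lift (f := fun x : ℝ => ((F x : ℝ) : S1)) (c := 1) (fun x => by
    simp only [F.map_add_one, AddCircle.coe_add, AddCircle.coe_period, add_zero])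

theorem toMap_coe (F : CircleDeg1Lift) (x : ℝ) : toMap F (x : S1) = ((F x : ℝ) : S1) := rfl

theorem toMap_cont (F : CircleDeg1Lift) (hF : Continuous F) : Continuous (toMap F) := by
  refine continuous_quot_lift _ ?_
  exact (AddCircle.continuous_mk' 1).comp hF

/-- Circle homeomorphism induced by an invertible lift. -/
def toHomeo (F : CircleDeg1Liftˣ) : S1 ≃ₜ S1 where
  toFun := toMap F
  invFun := toMap (F⁻¹ : CircleDeg1Liftˣ)
  left_inv := by
    intro x
    induction x using QuotientAddGroup.induction_on with
    | H x => 

      simp [toMap_coe]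
  right_inv := by
    intro x
    induction x using QuotientAddGroup.induction_on with
    | H x => 

      simp [toMap_coe]
  continuous_toFun := toMap_cont _ (unit_cont _)
  continuous_invFun := toMap_cont _ (unit_cont _)

theorem toHomeo_coe (F : CircleDeg1Liftˣ) (x : ℝ) :
    toHomeo F (x : S1) = (((F : CircleDeg1Lift) x : ℝ) : S1) := rfl

theorem S1_ind {P : S1 → Prop} (h : ∀ x : ℝ, P (x : S1)) (x : S1) : P x := by
  induction x using QuotientAddGroup.induction_on with
  | H x => exact h x

theorem homeo_ext {f g : S1 ≃ₜ S1} (h : ∀ x : ℝ, f (x : S1) = g (x : S1)) : f = g :=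
  Homeomorph.ext (S1_ind h)

/-- The group of all lifts of elements of `Γ`. -/
def lifts (Γ : Subgroup (S1 ≃ₜ S1)) : Subgroup CircleDeg1Liftˣ where
  carrier := {F | ∃ f ∈ Γ, IsLiftOf (F : CircleDeg1Lift) f}
  mul_mem' := by
    rintro F F' ⟨f, hf, hF⟩ ⟨f', hf', hF'⟩
    refine ⟨f * f', Γ.mul_mem hf hf', fun x => ?_⟩
    change f (f' (x : S1)) = _
    rw [hF', hF]
    rfl
  one_mem' := ⟨1, Γ.one_mem, fun x => rfl⟩
  inv_mem' := by
    rintro F ⟨f, hf, hF⟩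
    refine ⟨f⁻¹, Γ.inv_mem hf, fun x => ?_⟩
    change f.symm (x : S1) = _
    rw [Homeomorph.symm_apply_eq, hF]
    simp

theorem lifts_translate (Γ : Subgroup (S1 ≃ₜ S1)) (n : ℤ) :
    translate (Multiplicative.ofAdd (n : ℝ)) ∈ lifts Γ := by
  refine ⟨1, Γ.one_mem, fun x => ?_⟩
  rw [translate_apply]
  change (x : S1) = _
  rw [AddCircle.coe_add]
  have : ((n : ℝ) : S1) = 0 := by
    rw [AddCircle.coe_eq_zero_iff]
    exact ⟨n, by simp⟩
  rw [this, zero_add]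

theorem lifts_Mn (Γ : Subgroup (S1 ≃ₜ S1)) (hΓ : ∀ f ∈ Γ, OrientationPreserving f)
    (hmin : IsMinimalSubgroup Γ) : Mn (lifts Γ) := by
  intro x a b hab
  have hopen : IsOpen ((fun x : ℝ => (x : S1)) '' Ioo a b) :=
    QuotientAddGroup.isOpenMap_coe _ isOpen_Ioo
  obtain ⟨y, ⟨z, hz, hzy⟩, γ, hγ, hy⟩ := (hmin (x : S1)).inter_open_nonempty _ hopen
    ((nonempty_Ioo.2 hab).image _)
  obtain ⟨F, hF⟩ := hΓ γ hγ
  have h1 : (z : S1) = (((F : CircleDeg1Lift) x : ℝ) : S1) := by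
    rw [← hF x, hy]; exact hzy
  rw [QuotientAddGroup.eq, AddSubgroup.mem_zmultiples_iff] at h1
  obtain ⟨n, hn⟩ := h1
  simp only [zsmul_eq_mul, mul_one] at hn
  refine ⟨translate (Multiplicative.ofAdd ((-n : ℤ) : ℝ)) * F,
    (lifts Γ).mul_mem (lifts_translate Γ _) ⟨γ, hγ, hF⟩, ?_⟩
  have h2 : ((translate (Multiplicative.ofAdd ((-n : ℤ) : ℝ)) * F : CircleDeg1Liftˣ) : CircleDeg1Lift) x
      = z := by
    rw [Units.val_mul, mul_apply, translate_apply]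
    push_cast
    linarith
  rw [h2]
  exact hz

theorem measure_of (Γ : Subgroup (S1 ≃ₜ S1)) (hΓ : ∀ f ∈ Γ, OrientationPreserving f)
    (hG : Mn (lifts Γ)) (h : CircleDeg1Lift) (hd : DenseRange h)
    (hc : ∀ g ∈ lifts Γ, ∃ c : ℝ, ∀ x : ℝ, h ((g : CircleDeg1Lift) x) = h x + c) :
    HasInvariantProbMeasure Γ := by
  have hi : Injective h := inj_of _ hG h fun g hg x y hxy => by
    obtain ⟨c, hc⟩ := hc g hg
    rw [hc, hc, hxy]
  obtain ⟨H, rfl⟩ := isUnit_iff_bijective.2 (bij_of h hi hd)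
  have : IsProbabilityMeasure (volume : Measure S1) := ⟨UnitAddCircle.measure_univ⟩
  refine ⟨Measure.map (toHomeo H).symm volume,
    Measure.isProbabilityMeasure_map (toHomeo H).symm.continuous.aemeasurable, ?_⟩
  intro γ hγ
  obtain ⟨F, hF⟩ := hΓ γ hγ
  obtain ⟨c, hc⟩ := hc F ⟨γ, hγ, hF⟩
  rw [Measure.map_map γ.continuous.measurable (toHomeo H).symm.continuous.measurable]
  have e : (γ ∘ (toHomeo H).symm : S1 → S1) = (toHomeo H).symm ∘ fun x => x + (c : S1) := by
    funext y
    obtain ⟨z, rfl⟩ := (toHomeo H).surjective y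
    simp only [comp_apply, Homeomorph.symm_apply_apply]
    rw [Homeomorph.eq_symm_apply]
    revert z
    refine S1_ind fun x => ?_
    rw [hF, toHomeo_coe, toHomeo_coe, hc, AddCircle.coe_add]
  rw [e, ← Measure.map_map (toHomeo H).symm.continuous.measurable (by fun_prop),
    map_add_right_eq_self]

/-- If no nontrivial interval is contractible the action on the line is free. -/
theorem free_of (G : Subgroup CircleDeg1Liftˣ) (hno : ∀ a b, a < b → ¬ Con G a b)
    (g : CircleDeg1Liftˣ) (hg : g ∈ G) (p : ℝ) (hp : (g : CircleDeg1Lift) p = p) (x : ℝ) :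
    (g : CircleDeg1Lift) x = x := by
  have key : ∀ g ∈ G, ∀ p : ℝ, (g : CircleDeg1Lift) p = p → ∀ x : ℝ, p ≤ x →
      x ≤ (g : CircleDeg1Lift) x := by
    intro g hg p hp x hx
    by_contra! hlt
    have hm := unit_strictMono g
    have hit : ∀ n : ℕ, (g : CircleDeg1Lift)^[n] p = p := fun n => iterate_fixed hp n
    have hanti : Antitone fun n : ℕ => (g : CircleDeg1Lift)^[n] x :=
      hm.monotone.antitone_iterate_of_map_le hlt.le
    have hbdd : BddBelow (range fun n : ℕ => (g : CircleDeg1Lift)^[n] x) := by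
      refine ⟨p, ?_⟩
      rintro _ ⟨n, rfl⟩
      rw [← hit n]
      exact hm.monotone.iterate n hx
    have hlim := tendsto_atTop_ciInf hanti hbdd
    set L := ⨅ n : ℕ, (g : CircleDeg1Lift)^[n] x
    have hL : (g : CircleDeg1Lift) L = L :=
      isFixedPt_of_tendsto_iterate hlim (unit_cont g).continuousAt
    have hLx : L < x := (ciInf_le hbdd 1).trans_lt (by simpa using hlt)
    refine hno L x hLx fun ε hε => ?_
    have : ∀ᶠ n : ℕ in atTop, (g : CircleDeg1Lift)^[n] x < L + ε :=
      hlim.eventually_lt_const (by linarith)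
    obtain ⟨n, hn⟩ := this.exists
    refine ⟨g ^ n, G.pow_mem hg n, ?_⟩
    rw [Units.val_pow_eq_pow_val, coe_pow, iterate_fixed hL n]
    linarith
  have hp' : ((g⁻¹ : CircleDeg1Liftˣ) : CircleDeg1Lift) p = p := by
    conv_lhs => rw [← hp]
    simp
  have key2 : ∀ x, p ≤ x → (g : CircleDeg1Lift) x = x := by
    intro x hx
    refine le_antisymm ?_ (key g hg p hp x hx)
    have := key g⁻¹ (G.inv_mem hg) p hp' x hx
    simpa using (g : CircleDeg1Lift).monotone this
  obtain ⟨n, hn⟩ := exists_nat_ge (p - x)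
  have := key2 (x + n) (by linarith)
  rw [map_add_nat] at this
  linarith

end PCH

namespace PCH

open CircleDeg1Lift Function


/-- The action is free. -/
def Fr (G : Subgroup CircleDeg1Liftˣ) : Prop :=
  ∀ g ∈ G, ∀ p : ℝ, (g : CircleDeg1Lift) p = p → ∀ x : ℝ, (g : CircleDeg1Lift) x = x

theorem lt_of_lt {G : Subgroup CircleDeg1Liftˣ} (hF : Fr G) {f g : CircleDeg1Liftˣ}
    (hf : f ∈ G) (hg : g ∈ G) {y : ℝ} (hy : (f : CircleDeg1Lift) y < (g : CircleDeg1Lift) y)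
    (x : ℝ) : (f : CircleDeg1Lift) x < (g : CircleDeg1Lift) x := by
  by_contra! hx
  obtain ⟨z, hz⟩ : ∃ z, (f : CircleDeg1Lift) z = (g : CircleDeg1Lift) z :=
by
    obtain ⟨z, hz⟩ := mem_range_of_exists_le_of_exists_ge
      ((unit_cont f).sub (unit_cont g)) (c := 0) ⟨y, sub_nonpos.2 hy.le⟩ ⟨x, sub_nonneg.2 hx⟩
    exact ⟨z, sub_eq_zero.1 hz⟩
  have h1 := hF (g⁻¹ * f) (G.mul_mem (G.inv_mem hg) hf) z (by
    rw [Units.val_mul, mul_apply, hz]; simp) y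
  rw [Units.val_mul, mul_apply] at h1
  have h2 := congrArg (g : CircleDeg1Lift) h1
  rw [units_apply_inv_apply] at h2
  linarith

theorem le_total' {G : Subgroup CircleDeg1Liftˣ} (hF : Fr G) {f g : CircleDeg1Liftˣ}
    (hf : f ∈ G) (hg : g ∈ G) :
    (f : CircleDeg1Lift) ≤ (g : CircleDeg1Lift) ∨ (g : CircleDeg1Lift) ≤ (f : CircleDeg1Lift) := by
  by_cases h : (f : CircleDeg1Lift) ≤ (g : CircleDeg1Lift)
  · exact Or.inl h
  · right
    obtain ⟨y, hy⟩ : ∃ y, (g : CircleDeg1Lift) y < (f : CircleDeg1Lift) y := by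
      by_contra! H
      exact h H
    exact fun x => (lt_of_lt hF hg hf hy x).le

theorem le_of_tau_lt {G : Subgroup CircleDeg1Liftˣ} (hF : Fr G) {f g : CircleDeg1Liftˣ}
    (hf : f ∈ G) (hg : g ∈ G) (h : translationNumber (f : CircleDeg1Lift) < translationNumber (g : CircleDeg1Lift)) :
    (f : CircleDeg1Lift) ≤ (g : CircleDeg1Lift) :=
  (le_total' hF hf hg).resolve_right fun h' => absurd (translationNumber_mono h') (not_le.2 h)

theorem mul_le_mul_lift {a b c d : CircleDeg1Lift} (h1 : a ≤ b) (h2 : c ≤ d) : a * c ≤ b * d :=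
  fun x => (a.monotone (h2 x)).trans (h1 (d x))

theorem tau_pos {f : CircleDeg1Liftˣ} (h : ∀ x, x < (f : CircleDeg1Lift) x) :
    0 < translationNumber (f : CircleDeg1Lift) :=
  lt_translationNumber_of_forall_add_lt _ (unit_cont f) (by simpa using h)

theorem exists_small {G : Subgroup CircleDeg1Liftˣ} (hF : Fr G) (hG : Mn G)
    (hT : translate (Multiplicative.ofAdd (1 : ℝ)) ∈ G) (n : ℕ) :
    ∃ u ∈ G, 0 < translationNumber (u : CircleDeg1Lift) ∧ translationNumber (u : CircleDeg1Lift) ≤ (1 / 2) ^ n ∧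
      ∀ x, x < (u : CircleDeg1Lift) x := by
  induction n with
  | zero =>
    refine ⟨_, hT, ?_, ?_, ?_⟩
    · rw [translationNumber_translate]; norm_num
    · rw [translationNumber_translate]; norm_num
    · intro x; rw [translate_apply]; linarith
  | succ n ih =>
    obtain ⟨u, hu, h0, h1, h2⟩ := ih
    obtain ⟨v, hv, hv1, hv2⟩ := hG 0 0 _ (h2 0)
    have hvpos : ∀ x, x < (v : CircleDeg1Lift) x := fun x => lt_of_lt hF G.one_mem hv hv1 x
    have hw : v⁻¹ * u ∈ G := G.mul_mem (G.inv_mem hv) hu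
    have hwpos : ∀ x, x < ((v⁻¹ * u : CircleDeg1Liftˣ) : CircleDeg1Lift) x := fun x => by
      refine lt_of_lt hF G.one_mem hw (y := 0) ?_ x
      have := unit_strictMono v⁻¹ hv2
      rw [units_inv_apply_apply] at this
      exact this
    have hprod : (v : CircleDeg1Lift) * ((v⁻¹ * u : CircleDeg1Liftˣ) : CircleDeg1Lift) = u := by
      rw [← Units.val_mul]; simp
    have half : ∀ z : CircleDeg1Liftˣ, (z : CircleDeg1Lift) * z ≤ (u : CircleDeg1Lift) →
        translationNumber (z : CircleDeg1Lift) ≤ (1 / 2) ^ (n + 1) := by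
      intro z hz
      have := translationNumber_mono hz
      rw [translationNumber_mul_of_commute (Commute.refl _)] at this
      rw [pow_succ]
      linarith
    rcases le_total' hF hv hw with h | h
    · refine ⟨v, hv, tau_pos hvpos, half v ?_, hvpos⟩
      rw [← hprod]
      exact mul_le_mul_lift le_rfl h
    · refine ⟨_, hw, tau_pos hwpos, half _ ?_, hwpos⟩
      conv_rhs => rw [← hprod]
      exact mul_le_mul_lift h le_rfl

theorem tau_bracket {G : Subgroup CircleDeg1Liftˣ} (hF : Fr G) {u f : CircleDeg1Liftˣ}
    (hu : u ∈ G) (hf : f ∈ G) (h0 : 0 < translationNumber (u : CircleDeg1Lift)) :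
    ∃ m : ℤ, m * translationNumber (u : CircleDeg1Lift) ≤ translationNumber (f : CircleDeg1Lift) ∧
      translationNumber (f : CircleDeg1Lift) ≤ (m + 1) * translationNumber (u : CircleDeg1Lift) ∧
      ((u ^ (m - 1) : CircleDeg1Liftˣ) : CircleDeg1Lift) ≤ f ∧
      (f : CircleDeg1Lift) ≤ ((u ^ (m + 1) : CircleDeg1Liftˣ) : CircleDeg1Lift) := by
  set m := ⌊translationNumber (f : CircleDeg1Lift) / translationNumber (u : CircleDeg1Lift)⌋
  have h1 : m * translationNumber (u : CircleDeg1Lift) ≤ translationNumber (f : CircleDeg1Lift) :=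
    (le_div_iff₀ h0).1 (Int.floor_le _)
  have h2 : translationNumber (f : CircleDeg1Lift) < (m + 1) * translationNumber (u : CircleDeg1Lift) :=
    (div_lt_iff₀ h0).1 (Int.lt_floor_add_one _)
  refine ⟨m, h1, h2.le, ?_, ?_⟩
  · refine le_of_tau_lt hF (G.zpow_mem hu _) hf ?_
    rw [translationNumber_zpow]
    push_cast
    linarith
  · refine le_of_tau_lt hF hf (G.zpow_mem hu _) ?_
    rw [translationNumber_zpow]
    push_cast
    linarith

theorem tau_mul {G : Subgroup CircleDeg1Liftˣ} (hF : Fr G) (hG : Mn G)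
    (hT : translate (Multiplicative.ofAdd (1 : ℝ)) ∈ G) {f g : CircleDeg1Liftˣ}
    (hf : f ∈ G) (hg : g ∈ G) :
    translationNumber ((f : CircleDeg1Lift) * g) = translationNumber (f : CircleDeg1Lift) + translationNumber (g : CircleDeg1Lift) := by
  have key : ∀ n : ℕ, |translationNumber ((f : CircleDeg1Lift) * g) - (translationNumber (f : CircleDeg1Lift) + translationNumber (g : CircleDeg1Lift))|
      ≤ 4 * (1 / 2) ^ n := by
    intro n
    obtain ⟨u, hu, h0, hun, -⟩ := exists_small hF hG hT n
    obtain ⟨m, m1, m2, m3, m4⟩ := tau_bracket hF hu hf h0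
    obtain ⟨k, k1, k2, k3, k4⟩ := tau_bracket hF hu hg h0
    have l1 := translationNumber_mono (mul_le_mul_lift m3 k3)
    have l2 := translationNumber_mono (mul_le_mul_lift m4 k4)
    rw [← Units.val_mul, ← zpow_add, translationNumber_zpow] at l1
    rw [← Units.val_mul (u ^ (m + 1)), ← zpow_add, translationNumber_zpow] at l2
    push_cast at l1 l2
    rw [abs_le]
    constructor <;> nlinarith
  have hlim : Tendsto (fun n : ℕ => 4 * (1 / 2 : ℝ) ^ n) atTop (𝓝 (4 * 0)) :=
    (tendsto_pow_atTop_nhds_zero_of_lt_one (by norm_num) (by norm_num)).const_mul _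
  have := ge_of_tendsto' hlim key
  rw [mul_zero] at this
  have := abs_nonpos_iff.1 this
  linarith

theorem exists_con (Γ : Subgroup (S1 ≃ₜ S1)) (hΓ : ∀ f ∈ Γ, OrientationPreserving f)
    (hG : Mn (lifts Γ)) (hmeas : ¬ HasInvariantProbMeasure Γ) :
    ∃ a b, a < b ∧ Con (lifts Γ) a b := by
  by_contra! hno
  have hF : Fr (lifts Γ) := fun g hg p hp x => free_of _ hno g hg p hp x
  have hT : translate (Multiplicative.ofAdd (1 : ℝ)) ∈ lifts Γ := by
    simpa using lifts_translate Γ 1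
  let G := lifts Γ
  let f₁ : G →* CircleDeg1Lift := (Units.coeHom CircleDeg1Lift).comp G.subtype
  let t : G →* Multiplicative ℝ :=
    { toFun := fun g => Multiplicative.ofAdd (translationNumber ((g : CircleDeg1Liftˣ) : CircleDeg1Lift))
      map_one' := by simp
      map_mul' := fun a b => by
        rw [← ofAdd_add, ← tau_mul hF hG hT a.2 b.2]
        rfl }
  let f₂ : G →* CircleDeg1Lift := (Units.coeHom CircleDeg1Lift).comp (translate.comp t)
  obtain ⟨h, hh⟩ := semiconj_of_group_action_of_forall_translationNumber_eq f₁ f₂ (fun g =>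
    (translationNumber_translate _).symm)
  have hh' : ∀ g ∈ G, ∀ x : ℝ, h ((g : CircleDeg1Lift) x) = h x + translationNumber (g : CircleDeg1Lift) := by
    intro g hg x
    rw [add_comm]
    exact hh ⟨g, hg⟩ x
  refine hmeas (measure_of Γ hΓ hG h ?_ fun g hg => ⟨_, hh' g hg⟩)
  rw [DenseRange, Metric.dense_iff]
  intro y r hr
  obtain ⟨n, hn⟩ := exists_pow_lt_of_lt_one hr (by norm_num : (1 / 2 : ℝ) < 1)
  obtain ⟨u, hu, h0, hun, -⟩ := exists_small hF hG hT n
  set m := ⌊(y - h 0) / translationNumber (u : CircleDeg1Lift)⌋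
  have h1 : m * translationNumber (u : CircleDeg1Lift) ≤ y - h 0 :=
    (le_div_iff₀ h0).1 (Int.floor_le _)
  have h2 : y - h 0 < (m + 1) * translationNumber (u : CircleDeg1Lift) :=
    (div_lt_iff₀ h0).1 (Int.lt_floor_add_one _)
  refine ⟨h (((u ^ m : CircleDeg1Liftˣ) : CircleDeg1Lift) 0), ?_, mem_range_self _⟩
  rw [hh' _ (G.zpow_mem hu m), translationNumber_zpow, Metric.mem_ball, Real.dist_eq, abs_lt]
  constructor <;> linarith

/-- A homeomorphism with irrational translation number commuting with `Γ` yields a measure. -/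
theorem rational_of (Γ : Subgroup (S1 ≃ₜ S1)) (hΓ : ∀ f ∈ Γ, OrientationPreserving f)
    (hG : Mn (lifts Γ)) (hmeas : ¬ HasInvariantProbMeasure Γ) (Θ : CircleDeg1Liftˣ)
    (hc : ∀ g ∈ lifts Γ, ∀ x, (Θ : CircleDeg1Lift) ((g : CircleDeg1Lift) x) =
      (g : CircleDeg1Lift) ((Θ : CircleDeg1Lift) x)) :
    ¬ Irrational (translationNumber (Θ : CircleDeg1Lift)) := by
  intro hirr
  set ρ := translationNumber (Θ : CircleDeg1Lift) with hρ
  obtain ⟨h, hh⟩ := units_semiconj_of_translationNumber_eq (f₁ := Θ)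
    (f₂ := translate (Multiplicative.ofAdd ρ)) (by rw [translationNumber_translate])
  have hz : ∀ (F : CircleDeg1Lift), (∀ x, F ((Θ : CircleDeg1Lift) x) = F x + ρ) → ∀ (n : ℤ) (x : ℝ),
      F (((Θ ^ n : CircleDeg1Liftˣ) : CircleDeg1Lift) x) = F x + n * ρ := by
    intro F hF n
    induction n using Int.induction_on with
    | zero => intro x; simp
    | succ n ih =>
      intro x
      rw [zpow_add_one, Units.val_mul, mul_apply, ih, hF]
      push_cast; ring
    | pred n ih =>
      intro x
      have h1 := hF (((Θ⁻¹ : CircleDeg1Liftˣ) : CircleDeg1Lift) x)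
      rw [units_apply_inv_apply] at h1
      rw [zpow_sub_one, Units.val_mul, mul_apply, ih, h1]
      push_cast; ring
  have hh1 : ∀ x, h ((Θ : CircleDeg1Lift) x) = h x + ρ := fun x => by
    rw [add_comm]; exact hh x
  have hdense : ∀ a b : ℝ, a < b → ∃ n k : ℤ, a < n * ρ + k ∧ n * ρ + k < b := by
    intro a b hab
    have hd : Dense (AddSubgroup.closure {ρ, 1} : Set ℝ) :=
      dense_addSubgroupClosure_pair_iff.2 (by simpa using hirr)
    obtain ⟨y, hy, hy'⟩ := hd.inter_open_nonempty _ isOpen_Ioo (nonempty_Ioo.2 hab)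
    rw [SetLike.mem_coe, AddSubgroup.mem_closure_pair] at hy'
    obtain ⟨n, k, rfl⟩ := hy'
    exact ⟨n, k, by simpa using hy⟩
  refine hmeas (measure_of Γ hΓ hG h ?_ fun g hg => ?_)
  · rw [DenseRange, dense_iff_exists_between]
    intro a b hab
    obtain ⟨n, k, h1, h2⟩ := hdense (a - h 0) (b - h 0) (by linarith)
    refine ⟨_, mem_range_self (((Θ ^ n : CircleDeg1Liftˣ) : CircleDeg1Lift) 0 + k), ?_⟩
    rw [map_add_int, hz h hh1]
    constructor <;> linarith
  · have hg1 : ∀ x, (h * (g : CircleDeg1Lift)) ((Θ : CircleDeg1Lift) x) =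
        (h * (g : CircleDeg1Lift)) x + ρ := fun x => by
      rw [mul_apply, mul_apply, ← hc g hg, hh1]
    have hle : ∀ x y, h ((g : CircleDeg1Lift) x) - h x ≤ h ((g : CircleDeg1Lift) y) - h y := by
      intro x y
      refine le_of_forall_pos_le_add fun ε hε => ?_
      obtain ⟨n, k, h1, h2⟩ := hdense (h y - ε - h x) (h y - h x) (by linarith)
      have e1 : h (((Θ ^ n : CircleDeg1Liftˣ) : CircleDeg1Lift) x + k) = h x + (n * ρ + k) := by
        rw [map_add_int, hz h hh1]; ring
      have e2 : (h * (g : CircleDeg1Lift)) (((Θ ^ n : CircleDeg1Liftˣ) : CircleDeg1Lift) x + k) =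
          (h * (g : CircleDeg1Lift)) x + (n * ρ + k) := by
        rw [map_add_int, hz _ hg1]; ring
      have hlt : ((Θ ^ n : CircleDeg1Liftˣ) : CircleDeg1Lift) x + k < y := by
        by_contra! H
        have := h.monotone H
        linarith
      have := (h * (g : CircleDeg1Lift)).monotone hlt.le
      rw [e2, mul_apply, mul_apply] at this
      linarith
    refine ⟨h ((g : CircleDeg1Lift) 0) - h 0, fun x => ?_⟩
    have := le_antisymm (hle x 0) (hle 0 x)
    linarith

theorem Con.mono {G : Subgroup CircleDeg1Liftˣ} {a b a' b' : ℝ} (h : Con G a b) (ha : a ≤ a')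
    (hb : b' ≤ b) : Con G a' b' := by
  intro ε hε
  obtain ⟨g, hg, h1⟩ := h ε hε
  refine ⟨g, hg, ?_⟩
  have := (g : CircleDeg1Lift).monotone ha
  have := (g : CircleDeg1Lift).monotone hb
  linarith

theorem Con.map {G : Subgroup CircleDeg1Liftˣ} {a b : ℝ} (h : Con G a b) {g : CircleDeg1Liftˣ}
    (hg : g ∈ G) : Con G ((g : CircleDeg1Lift) a) ((g : CircleDeg1Lift) b) := by
  intro ε hε
  obtain ⟨f, hf, h1⟩ := h ε hε
  refine ⟨f * g⁻¹, G.mul_mem hf (G.inv_mem hg), ?_⟩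
  simpa [Units.val_mul, mul_apply] using h1

theorem Con.refl (G : Subgroup CircleDeg1Liftˣ) (a : ℝ) : Con G a a :=
  fun ε hε => ⟨1, G.one_mem, by simpa using hε⟩

theorem Con.lt {G : Subgroup CircleDeg1Liftˣ} {a b : ℝ} (h : Con G a b) : b < a + 1 := by
  by_contra! H
  obtain ⟨g, hg, h1⟩ := h 1 one_pos
  have := (g : CircleDeg1Lift).monotone H
  rw [map_add_one] at this
  linarith

theorem Con.arc {Γ : Subgroup (S1 ≃ₜ S1)} {a b : ℝ} (hab : a ≤ b) (h : Con (lifts Γ) a b) :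
    ContractibleArc Γ a b := by
  have h' : ∀ n : ℕ, ∃ (f : S1 ≃ₜ S1) (g : CircleDeg1Liftˣ), (f ∈ Γ ∧ IsLiftOf (g : CircleDeg1Lift) f) ∧
      (g : CircleDeg1Lift) b - (g : CircleDeg1Lift) a < 1 / ((n : ℝ) + 1) := by
    intro n
    obtain ⟨g, ⟨f, hf, hg⟩, h1⟩ := h (1 / ((n : ℝ) + 1)) (by positivity)
    exact ⟨f, g, ⟨hf, hg⟩, h1⟩
  choose f g h1 h2 using h'
  refine ⟨f, g, h1, squeeze_zero (fun n => ?_) (fun n => (h2 n).le)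
    tendsto_one_div_add_atTop_nhds_zero_nat⟩
  exact sub_nonneg.2 ((g n : CircleDeg1Lift).monotone hab)

/-- The supremum of right endpoints of contractible intervals starting at `x`. -/
def thetaFun (G : Subgroup CircleDeg1Liftˣ) (x : ℝ) : ℝ := sSup {b | x ≤ b ∧ Con G x b}

theorem theta_bdd (G : Subgroup CircleDeg1Liftˣ) (x : ℝ) : BddAbove {b | x ≤ b ∧ Con G x b} :=
  ⟨x + 1, fun _ hb => hb.2.lt.le⟩

theorem theta_ne (G : Subgroup CircleDeg1Liftˣ) (x : ℝ) : {b | x ≤ b ∧ Con G x b}.Nonempty :=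
  ⟨x, le_rfl, Con.refl G x⟩

theorem le_theta {G : Subgroup CircleDeg1Liftˣ} {x b : ℝ} (hx : x ≤ b) (h : Con G x b) :
    b ≤ thetaFun G x := le_csSup (theta_bdd G x) ⟨hx, h⟩

theorem theta_mono (G : Subgroup CircleDeg1Liftˣ) : Monotone (thetaFun G) := by
  intro x y hxy
  refine csSup_le (theta_ne G x) fun b hb => ?_
  rcases le_total y b with h | h
  · exact le_theta h (hb.2.mono hxy le_rfl)
  · exact h.trans (le_theta le_rfl (Con.refl G y))

theorem theta_comm_le {G : Subgroup CircleDeg1Liftˣ} {g : CircleDeg1Liftˣ} (hg : g ∈ G) (x : ℝ) :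
    thetaFun G x ≤ ((g⁻¹ : CircleDeg1Liftˣ) : CircleDeg1Lift) (thetaFun G ((g : CircleDeg1Lift) x)) := by
  refine csSup_le (theta_ne G x) fun b hb => ?_
  have := le_theta ((g : CircleDeg1Lift).monotone hb.1) (hb.2.map hg)
  have := ((g⁻¹ : CircleDeg1Liftˣ) : CircleDeg1Lift).monotone this
  rwa [units_inv_apply_apply] at this

theorem theta_comm {G : Subgroup CircleDeg1Liftˣ} {g : CircleDeg1Liftˣ} (hg : g ∈ G) (x : ℝ) :
    thetaFun G ((g : CircleDeg1Lift) x) = (g : CircleDeg1Lift) (thetaFun G x) := by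
  apply le_antisymm
  · have := theta_comm_le (G.inv_mem hg) ((g : CircleDeg1Lift) x)
    rwa [inv_inv, units_inv_apply_apply] at this
  · have := (g : CircleDeg1Lift).monotone (theta_comm_le hg x)
    rwa [units_apply_inv_apply] at this

theorem main (Γ : Subgroup (S1 ≃ₜ S1)) (hΓ : ∀ f ∈ Γ, OrientationPreserving f)
    (hmin : IsMinimalSubgroup Γ) (hmeas : ¬ HasInvariantProbMeasure Γ) :
    ∃ θ : S1 ≃ₜ S1, OrientationPreserving θ ∧
      (∃ κ : ℕ, 1 ≤ κ ∧ θ ^ κ = 1) ∧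
      (∀ γ ∈ Γ, Commute θ γ) ∧
      ∃ Θ : CircleDeg1Liftˣ, IsLiftOf (Θ : CircleDeg1Lift) θ ∧
        (∀ x : ℝ, x < (Θ : CircleDeg1Lift) x ∧ (Θ : CircleDeg1Lift) x ≤ x + 1) ∧
        ∀ x a b : ℝ, x ≤ a → a ≤ b → b < (Θ : CircleDeg1Lift) x →
          ContractibleArc Γ a b := by
  have hG := lifts_Mn Γ hΓ hmin
  have hT : translate (Multiplicative.ofAdd (1 : ℝ)) ∈ lifts Γ := by
    simpa using lifts_translate Γ 1
  obtain ⟨p, q, hpq, hcon⟩ := exists_con Γ hΓ hG hmeas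
  let Θ₀ : CircleDeg1Lift := ⟨⟨thetaFun (lifts Γ), theta_mono _⟩, fun x => by
    have := theta_comm hT x
    rw [translate_apply, translate_apply] at this
    rw [add_comm x, add_comm _ (1 : ℝ)]
    exact this⟩
  have hcomm : ∀ g ∈ lifts Γ, ∀ x, Θ₀ ((g : CircleDeg1Lift) x) = (g : CircleDeg1Lift) (Θ₀ x) :=
    fun g hg x => theta_comm hg x
  have hinj : Injective Θ₀ := inj_of _ hG Θ₀ fun g hg x y hxy => by
    rw [hcomm g hg, hcomm g hg, hxy]
  have hdense : DenseRange Θ₀ := by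
    rw [DenseRange, dense_iff_exists_between]
    intro a b hab
    obtain ⟨g, hg, h1, h2⟩ := hG (Θ₀ 0) a b hab
    exact ⟨_, ⟨(g : CircleDeg1Lift) 0, hcomm g hg 0⟩, h1, h2⟩
  obtain ⟨Θ, hΘ⟩ := isUnit_iff_bijective.2 (bij_of Θ₀ hinj hdense)
  have hΘ' : ∀ x, (Θ : CircleDeg1Lift) x = thetaFun (lifts Γ) x := fun x => by rw [hΘ]; rfl
  rw [← hΘ] at hcomm
  have hrat := rational_of Γ hΓ hG hmeas Θ hcomm
  refine ⟨toHomeo Θ, ⟨Θ, toHomeo_coe Θ⟩, ?_, ?_, Θ, toHomeo_coe Θ, fun x => ⟨?_, ?_⟩, ?_⟩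
  · simp only [Irrational, not_not] at hrat
    obtain ⟨r, hr⟩ := hrat
    obtain ⟨x₀, hx₀⟩ := (translationNumber_eq_rat_iff (Θ : CircleDeg1Lift) (unit_cont Θ) r.pos
      (m := r.num)).1 (by rw [← hr]; exact_mod_cast (Rat.num_div_den r).symm)
    refine ⟨r.den, r.pos, ?_⟩
    have hpc : ∀ (n : ℕ), ∀ g ∈ lifts Γ, ∀ x, ((Θ : CircleDeg1Lift) ^ n) ((g : CircleDeg1Lift) x) =
        (g : CircleDeg1Lift) (((Θ : CircleDeg1Lift) ^ n) x) := by
      intro n g hg x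
      rw [coe_pow]
      exact (Function.Commute.iterate_left (f := (Θ : CircleDeg1Lift)) (g := (g : CircleDeg1Lift))
        (hcomm g hg) n) x
    have hall : ∀ x, ((Θ : CircleDeg1Lift) ^ r.den) x = x + r.num := by
      have hd : Dense {y | ∃ g ∈ lifts Γ, (g : CircleDeg1Lift) x₀ = y} := by
        rw [dense_iff_exists_between]
        intro a b hab
        obtain ⟨g, hg, h1, h2⟩ := hG x₀ a b hab
        exact ⟨_, ⟨g, hg, rfl⟩, h1, h2⟩
      have := Continuous.ext_on hd (f := ((Θ : CircleDeg1Lift) ^ r.den)) (g := fun x => x + r.num)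
        (continuous_pow _ (unit_cont Θ) _) (by fun_prop) (by
          rintro _ ⟨g, hg, rfl⟩
          rw [hpc _ g hg, hx₀]
          simp)
      exact fun x => congrFun this x
    have hpow : ∀ (n : ℕ) (x : ℝ), (toHomeo Θ ^ n) (x : S1) =
        ((((Θ : CircleDeg1Lift) ^ n) x : ℝ) : S1) := by
      intro n
      induction n with
      | zero => intro x; simp
      | succ n ih =>
        intro x
        rw [pow_succ, pow_succ, mul_apply, ← ih, ← toHomeo_coe]
        rfl
    refine homeo_ext fun x => ?_
    rw [hpow, hall, AddCircle.coe_add]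
    have : ((r.num : ℝ) : S1) = 0 := by
      rw [AddCircle.coe_eq_zero_iff]
      exact ⟨r.num, by simp⟩
    rw [this, add_zero]
    rfl
  · intro γ hγ
    obtain ⟨F, hF⟩ := hΓ γ hγ
    refine homeo_ext fun x => ?_
    change toHomeo Θ (γ (x : S1)) = γ (toHomeo Θ (x : S1))
    rw [hF, toHomeo_coe, toHomeo_coe, hF, hcomm F ⟨γ, hγ, hF⟩]
  · obtain ⟨g, hg, h1, h2⟩ := hG x p q hpq
    have h3 := (hcon.mono h1.le le_rfl).map ((lifts Γ).inv_mem hg)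
    have h4 := unit_strictMono g⁻¹ h2
    rw [units_inv_apply_apply] at h3 h4
    rw [hΘ']
    exact h4.trans_le (le_theta h4.le h3)
  · rw [hΘ']
    exact csSup_le (theta_ne _ x) fun b hb => hb.2.lt.le
  · intro x a b hxa hab hb
    rw [hΘ'] at hb
    obtain ⟨c, hc, hbc⟩ := exists_lt_of_lt_csSup (theta_ne _ x) hb
    exact (hc.2.mono hxa hbc.le).arc hab

end PCH

/-- A minimal subgroup of `Homeo₊(S¹)` preserving no Borel probability measure
admits a periodic homeomorphism `θ` commuting with all of `Γ` such that every closed interval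
contained in `[x, θ(x)[` is `Γ`-contractible (the interval `[x, θ(x)[` being the whole circle
when `θ = id`; this is expressed via a lift `Θ` of `θ` with `x < Θ x ≤ x + 1`). -/
theorem exists_periodic_commuting_homeomorphism
    (Γ : Subgroup (S1 ≃ₜ S1)) (hΓ : ∀ f ∈ Γ, OrientationPreserving f)
    (hmin : IsMinimalSubgroup Γ) (hmeas : ¬ HasInvariantProbMeasure Γ) :
    ∃ θ : S1 ≃ₜ S1, OrientationPreserving θ ∧
      (∃ κ : ℕ, 1 ≤ κ ∧ θ ^ κ = 1) ∧
      (∀ γ ∈ Γ, Commute θ γ) ∧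
      ∃ Θ : CircleDeg1Liftˣ, IsLiftOf (Θ : CircleDeg1Lift) θ ∧
        (∀ x : ℝ, x < (Θ : CircleDeg1Lift) x ∧ (Θ : CircleDeg1Lift) x ≤ x + 1) ∧
        ∀ x a b : ℝ, x ≤ a → a ≤ b → b < (Θ : CircleDeg1Lift) x →
          ContractibleArc Γ a b := by
  exact PCH.main Γ hΓ hmin hmeas

end
end

section
/- Let Γ be a subgroup of Diff^ω₊(S¹) which is locally nondiscrete with respect to the C⁰-topology. Then Γ has no exceptional minimal set; that is, there exists no nonempty closed Γ-invariant minimal subset of S¹ homeomorphic to a Cantor set. -/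
open Filter Topology Set MeasureTheory Classical

noncomputable section

/-- Standing hypotheses on the stabilizer of an endpoint of a gap. -/
structure GoodStab (G : Subgroup (ℝ ≃o ℝ)) (p : ℝ) (C : Set ℝ) : Prop where
  an : ∀ g ∈ G, AnalyticOnNhd ℝ (⇑g) univ
  dpos : ∀ g ∈ G, ∀ x, 0 < deriv (⇑g) x
  fix : ∀ g ∈ G, g p = p
  inv : ∀ g ∈ G, ∀ x ∈ C, g x ∈ C
  closed : IsClosed C
  acc : ∀ ε > 0, ∃ c ∈ C, p - ε < c ∧ c < p
  empt : ∀ a b, a < b → ∃ w ∈ Ioo a b, w ∉ C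

/-- Germ order on the left of `p`. -/
def germLT (p : ℝ) (f g : ℝ ≃o ℝ) : Prop := ∀ᶠ x in 𝓝[<] p, f x < g x

lemma eventually_left_iff {p : ℝ} {P : ℝ → Prop} :
    (∀ᶠ x in 𝓝[<] p, P x) ↔ ∃ ε > 0, ∀ x, p - ε < x → x < p → P x := by
  rw [eventually_iff, mem_nhdsLT_iff_exists_Ioo_subset]
  constructor
  · rintro ⟨l, hl, h⟩
    exact ⟨p - l, sub_pos.2 hl, fun x h1 h2 => h ⟨by linarith, h2⟩⟩
  · rintro ⟨ε, hε, h⟩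
    exact ⟨p - ε, by simpa using hε, fun x hx => h x hx.1 hx.2⟩

lemma germ_tri {G : Subgroup (ℝ ≃o ℝ)} {p : ℝ} {C : Set ℝ} (H : GoodStab G p C)
    {f g : ℝ ≃o ℝ} (hf : f ∈ G) (hg : g ∈ G) : f = g ∨ germLT p f g ∨ germLT p g f := by
  have ha := H.an f hf
  have hb := H.an g hg
  rcases (ha p (mem_univ _)).eventually_eq_or_eventually_ne (hb p (mem_univ _)) with h | h
  · left
    have := ha.eq_of_eventuallyEq hb h
    ext x
    exact congrFun this x
  · right
    have h' : ∀ᶠ z in 𝓝[<] p, f z ≠ g z := h.filter_mono (nhdsWithin_mono _ (fun x hx => ne_of_lt hx))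
    obtain ⟨ε, hε, h⟩ := eventually_left_iff.1 h'
    have key : ∀ x ∈ Ioo (p - ε) p, ∀ y ∈ Ioo (p - ε) p, f x < g x → g y < f y → False := by
      intro x hx y hy h1 h2
      have hc : ContinuousOn (fun t => f t - g t) (Ioo (p - ε) p) :=
        (f.continuous.sub g.continuous).continuousOn
      have := isPreconnected_Ioo.intermediate_value hx hy hc
      obtain ⟨t, ht, ht0⟩ := this (show (0:ℝ) ∈ Icc _ _ from ⟨by linarith, by linarith⟩)
      exact h t ht.1 ht.2 (by simpa [sub_eq_zero] using ht0)
    have hm : p - ε / 2 ∈ Ioo (p - ε) p := ⟨by linarith, by linarith⟩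
    rcases lt_or_gt_of_ne (h _ hm.1 hm.2) with h1 | h1
    · left
      refine eventually_left_iff.2 ⟨ε, hε, fun x hx1 hx2 => ?_⟩
      exact (lt_or_gt_of_ne (h x hx1 hx2)).resolve_right fun h2 => key _ hm _ ⟨hx1, hx2⟩ h1 h2
    · right
      refine eventually_left_iff.2 ⟨ε, hε, fun x hx1 hx2 => ?_⟩
      exact (lt_or_gt_of_ne (h x hx1 hx2)).resolve_left fun h2 => key _ ⟨hx1, hx2⟩ _ hm h2 h1

lemma tendsto_left {p : ℝ} (k : ℝ ≃o ℝ) (hk : k p = p) : Tendsto k (𝓝[<] p) (𝓝[<] p) := by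
  refine tendsto_nhdsWithin_iff.2 ⟨?_, ?_⟩
  · have := k.continuous.tendsto p
    rw [hk] at this
    exact this.mono_left nhdsWithin_le_nhds
  · filter_upwards [self_mem_nhdsWithin] with x hx
    have := k.strictMono (show x < p from hx)
    rwa [hk] at this

lemma germ_mul_left {p : ℝ} {f g : ℝ ≃o ℝ} (k : ℝ ≃o ℝ) (h : germLT p f g) :
    germLT p (k * f) (k * g) := by
  filter_upwards [h] with x hx
  exact k.strictMono hx

lemma germ_mul_right {p : ℝ} {f g : ℝ ≃o ℝ} (k : ℝ ≃o ℝ) (hk : k p = p) (h : germLT p f g) :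
    germLT p (f * k) (g * k) := (tendsto_left k hk).eventually h

lemma germ_trans {p : ℝ} {f g k : ℝ ≃o ℝ} (h : germLT p f g) (h' : germLT p g k) :
    germLT p f k := by
  filter_upwards [h, h'] with x hx hx'
  exact hx.trans hx'

lemma germ_irrefl {p : ℝ} {f : ℝ ≃o ℝ} (h : germLT p f f) : False := by
  obtain ⟨x, hx⟩ := h.exists
  exact lt_irrefl _ hx

/-- Elementary distortion estimate. -/
lemma distortion_step {G : Subgroup (ℝ ≃o ℝ)} {p : ℝ} {C : Set ℝ} (H : GoodStab G p C)
    {f : ℝ ≃o ℝ} (hf : f ∈ G) :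
    ∃ M : ℝ, 0 ≤ M ∧ ∀ a b c, p - 1 ≤ a → a < b → b ≤ c → c ≤ p →
      (b - a) * (f c - f a) ≤ Real.exp (M * (c - a)) * ((f b - f a) * (c - a)) := by
  have ha := H.an f hf
  have hd : AnalyticOnNhd ℝ (deriv f) univ := ha.deriv
  have hdd : AnalyticOnNhd ℝ (deriv (deriv f)) univ := hd.deriv
  have hcd : Continuous (deriv f) := continuousOn_univ.1 hd.continuousOn
  have hcdd : Continuous (deriv (deriv f)) := continuousOn_univ.1 hdd.continuousOn
  have hcomp : IsCompact (Icc (p - 1) p) := isCompact_Icc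
  have hne : (Icc (p - 1) p).Nonempty := ⟨p, by constructor <;> linarith⟩
  obtain ⟨x0, _, hx0⟩ := hcomp.exists_isMinOn hne hcd.continuousOn
  obtain ⟨B, hB⟩ := hcomp.exists_bound_of_continuousOn hcdd.continuousOn
  set m := deriv f x0 with hm
  have hmpos : 0 < m := H.dpos f hf x0
  have hB0 : 0 ≤ B := (norm_nonneg _).trans (hB p ⟨by linarith, le_rfl⟩)
  have hlip : ∀ s ∈ Icc (p-1) p, ∀ t ∈ Icc (p-1) p, deriv f t - deriv f s ≤ B * |t - s| := by
    intro s hs t ht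
    have := (convex_Icc (p-1) p).norm_image_sub_le_of_norm_deriv_le
      (f := deriv f) (fun x _ => (hd x (mem_univ _)).differentiableAt) hB hs ht
    exact (le_abs_self _).trans this
  refine ⟨B / m, by positivity, ?_⟩
  intro a b c h1 h2 h3 h4
  have hdiff : ∀ x, HasDerivAt f (deriv f x) x := fun x =>
    (ha x (mem_univ _)).differentiableAt.hasDerivAt
  obtain ⟨s, hs, hs'⟩ := exists_hasDerivAt_eq_slope f (deriv f) h2 f.continuous.continuousOn
    (fun x _ => hdiff x)
  obtain ⟨t, ht, ht'⟩ := exists_hasDerivAt_eq_slope f (deriv f) (h2.trans_le h3)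
    f.continuous.continuousOn (fun x _ => hdiff x)
  have hac : a < c := h2.trans_le h3
  have e1 : f b - f a = deriv f s * (b - a) := by
    rw [hs']; field_simp [sub_ne_zero.2 h2.ne']
  have e2 : f c - f a = deriv f t * (c - a) := by
    rw [ht']; field_simp [sub_ne_zero.2 hac.ne']
  have hsI : s ∈ Icc (p-1) p := ⟨by linarith [hs.1], by linarith [hs.2]⟩
  have htI : t ∈ Icc (p-1) p := ⟨by linarith [ht.1], by linarith [ht.2]⟩
  have hms : m ≤ deriv f s := hx0 hsI
  have habs : |t - s| ≤ c - a := by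
    rw [abs_le]; constructor <;> linarith [hs.1, hs.2, ht.1, ht.2]
  have hkey : deriv f t ≤ Real.exp (B / m * (c - a)) * deriv f s := by
    have l1 := hlip s hsI t htI
    have l2 : B * |t - s| ≤ B * (c - a) := mul_le_mul_of_nonneg_left habs hB0
    have l3 : B * (c - a) ≤ B / m * (c - a) * deriv f s := by
      have : B * (c - a) = B / m * (c - a) * m := by field_simp
      rw [this]
      exact mul_le_mul_of_nonneg_left hms (mul_nonneg (by positivity) (by linarith))
    have l4 := Real.add_one_le_exp (B / m * (c - a))
    have l5 := mul_le_mul_of_nonneg_right l4 (hmpos.le.trans hms)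
    linarith
  rw [e1, e2]
  have : 0 ≤ (b - a) * (c - a) := mul_nonneg (by linarith) (by linarith)
  have := mul_le_mul_of_nonneg_right hkey this
  linarith

/-- Lower bound for the displacement of positive elements along an orbit of `f`. -/
lemma displacement {G : Subgroup (ℝ ≃o ℝ)} {p : ℝ} {C : Set ℝ} (H : GoodStab G p C)
    {f : ℝ ≃o ℝ} (hf : f ∈ G) (hpos : germLT p 1 f) :
    ∃ δ > 0, ∃ y : ℕ → ℝ, Tendsto y atTop (𝓝[<] p) ∧
      ∀ h ∈ G, ∀ n, y n < h (y n) → δ * (f (y n) - y n) ≤ h (y n) - y n := by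
  obtain ⟨ε, hε, hfx⟩ := eventually_left_iff.1 hpos
  obtain ⟨c, hcC, hc1, hc2⟩ := H.acc (min ε 1) (lt_min hε one_pos)
  obtain ⟨w, hw, hwC⟩ := H.empt c p hc2
  have hfx : ∀ x, c ≤ x → x < p → x < f x := fun x h1 h2 =>
    hfx x (by linarith [min_le_left ε 1]) h2
  have hcp : p - 1 ≤ c := by linarith [min_le_right ε 1]
  set S := C ∩ Icc c w with hS
  have hScl : IsCompact S := isCompact_Icc.inter_left H.closed
  obtain ⟨u, huS, hu⟩ := hScl.exists_isGreatest ⟨c, hcC, le_rfl, hw.1.le⟩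
  have huw : u < w := lt_of_le_of_ne huS.2.2 (fun h => hwC (h ▸ huS.1))
  have hup : u < p := huw.trans hw.2
  have hcu : c ≤ u := huS.2.1
  have hufu : u < f u := hfx u hcu hup
  set v := min w (f u) with hv
  have huv : u < v := lt_min huw hufu
  have hgap : ∀ x ∈ C, u < x → v ≤ x := by
    intro x hx h1
    by_contra h2
    push Not at h2
    have : x ≤ u := hu ⟨hx, by linarith, (h2.trans_le (min_le_left _ _)).le⟩
    linarith
  have hfp : f p = p := H.fix f hf
  have hfG : ∀ n : ℕ, f ^ n ∈ G := fun n => G.pow_mem hf n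
  have hsucc : ∀ n x, (f ^ (n+1)) x = f ((f ^ n) x) := fun n x => by
    rw [pow_succ']; rfl
  have hsucc' : ∀ n x, (f ^ (n+1)) x = (f ^ n) (f x) := fun n x => by
    rw [pow_succ]; rfl
  set y : ℕ → ℝ := fun n => (f ^ n) u with hy
  set z : ℕ → ℝ := fun n => (f ^ n) v with hz
  have hylt : ∀ n, y n < p := fun n => by
    have := (f ^ n).strictMono hup
    rwa [H.fix _ (hfG n)] at this
  have hyu : ∀ n, u ≤ y n := by
    intro n
    induction n with
    | zero => exact le_rfl
    | succ n ih =>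
      have : y (n+1) = f (y n) := hsucc n u
      rw [this]
      exact ih.trans (hfx _ (hcu.trans ih) (hylt n)).le
  have hystep : ∀ n, y (n+1) = f (y n) := fun n => hsucc n u
  have hymono : Monotone y := monotone_nat_of_le_succ fun n => by
    rw [hystep]; exact (hfx _ (hcu.trans (hyu n)) (hylt n)).le
  have hyt : Tendsto y atTop (𝓝 p) := by
    have hb : BddAbove (range y) := ⟨p, by rintro _ ⟨n, rfl⟩; exact (hylt n).le⟩
    have ht := tendsto_atTop_ciSup hymono hb
    set L := ⨆ n, y n
    have hL1 : L ≤ p := ciSup_le fun n => (hylt n).le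
    have hL2 : u ≤ L := (hyu 0).trans (le_ciSup hb 0)
    have hfL : f L = L := by
      have t1 := (f.continuous.tendsto L).comp ht
      have t2 := ht.comp (tendsto_add_atTop_nat 1)
      refine tendsto_nhds_unique t1 (t2.congr fun n => ?_)
      simpa using hystep n
    have : L = p := by
      by_contra hne
      have := hfx L (hcu.trans hL2) (lt_of_le_of_ne hL1 hne)
      linarith
    rwa [this] at ht
  obtain ⟨M, hM, hdist⟩ := distortion_step H hf
  set r := (v - u) / (f u - u) with hr
  have hrpos : 0 < r := div_pos (by linarith) (by linarith)
  have hyz : ∀ n, y n < z n := fun n => (f ^ n).strictMono huv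
  have hzy : ∀ n, z n ≤ y (n+1) := fun n => by
    have : y (n+1) = (f ^ n) (f u) := hsucc' n u
    rw [this]
    exact (f ^ n).monotone (min_le_right _ _)
  have hdis : ∀ n, Real.exp (-(M * (y n - u))) * r * (y (n+1) - y n) ≤ z n - y n := by
    intro n
    induction n with
    | zero =>
      have e0 : y 0 = u := rfl
      have e1 : z 0 = v := rfl
      have e2 : y 1 = f u := hystep 0
      simp only [zero_add, e0, e1, e2, hr]
      have : f u - u ≠ 0 := by linarith
      simp
      field_simp
      exact le_rfl
    | succ n ih =>
      have hd := hdist (y n) (z n) (y (n+1)) (by linarith [hyu n]) (hyz n) (hzy n) (hylt _).le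
      have e1 : z (n+1) = f (z n) := hsucc n v
      rw [← hystep (n+1), ← e1, ← hystep n] at hd
      have hgt : 0 < y (n+1) - y n := by linarith [hyz n, hzy n]
      have hgt' : 0 < y (n+2) - y (n+1) := by linarith [hyz (n+1), hzy (n+1)]
      have e3 : Real.exp (-(M * (y (n+1) - u))) = Real.exp (-(M * (y n - u))) *
          Real.exp (-(M * (y (n+1) - y n))) := by
        rw [← Real.exp_add]; congr 1; ring
      have e4 : Real.exp (-(M * (y (n+1) - y n))) * Real.exp (M * (y (n+1) - y n)) = 1 := by
        rw [← Real.exp_add]; simp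
      have i1 := mul_le_mul_of_nonneg_right ih hgt'.le
      have i2 := i1.trans hd
      have i3 := mul_le_mul_of_nonneg_left i2 (Real.exp_pos (-(M * (y (n+1) - y n)))).le
      rw [← mul_assoc (Real.exp (-(M * (y (n+1) - y n)))) (Real.exp (M * (y (n+1) - y n))), e4,
        one_mul] at i3
      have i4 : (Real.exp (-(M * (y (n+1) - u))) * r * (y (n+2) - y (n+1))) * (y (n+1) - y n)
          ≤ (z (n+1) - y (n+1)) * (y (n+1) - y n) := by
        rw [e3]; refine le_trans (le_of_eq ?_) i3; ring
      exact le_of_mul_le_mul_right i4 hgt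
  refine ⟨Real.exp (-(M * (p - u))) * r, by positivity, y,
    tendsto_nhdsWithin_iff.2 ⟨hyt, Eventually.of_forall hylt⟩, ?_⟩
  intro h hh n hlt
  have hzle : z n ≤ h (y n) := by
    have hin : (f ^ n)⁻¹ (h (y n)) ∈ C := by
      apply H.inv _ (G.inv_mem (hfG n))
      apply H.inv _ hh
      exact H.inv _ (hfG n) _ huS.1
    have h1 : u < (f ^ n)⁻¹ (h (y n)) := by
      have := ((f ^ n)⁻¹).strictMono hlt
      have e : (f ^ n)⁻¹ (y n) = u := RelIso.inv_apply_self (f ^ n) u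
      rwa [e] at this
    have h2 := (f ^ n).monotone (hgap _ hin h1)
    have e : (f ^ n) ((f ^ n)⁻¹ (h (y n))) = h (y n) := RelIso.apply_inv_self (f ^ n) _
    rwa [e] at h2
  have hexp : Real.exp (-(M * (p - u))) ≤ Real.exp (-(M * (y n - u))) := by
    apply Real.exp_le_exp.2
    have := mul_le_mul_of_nonneg_left (hylt n).le hM
    linarith
  have hgt : 0 < y (n+1) - y n := by linarith [hyz n, hzy n]
  have := hdis n
  rw [hystep] at this hgt
  have i := mul_le_mul_of_nonneg_right hexp (mul_pos hrpos hgt).le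
  linarith

lemma expand {G : Subgroup (ℝ ≃o ℝ)} {p : ℝ} {C : Set ℝ} (H : GoodStab G p C)
    {f k : ℝ ≃o ℝ} (hf : f ∈ G) (hk : k ∈ G) (hle : ∀ᶠ x in 𝓝[<] p, k x ≤ f x) :
    ∀ᶠ x in 𝓝[<] p, ∀ x', x ≤ x' → x' < p → deriv f p / 2 * (x' - x) ≤ k x' - k x := by
  have hdk : ∀ x, HasDerivAt k (deriv k x) x := fun x =>
    (H.an k hk x (mem_univ _)).differentiableAt.hasDerivAt
  have hdf : HasDerivAt f (deriv f p) p := (H.an f hf p (mem_univ _)).differentiableAt.hasDerivAt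
  have hge : deriv f p ≤ deriv k p := by
    have t1 := (hasDerivAt_iff_tendsto_slope.1 hdf).mono_left
      (nhdsWithin_mono p (show Iio p ⊆ {p}ᶜ from fun x hx => ne_of_lt hx))
    have t2 := (hasDerivAt_iff_tendsto_slope.1 (hdk p)).mono_left
      (nhdsWithin_mono p (show Iio p ⊆ {p}ᶜ from fun x hx => ne_of_lt hx))
    refine le_of_tendsto_of_tendsto t1 t2 ?_
    filter_upwards [hle, self_mem_nhdsWithin] with x hx hxp
    have hxp : x < p := hxp
    rw [slope_def_field, slope_def_field, H.fix f hf, H.fix k hk]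
    rw [div_le_div_right_of_neg (by linarith)]
    linarith
  have hpos := H.dpos f hf p
  have hcd : Continuous (deriv k) := continuousOn_univ.1 (H.an k hk).deriv.continuousOn
  have hev : ∀ᶠ x in 𝓝[<] p, deriv f p / 2 < deriv k x :=
    (hcd.tendsto p).mono_left nhdsWithin_le_nhds |>.eventually (lt_mem_nhds (by linarith))
  obtain ⟨ε, hε, h⟩ := eventually_left_iff.1 hev
  refine eventually_left_iff.2 ⟨ε, hε, fun x h1 h2 x' h3 h4 => ?_⟩
  rcases h3.eq_or_lt with rfl | h3
  · simp
  obtain ⟨s, hs, hs'⟩ := exists_hasDerivAt_eq_slope k (deriv k) h3 k.continuous.continuousOn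
    (fun x _ => hdk x)
  have e1 : k x' - k x = deriv k s * (x' - x) := by
    rw [hs']; field_simp [sub_ne_zero.2 h3.ne']
  rw [e1]
  exact mul_le_mul_of_nonneg_right (h s (by linarith [hs.1]) (by linarith [hs.2])).le (by linarith)

lemma pow_mono_germ {p : ℝ} {h : ℝ ≃o ℝ} (hpos : germLT p 1 h) (i j : ℕ)
    (hij : i ≤ j) : ∀ᶠ x in 𝓝[<] p, (h ^ i) x ≤ (h ^ j) x := by
  induction j, hij using Nat.le_induction with
  | base => exact Eventually.of_forall fun x => le_rfl
  | succ j _ ih =>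
    filter_upwards [ih, germ_mul_left (h ^ j) hpos] with x h1 h2
    rw [pow_succ]
    rw [mul_one] at h2
    exact h1.trans h2.le

/-- Uniform Archimedean property. -/
lemma archi {G : Subgroup (ℝ ≃o ℝ)} {p : ℝ} {C : Set ℝ} (H : GoodStab G p C)
    {f : ℝ ≃o ℝ} (hf : f ∈ G) (hpos : germLT p 1 f) :
    ∃ N : ℕ, ∀ h ∈ G, germLT p 1 h → germLT p f (h ^ N) := by
  obtain ⟨δ, hδ, y, hy, hdisp⟩ := displacement H hf hpos
  set l := deriv f p / 2 with hl
  have hlpos : 0 < l := half_pos (H.dpos f hf p)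
  obtain ⟨N, hN⟩ := exists_nat_gt (1 / (l * δ))
  have hN : 1 < N * (l * δ) := by
    rwa [div_lt_iff₀ (by positivity)] at hN
  refine ⟨N, fun h hh hhpos => ?_⟩
  by_contra hcon
  have hle : ∀ᶠ x in 𝓝[<] p, (h ^ N) x ≤ f x := by
    rcases germ_tri H hf (G.pow_mem hh N) with e | e | e
    · rw [e]; exact Eventually.of_forall fun x => le_rfl
    · exact absurd e hcon
    · filter_upwards [e] with x hx using hx.le
  have hexp : ∀ i ≤ N, ∀ᶠ x in 𝓝[<] p, ∀ x', x ≤ x' → x' < p →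
      l * (x' - x) ≤ (h ^ i) x' - (h ^ i) x := by
    intro i hi
    apply expand H hf (G.pow_mem hh i)
    filter_upwards [pow_mono_germ hhpos i N hi, hle] with x h1 h2 using h1.trans h2
  have hall : ∀ᶠ x in 𝓝[<] p, ∀ i ∈ Finset.range (N+1), ∀ x', x ≤ x' → x' < p →
      l * (x' - x) ≤ (h ^ i) x' - (h ^ i) x := by
    rw [Filter.eventually_all_finset]
    intro i hi
    exact hexp i (by simpa [Nat.lt_succ_iff] using hi)
  have hev : ∀ᶠ x in 𝓝[<] p, x < p ∧ x < h x ∧ x < f x ∧ (h ^ N) x ≤ f x ∧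
      ∀ i ∈ Finset.range (N+1), ∀ x', x ≤ x' → x' < p →
      l * (x' - x) ≤ (h ^ i) x' - (h ^ i) x := by
    filter_upwards [self_mem_nhdsWithin, hhpos, hpos, hle, hall] with x h1 h2 h3 h4 h5
    exact ⟨h1, h2, h3, h4, h5⟩
  obtain ⟨n, hn1, hn2, hn3, hn4, hn5⟩ := (hy.eventually hev).exists
  have hd := hdisp h hh n hn2
  set x := y n
  have hhx : h x < p := by
    have := h.strictMono hn1
    rwa [H.fix h hh] at this
  have hsum : ∀ i ≤ N, i * (l * (h x - x)) ≤ (h ^ i) x - x := by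
    intro i hi
    induction i with
    | zero => simp
    | succ i ih =>
      have e : (h ^ (i+1)) x = (h ^ i) (h x) := by rw [pow_succ]; rfl
      rw [e]
      have := hn5 i (Finset.mem_range.2 (by omega)) (h x) hn2.le hhx
      have := ih (by omega)
      push_cast
      linarith
  have h1 := hsum N le_rfl
  have h2 : (N:ℝ) * (l * (δ * (f x - x))) ≤ N * (l * (h x - x)) := by gcongr
  have h3 : 0 < f x - x := by linarith
  nlinarith

theorem cyclic_stab {G : Subgroup (ℝ ≃o ℝ)} {p : ℝ} {C : Set ℝ} (H : GoodStab G p C) :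
    ∃ h ∈ G, ∀ g ∈ G, ∃ k : ℤ, g = h ^ k := by
  by_cases hex : ∃ f ∈ G, germLT p 1 f
  swap
  · refine ⟨1, G.one_mem, fun g hg => ⟨0, ?_⟩⟩
    push Not at hex
    rcases germ_tri H G.one_mem hg with e | e | e
    · simp [← e]
    · exact absurd e (hex g hg)
    · have := germ_mul_left g⁻¹ e
      rw [inv_mul_cancel, mul_one] at this
      exact absurd this (hex _ (G.inv_mem hg))
  obtain ⟨f, hf, hfpos⟩ := hex
  have hleast : ∃ h ∈ G, germLT p 1 h ∧ ∀ k ∈ G, germLT p 1 k → ¬ germLT p k h := by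
    obtain ⟨N, hN⟩ := archi H hf hfpos
    let P : ℕ → Prop := fun m => ∃ h ∈ G, germLT p 1 h ∧ ∀ᶠ x in 𝓝[<] p, (h ^ m) x ≤ f x
    have hP1 : P 1 := ⟨f, hf, hfpos, Eventually.of_forall fun x => by simp⟩
    have hbd : ∀ m, P m → m ≤ N := by
      rintro m ⟨h, hh, hhpos, hm⟩
      by_contra hlt
      push Not at hlt
      obtain ⟨x, h1, h2, h3⟩ :=
        (hm.and ((pow_mono_germ hhpos N m hlt.le).and (hN h hh hhpos))).exists
      linarith
    have hm1 : 1 ≤ Nat.findGreatest P N := Nat.le_findGreatest (hbd 1 hP1) hP1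
    have hPm : P (Nat.findGreatest P N) := Nat.findGreatest_spec (hbd 1 hP1) hP1
    set m := Nat.findGreatest P N with hm
    obtain ⟨h, hh, hhpos, hmf⟩ := hPm
    refine ⟨h, hh, hhpos, fun k hk hkpos hkh => ?_⟩
    have hl : ∃ l ∈ G, germLT p 1 l ∧ ∀ᶠ x in 𝓝[<] p, l (l x) ≤ h x := by
      have hq : k⁻¹ * h ∈ G := G.mul_mem (G.inv_mem hk) hh
      have hqpos : germLT p 1 (k⁻¹ * h) := by
        have := germ_mul_left k⁻¹ hkh
        rwa [inv_mul_cancel] at this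
      have hkq : ∀ x, k ((k⁻¹ * h) x) = h x := fun x => RelIso.apply_inv_self k (h x)
      have case : (∀ᶠ x in 𝓝[<] p, k x ≤ (k⁻¹ * h) x) ∨ (∀ᶠ x in 𝓝[<] p, (k⁻¹ * h) x ≤ k x) := by
        rcases germ_tri H hk hq with e | e | e
        · left; rw [← e]; exact Eventually.of_forall fun x => le_rfl
        · left; filter_upwards [e] with x hx using hx.le
        · right; filter_upwards [e] with x hx using hx.le
      rcases case with c | c
      · refine ⟨k, hk, hkpos, ?_⟩
        filter_upwards [c] with x hx
        rw [← hkq x]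
        exact k.monotone hx
      · refine ⟨k⁻¹ * h, hq, hqpos, ?_⟩
        filter_upwards [(tendsto_left (k⁻¹ * h) (H.fix _ hq)).eventually c] with x hx
        rw [← hkq x]
        exact hx
    obtain ⟨l, hlG, hlpos, hl2⟩ := hl
    have hpow : ∀ i : ℕ, ∀ᶠ x in 𝓝[<] p, (l ^ (2 * i)) x ≤ (h ^ i) x := by
      intro i
      induction i with
      | zero => exact Eventually.of_forall fun x => le_rfl
      | succ i ih =>
        filter_upwards [hl2, (tendsto_left h (H.fix h hh)).eventually ih] with x h1 h2
        have e1 : (l ^ (2 * (i+1))) x = (l ^ (2 * i)) (l (l x)) := by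
          rw [show 2 * (i+1) = 2 * i + 1 + 1 by ring, pow_succ, pow_succ]; rfl
        have e2 : (h ^ (i+1)) x = (h ^ i) (h x) := by rw [pow_succ]; rfl
        rw [e1, e2]
        exact ((l ^ (2*i)).monotone h1).trans h2
    have hP2 : P (2 * m) := ⟨l, hlG, hlpos, by
      filter_upwards [hpow m, hmf] with x h1 h2 using h1.trans h2⟩
    have := Nat.le_findGreatest (hbd _ hP2) hP2
    omega
  obtain ⟨h, hh, hhpos, hmin⟩ := hleast
  have hposg : ∀ g ∈ G, germLT p 1 g → ∃ k : ℤ, g = h ^ k := by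
    intro g hg hgpos
    obtain ⟨N, hN⟩ := archi H hg hgpos
    have hN := hN h hh hhpos
    have hexn : ∃ n : ℕ, germLT p g (h ^ n) := ⟨N, hN⟩
    set n := Nat.find hexn with hn
    have hns : germLT p g (h ^ n) := Nat.find_spec hexn
    have hn0 : n ≠ 0 := by
      intro h0
      rw [h0, pow_zero] at hns
      exact germ_irrefl (germ_trans hgpos hns)
    obtain ⟨m, hm⟩ := Nat.exists_eq_succ_of_ne_zero hn0
    have hnot : ¬ germLT p g (h ^ m) := Nat.find_min hexn (by omega)
    refine ⟨m, ?_⟩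
    rw [zpow_natCast]
    rcases germ_tri H hg (G.pow_mem hh m) with e | e | e
    · exact e
    · exact absurd e hnot
    · exfalso
      refine hmin ((h ^ m)⁻¹ * g) (G.mul_mem (G.inv_mem (G.pow_mem hh m)) hg) ?_ ?_
      · have := germ_mul_left (h ^ m)⁻¹ e
        rwa [inv_mul_cancel] at this
      · rw [hm] at hns
        have := germ_mul_left (h ^ m)⁻¹ hns
        rwa [Nat.succ_eq_add_one, pow_succ, inv_mul_cancel_left] at this
  refine ⟨h, hh, fun g hg => ?_⟩
  rcases germ_tri H G.one_mem hg with e | e | e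
  · exact ⟨0, by simp [← e]⟩
  · exact hposg g hg e
  · have := germ_mul_left g⁻¹ e
    rw [inv_mul_cancel, mul_one] at this
    obtain ⟨k, hk⟩ := hposg _ (G.inv_mem hg) this
    exact ⟨-k, by rw [zpow_neg, ← hk, inv_inv]⟩

/-- Powers of a map moving `x` stay away from `x`. -/
lemma zpow_far (h : ℝ ≃o ℝ) (x : ℝ) (hx : h x ≠ x) :
    ∃ η > 0, ∀ k : ℤ, k ≠ 0 → η ≤ |(h ^ k) x - x| := by
  have hnat : ∀ g : ℝ ≃o ℝ, g x ≠ x → ∀ n : ℕ, |g x - x| ≤ |(g ^ (n+1)) x - x| := by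
    intro g hg n
    have hs : ∀ n, (g ^ (n+1)) x = (g ^ n) (g x) := fun n => by rw [pow_succ]; rfl
    rcases lt_or_gt_of_ne hg with h1 | h1
    · have : ∀ n : ℕ, (g ^ (n+1)) x ≤ g x := by
        intro n
        induction n with
        | zero => simp
        | succ n ih =>
          rw [hs (n+1)]
          exact ((g ^ (n+1)).monotone h1.le).trans ih
      have := this n
      rw [abs_of_neg (by linarith), abs_of_neg (by linarith)]
      linarith
    · have : ∀ n : ℕ, g x ≤ (g ^ (n+1)) x := by
        intro n
        induction n with
        | zero => simp
        | succ n ih =>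
          rw [hs (n+1)]
          exact ih.trans ((g ^ (n+1)).monotone h1.le)
      have := this n
      rw [abs_of_pos (by linarith), abs_of_pos (by linarith)]
      linarith
  have hx' : h⁻¹ x ≠ x := by
    intro e
    apply hx
    conv_lhs => rw [← e]
    exact RelIso.apply_inv_self h x
  refine ⟨min |h x - x| |h⁻¹ x - x|, lt_min (abs_pos.2 (sub_ne_zero.2 hx))
    (abs_pos.2 (sub_ne_zero.2 hx')), ?_⟩
  intro k hk
  rcases lt_or_gt_of_ne hk with h1 | h1
  · obtain ⟨n, hn⟩ : ∃ n : ℕ, k = -((n+1 : ℕ) : ℤ) := ⟨(-k).toNat - 1, by omega⟩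
    rw [hn, zpow_neg, zpow_natCast, ← inv_pow]
    exact (min_le_right _ _).trans (hnat _ hx' n)
  · obtain ⟨n, hn⟩ : ∃ n : ℕ, k = ((n+1 : ℕ) : ℤ) := ⟨k.toNat - 1, by omega⟩
    rw [hn, zpow_natCast]
    exact (min_le_left _ _).trans (hnat _ hx n)

/-- The stabilizer acts discretely on every interval. -/
theorem stab_discrete {G : Subgroup (ℝ ≃o ℝ)} {p : ℝ} {C : Set ℝ} (H : GoodStab G p C)
    {a b : ℝ} (hab : a < b) :
    ∃ η > 0, ∀ g ∈ G, g ≠ 1 → ∃ x ∈ Ioo a b, η ≤ |g x - x| := by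
  obtain ⟨h, hh, hcyc⟩ := cyclic_stab H
  by_cases h1 : h = 1
  · refine ⟨1, one_pos, fun g hg hne => ?_⟩
    obtain ⟨k, hk⟩ := hcyc g hg
    rw [h1, one_zpow] at hk
    exact absurd hk hne
  obtain ⟨x, hx, hxne⟩ : ∃ x ∈ Ioo a b, h x ≠ x := by
    by_contra hcon
    push Not at hcon
    apply h1
    have hev : (⇑h) =ᶠ[𝓝 ((a + b) / 2)] (⇑(1 : ℝ ≃o ℝ)) := by
      filter_upwards [Ioo_mem_nhds (show a < (a+b)/2 by linarith) (show (a+b)/2 < b by linarith)]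
        with x hx using hcon x hx
    have := (H.an h hh).eq_of_eventuallyEq (H.an 1 G.one_mem) hev
    ext x
    exact congrFun this x
  obtain ⟨η, hη, hfar⟩ := zpow_far h x hxne
  refine ⟨η, hη, fun g hg hne => ⟨x, hx, ?_⟩⟩
  obtain ⟨k, rfl⟩ := hcyc g hg
  exact hfar k (by rintro rfl; exact hne (zpow_zero _))

/-- Lifts of elements of `Γ` fixing `p`. -/
def liftStab (Γ : Subgroup (S1 ≃ₜ S1)) (p : ℝ) : Subgroup (ℝ ≃o ℝ) where
  carrier := {g | (∃ f ∈ Γ, ∀ x : ℝ, f (x : S1) = ((g x : ℝ) : S1)) ∧ g p = p}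
  mul_mem' := by
    rintro a b ⟨⟨f, hf, hf'⟩, ha⟩ ⟨⟨g, hg, hg'⟩, hb⟩
    refine ⟨⟨f * g, Γ.mul_mem hf hg, fun x => ?_⟩, ?_⟩
    · change f (g (x : S1)) = ((a (b x) : ℝ) : S1)
      rw [hg', hf']
    · change a (b p) = p
      rw [hb, ha]
  one_mem' := ⟨⟨1, Γ.one_mem, fun x => rfl⟩, rfl⟩
  inv_mem' := by
    rintro a ⟨⟨f, hf, hf'⟩, ha⟩
    have haa : ∀ x, a (a⁻¹ x) = x := fun x => RelIso.apply_inv_self a x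
    refine ⟨⟨f⁻¹, Γ.inv_mem hf, fun x => ?_⟩, ?_⟩
    · change f.symm (x : S1) = _
      rw [Homeomorph.symm_apply_eq, hf', haa]
    · apply a.injective
      rw [haa, ha]

lemma S1_coe_eq {x y : ℝ} (h : (x : S1) = (y : S1)) : ∃ n : ℤ, x - y = n := by
  have h0 : ((x - y : ℝ) : S1) = 0 := by
    rw [AddCircle.coe_sub, h, sub_self]
  obtain ⟨n, hn⟩ := (AddCircle.coe_eq_zero_iff (1 : ℝ)).1 h0
  exact ⟨n, by rw [← hn]; simp⟩

/-- Two continuous lifts of the same map differ by a constant. -/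
lemma lifts_differ {f g : ℝ → ℝ} (hf : Continuous f) (hg : Continuous g)
    (h : ∀ x, ((f x : ℝ) : S1) = ((g x : ℝ) : S1)) : ∃ c : ℝ, ∀ x, f x = g x + c := by
  choose n hn using fun x => S1_coe_eq (h x)
  have hc : Continuous n := by
    rw [Int.isClosedEmbedding_coe_real.isEmbedding.continuous_iff]
    have : (Int.cast ∘ n : ℝ → ℝ) = fun x => f x - g x := by
      ext x; exact (hn x).symm
    rw [this]
    exact hf.sub hg
  refine ⟨n 0, fun x => ?_⟩
  have : n x = n 0 := PreconnectedSpace.constant inferInstance hc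
  rw [← this, ← hn]
  ring

lemma cantor_acc (x : ℕ → Bool) : (𝓝[≠] x).NeBot := by
  rw [← mem_closure_iff_nhdsWithin_neBot]
  let s : ℕ → (ℕ → Bool) := fun n => Function.update x n (!(x n))
  have hs : Tendsto s atTop (𝓝 x) := by
    rw [tendsto_pi_nhds]
    intro i
    refine tendsto_const_nhds.congr' ?_
    filter_upwards [eventually_gt_atTop i] with n hn
    simp [s, Function.update_of_ne hn.ne]
  refine mem_closure_of_tendsto hs (Eventually.of_forall fun n => ?_)
  intro h
  have := congrFun h n
  simp [s] at this

lemma preimage_acc {C : Set S1} (e : C ≃ₜ (ℕ → Bool)) {p : ℝ} (hp : (p : S1) ∈ C) {ε : ℝ}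
    (hε : 0 < ε) : ∃ c : ℝ, (c : S1) ∈ C ∧ c ≠ p ∧ |c - p| < ε := by
  have hopen : IsOpen ((fun x : ℝ => (x : S1)) '' (Ioo (p - ε) (p + ε))) :=
    QuotientAddGroup.isOpenMap_coe _ isOpen_Ioo
  set U : Set C := Subtype.val ⁻¹' ((fun x : ℝ => (x : S1)) '' (Ioo (p - ε) (p + ε))) with hU
  have hUo : IsOpen U := hopen.preimage continuous_subtype_val
  have hVo : IsOpen (e.symm ⁻¹' U) := hUo.preimage e.symm.continuous
  have hmem : e ⟨p, hp⟩ ∈ e.symm ⁻¹' U := by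
    simp only [mem_preimage, Homeomorph.symm_apply_apply, hU]
    exact ⟨p, ⟨by linarith, by linarith⟩, rfl⟩
  have := cantor_acc (e ⟨p, hp⟩)
  have hev : ∀ᶠ z in 𝓝[≠] (e ⟨p, hp⟩), z ∈ e.symm ⁻¹' U ∧ z ≠ e ⟨p, hp⟩ :=
    (Filter.Eventually.filter_mono nhdsWithin_le_nhds (hVo.eventually_mem hmem)).and
      self_mem_nhdsWithin
  obtain ⟨z, hz, hzne⟩ := hev.exists
  obtain ⟨c, hc, hce⟩ := hz
  refine ⟨c, ?_, ?_, ?_⟩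
  · change (fun x : ℝ => (x : S1)) c ∈ C
    rw [hce]; exact (e.symm z).2
  · rintro rfl
    apply hzne
    rw [← e.symm_apply_eq]
    exact Subtype.ext hce.symm
  · rw [abs_lt]; constructor <;> linarith [hc.1, hc.2]

lemma preimage_empt {C : Set S1} (e : C ≃ₜ (ℕ → Bool)) {a b : ℝ} (hab : a < b) :
    ∃ w ∈ Ioo a b, ((w : ℝ) : S1) ∉ C := by
  by_contra hcon
  push Not at hcon
  have htd : TotallyDisconnectedSpace C := e.symm.totallyDisconnectedSpace
  have hC : IsTotallyDisconnected C := totallyDisconnectedSpace_subtype_iff.1 htd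
  have hsub := hC ((fun x : ℝ => (x : S1)) '' Ioo a b) (by rintro _ ⟨x, hx, rfl⟩; exact hcon x hx)
    (isPreconnected_Ioo.image _ (AddCircle.continuous_mk' 1).continuousOn)
  obtain ⟨d, hd0, hd1, hd2⟩ : ∃ d, 0 < d ∧ d < 1 ∧ d < b - a := by
    refine ⟨min 1 (b - a) / 2, ?_, ?_, ?_⟩
    · have : 0 < min 1 (b - a) := lt_min one_pos (by linarith)
      linarith
    · linarith [min_le_left 1 (b - a)]
    · linarith [min_le_right 1 (b - a)]
  have h1 : a + (b - a - d) / 2 + d ∈ Ioo a b := ⟨by linarith, by linarith⟩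
  have h2 : a + (b - a - d) / 2 ∈ Ioo a b := ⟨by linarith, by linarith⟩
  have := hsub ⟨_, h1, rfl⟩ ⟨_, h2, rfl⟩
  obtain ⟨n, hn⟩ := S1_coe_eq this
  have hn' : d = n := by linarith
  rw [hn'] at hd0 hd1
  have : 0 < n := by exact_mod_cast hd0
  have : n < 1 := by exact_mod_cast hd1
  omega

/-- A subgroup of `Diff^ω₊(S¹)` which is locally nondiscrete with respect to
the `C⁰`-topology has no exceptional minimal set (a nonempty closed invariant minimal subset
homeomorphic to a Cantor set). -/
theorem no_exceptional_minimal_set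
    (Γ : Subgroup (S1 ≃ₜ S1)) (hΓ : ∀ f ∈ Γ, IsAnalyticDiffeo f)
    (hnd : LocallyC0Nondiscrete Γ) :
    ¬ ∃ C : Set S1, C.Nonempty ∧ IsClosed C ∧ (∀ γ ∈ Γ, ⇑γ '' C = C) ∧
        (∀ C' : Set S1, C' ⊆ C → C'.Nonempty → IsClosed C' →
          (∀ γ ∈ Γ, ⇑γ '' C' = C') → C' = C) ∧
        Nonempty (C ≃ₜ (ℕ → Bool)) := by
  rintro ⟨C, hCne, hCcl, hCinv, -, ⟨e⟩⟩
  obtain ⟨a, b, hab, -, f, F, hfF, hconv⟩ := hnd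
  set D : Set ℝ := {x : ℝ | (x : S1) ∈ C} with hD
  have hDcl : IsClosed D := hCcl.preimage (AddCircle.continuous_mk' 1)
  obtain ⟨x0, hx0, hx0C⟩ := preimage_empt e hab
  have hopen : IsOpen (Dᶜ ∩ Ioo a b) := hDcl.isOpen_compl.inter isOpen_Ioo
  obtain ⟨η, hη, hball⟩ := Metric.isOpen_iff.1 hopen x0 ⟨hx0C, hx0⟩
  rw [Real.ball_eq_Ioo] at hball
  have hper : ∀ x : ℝ, x ∈ D → ∀ n : ℤ, x + n ∈ D := by
    intro x hx n
    have : ((x + n : ℝ) : S1) = (x : S1) := by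
      rw [AddCircle.coe_add]
      have : ((n : ℝ) : S1) = 0 := (AddCircle.coe_eq_zero_iff (1 : ℝ)).2 ⟨n, by simp⟩
      rw [this, add_zero]
    change ((x + n : ℝ) : S1) ∈ C
    rw [this]; exact hx
  obtain ⟨c0, hc0⟩ : ∃ c0 : ℝ, c0 ∈ D := by
    obtain ⟨c, hc⟩ := hCne
    obtain ⟨x, rfl⟩ := QuotientAddGroup.mk_surjective c
    exact ⟨x, hc⟩
  have hDx : (D ∩ Iic x0).Nonempty := by
    obtain ⟨n, hn⟩ := exists_int_gt (c0 - x0)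
    refine ⟨c0 + ((-n : ℤ) : ℝ), hper _ hc0 _, ?_⟩
    push_cast
    simp only [mem_Iic]; linarith
  have hbdd : BddAbove (D ∩ Iic x0) := ⟨x0, fun x hx => hx.2⟩
  set p := sSup (D ∩ Iic x0) with hp
  have hpmem : p ∈ D ∩ Iic x0 := (hDcl.inter isClosed_Iic).csSup_mem hDx hbdd
  have hpub : ∀ x ∈ D, x ≤ x0 → x ≤ p := fun x hx hx' => le_csSup hbdd ⟨hx, hx'⟩
  have hpx0 : p < x0 := lt_of_le_of_ne hpmem.2 (fun h => hx0C (h ▸ hpmem.1))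
  have hinv : ∀ g : ℝ ≃o ℝ, ∀ f ∈ Γ, (∀ x : ℝ, f (x : S1) = ((g x : ℝ) : S1)) →
      ∀ x, x ∈ D ↔ g x ∈ D := by
    intro g f hf hfg x
    change (x : S1) ∈ C ↔ ((g x : ℝ) : S1) ∈ C
    rw [← hfg]
    constructor
    · intro h
      rw [← hCinv f hf]; exact ⟨_, h, rfl⟩
    · intro h
      rw [← hCinv f hf] at h
      obtain ⟨y, hy, hyx⟩ := h
      rwa [← f.injective hyx]
  have H : GoodStab (liftStab Γ p) p D := by
    have hform : ∀ g ∈ liftStab Γ p, ∃ (F' : CircleDeg1Liftˣ) (c : ℝ),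
        AnalyticOnNhd ℝ (⇑(F' : CircleDeg1Lift)) Set.univ ∧
        (∀ x : ℝ, 0 < deriv (⇑(F' : CircleDeg1Lift)) x) ∧
        (⇑g) = fun x => (F' : CircleDeg1Lift) x + c := by
      rintro g ⟨⟨f, hf, hfg⟩, -⟩
      obtain ⟨F', hl, han, hd⟩ := hΓ f hf
      obtain ⟨c, hc⟩ := lifts_differ g.continuous (continuousOn_univ.1 han.continuousOn)
        (fun x => by rw [← hfg, hl])
      exact ⟨F', c, han, hd, funext hc⟩
    refine ⟨?_, ?_, fun g hg => hg.2, ?_, hDcl, ?_, fun a b h => preimage_empt e h⟩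
    · intro g hg
      obtain ⟨F', c, han, hd, hc⟩ := hform g hg
      rw [hc]
      exact han.add analyticOnNhd_const
    · intro g hg x
      obtain ⟨F', c, han, hd, hc⟩ := hform g hg
      rw [hc, deriv_add_const]
      exact hd x
    · rintro g ⟨⟨f, hf, hfg⟩, -⟩ x hx
      exact (hinv g f hf hfg x).1 hx
    · intro ε hε
      obtain ⟨c, hcC, hcne, hcε⟩ := preimage_acc e hpmem.1 (lt_min hε (sub_pos.2 hpx0))
      obtain ⟨h1, h2⟩ := abs_lt.1 hcε
      have h3 := min_le_left ε (x0 - p)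
      have h4 := min_le_right ε (x0 - p)
      exact ⟨c, hcC, by linarith, lt_of_le_of_ne (hpub c hcC (by linarith)) hcne⟩
  obtain ⟨κ, hκ, hfar⟩ := stab_discrete H hab
  obtain ⟨N, hN⟩ := hconv (min η κ) (lt_min hη hκ)
  have hN := hN N le_rfl
  obtain ⟨hfΓ, hf1, hlift⟩ := hfF N
  set g : ℝ ≃o ℝ := CircleDeg1Lift.toOrderIso (F N) with hg
  have hgx : ∀ x, g x = (F N : CircleDeg1Lift) x := fun x => rfl
  have hlift' : ∀ x : ℝ, (f N) (x : S1) = ((g x : ℝ) : S1) := hlift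
  have hinvg := hinv g (f N) hfΓ hlift'
  have hgx0 : |g x0 - x0| < η := (hN x0 hx0).trans_le (min_le_left _ _)
  obtain ⟨hg1, hg2⟩ := abs_lt.1 hgx0
  have hnoD : ∀ y, x0 - η < y → y < x0 + η → y ∉ D := fun y h1 h2 => (hball ⟨h1, h2⟩).1
  have hgp : g p = p := by
    apply le_antisymm
    · have h1 : g p ∈ D := (hinvg p).1 hpmem.1
      have h2 : g p < g x0 := g.strictMono hpx0
      apply hpub _ h1
      by_contra h3
      push Not at h3
      exact hnoD _ (by linarith) (by linarith) h1
    · have h1 : g (g.symm p) = p := g.apply_symm_apply p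
      have h2 : g.symm p ∈ D := (hinvg _).2 (h1.symm ▸ hpmem.1)
      have h3 : p < g x0 := by
        by_contra h3
        push Not at h3
        exact hnoD p (by linarith) (by linarith) hpmem.1
      have h4 : g.symm p ≤ p := by
        apply hpub _ h2
        rw [← g.le_iff_le, h1]; exact h3.le
      have := g.monotone h4
      rwa [h1] at this
  have hgG : g ∈ liftStab Γ p := ⟨⟨f N, hfΓ, hlift'⟩, hgp⟩
  have hg1 : g ≠ 1 := by
    intro h
    apply hf1
    apply Homeomorph.ext
    intro y
    obtain ⟨x, rfl⟩ := QuotientAddGroup.mk_surjective y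
    have := hlift' x
    rw [h] at this
    exact this
  obtain ⟨x, hx, hxκ⟩ := hfar g hgG hg1
  have := (hN x hx).trans_le (min_le_right _ _)
  rw [← hgx] at this
  linarith

end
end
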